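/- Let d ≥ 2 be an integer. There exists d₀ = d₀(d) ∈ (d/2, d) such that for every p ∈ (d₀, d) and μ ∈ (1, d/p) there exist constants b̂ > 0 and ν > 1 (depending only on d, p, μ), and, for each R₀ ∈ (0,1], a constant N = N(d, p, μ, R₀) with the following property. Let b : ℝ^d → ℝ^d be measurable and satisfy r·(⨍_B |b|^{pμ} dx)^{1/(pμ)} ≤ b̂ for every ball B ⊂ ℝ^d of radius r ≤ R₀. Let 0 < ρ ≤ min(R₀, 1/ν), let u be twice continuously differentiable on B̄_ρ, and let f be measurable on B_ρ with Δu(x) + b(x)·Du(x) + f(x) = 0 for almost every x ∈ B_ρ and ‖f‖_{E_{p,μ}(B_ρ)} < ∞. Then ‖D²u‖_{E_{p,μ}(B_{ρ/3})} ≤ N ρ^{−2} ‖u‖_{E_{p,μ}(B_ρ)} + N ρ^{μ−2} sup_{B_ρ} |u| + N ‖f‖_{E_{p,μ}(B_ρ)}. -/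

import Mathlib

open MeasureTheory Metric Set Filter
open scoped ENNReal RealInnerProductSpace

noncomputable section

/-- Euclidean space `ℝ^d`. -/
abbrev E (d : ℕ) : Type := EuclideanSpace ℝ (Fin d)

/-- Frobenius norm of a `d × d` matrix. -/
def frob {d : ℕ} (m : Matrix (Fin d) (Fin d) ℝ) : ℝ :=
  Real.sqrt (∑ i, ∑ j, (m i j) ^ 2)

/-- `F` is `δ`-elliptic: `δ tr w ≤ F (m + w) - F m ≤ δ⁻¹ tr w` for symmetric `m` and
symmetric positive semidefinite `w`. -/
def Elliptic {d : ℕ} (δ : ℝ) (F : Matrix (Fin d) (Fin d) ℝ → ℝ) : Prop :=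
  ∀ m : Matrix (Fin d) (Fin d) ℝ, m.IsSymm →
    ∀ w : Matrix (Fin d) (Fin d) ℝ, w.PosSemidef →
      δ * w.trace ≤ F (m + w) - F m ∧ F (m + w) - F m ≤ δ⁻¹ * w.trace

/-- Gradient of `u : ℝ^d → ℝ` as a vector in `ℝ^d`. -/
def grad {d : ℕ} (u : E d → ℝ) (x : E d) : E d :=
  (EuclideanSpace.equiv (Fin d) ℝ).symm fun i => fderiv ℝ u x (EuclideanSpace.single i 1)

/-- Hessian matrix of `u : ℝ^d → ℝ`. -/
def hess {d : ℕ} (u : E d → ℝ) (x : E d) : Matrix (Fin d) (Fin d) ℝ :=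
  Matrix.of fun i j =>
    fderiv ℝ (fun y => fderiv ℝ u y (EuclideanSpace.single j 1)) x (EuclideanSpace.single i 1)

/-- Normalized `L_p` norm `(⨍_B |g|^p)^{1/p}` (average over `B`). -/
def nLp {d : ℕ} (p : ℝ) (B : Set (E d)) (g : E d → ℝ) : ℝ≥0∞ :=
  ((volume B)⁻¹ * ∫⁻ y in B, ENNReal.ofReal (|g y| ^ p)) ^ (1 / p)

/-- Unnormalized `L_p` norm `(∫_A |g|^p)^{1/p}`. -/
def Lpn {d : ℕ} (p : ℝ) (A : Set (E d)) (g : E d → ℝ) : ℝ≥0∞ :=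
  (∫⁻ y in A, ENNReal.ofReal (|g y| ^ p)) ^ (1 / p)

/-- Morrey norm `‖g‖_{E_{p,μ}(Ω)} = sup_{ρ>0, x∈Ω} ρ^μ (⨍_{B_ρ(x)} |g 1_Ω|^p)^{1/p}`. -/
def morrey {d : ℕ} (p μ : ℝ) (Ω : Set (E d)) (g : E d → ℝ) : ℝ≥0∞ :=
  ⨆ (ρ : ℝ) (_ : 0 < ρ) (x : E d) (_ : x ∈ Ω),
    ENNReal.ofReal (ρ ^ μ) * nLp p (ball x ρ) (Ω.indicator g)

/-- The `(θ, R₀)`-oscillation condition on `F(m, x)`. -/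
def OscCond {d : ℕ} (δ θ R₀ : ℝ) (F : Matrix (Fin d) (Fin d) ℝ → E d → ℝ) : Prop :=
  ∀ r ∈ Set.Ioc (0 : ℝ) R₀, ∀ z : E d,
    ∃ Fb : Matrix (Fin d) (Fin d) ℝ → ℝ,
      ConvexOn ℝ Set.univ Fb ∧ Elliptic δ Fb ∧ Fb 0 = 0 ∧
      ∀ m : Matrix (Fin d) (Fin d) ℝ, m.IsSymm → frob m = 1 →
        (volume (ball z r))⁻¹ *
            ∫⁻ x in ball z r,
              ⨆ (τ : ℝ) (_ : 0 < τ), ENNReal.ofReal (τ⁻¹ * |F (τ • m) x - Fb (τ • m)|)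
          ≤ ENNReal.ofReal θ

/-- The homogeneity bound `|F(ζ m, x)| ≤ ζ |F(m, x)| + K(x)` for `ζ ∈ [0,1]`. -/
def HomBound {d : ℕ} (F : Matrix (Fin d) (Fin d) ℝ → E d → ℝ) (K : E d → ℝ) : Prop :=
  ∀ ζ ∈ Set.Icc (0 : ℝ) 1, ∀ m : Matrix (Fin d) (Fin d) ℝ, m.IsSymm → ∀ x : E d,
    |F (ζ • m) x| ≤ ζ * |F m x| + K x

/-! The Bellman function -/

namespace Bell

/-- parameters: `p > 2`, conjugate exponent `q`, `γ = (2-q)/q`. -/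
structure Par where
  p : ℝ
  q : ℝ
  k : ℝ
  hp : 2 < p
  hq : 1 < q
  hq2 : q < 2
  hpq : 1 / p + 1 / q = 1
  hk : 0 < k

variable (P : Par)

def Par.g : ℝ := (2 - P.q) / P.q
def Par.C : ℝ := (1 + P.q ^ 2 + (2 + P.p) ^ 2 * P.q ^ 2) / (P.q * (P.q - 1))

def rr (z : ℝ) : ℝ := z ^ 2 + P.k ^ 2
def W (z e : ℝ) : ℝ := (rr P z) ^ (P.p / 2) + (rr P e) ^ (P.q / 2)
def Wz (z : ℝ) : ℝ := P.p * z * (rr P z) ^ (P.p / 2 - 1)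
def We (e : ℝ) : ℝ := P.q * e * (rr P e) ^ (P.q / 2 - 1)
def Wzz (z : ℝ) : ℝ := P.p * (rr P z) ^ (P.p / 2 - 1) + P.p * (P.p - 2) * z ^ 2 * (rr P z) ^ (P.p / 2 - 2)
def Wee (e : ℝ) : ℝ := P.q * (rr P e) ^ (P.q / 2 - 1) + P.q * (P.q - 2) * e ^ 2 * (rr P e) ^ (P.q / 2 - 2)
def B (z e : ℝ) : ℝ := z ^ 2 * (W P z e) ^ P.g + P.C * (rr P e) ^ (P.q / 2)
def Bz (z e : ℝ) : ℝ := 2 * z * (W P z e) ^ P.g + P.g * z ^ 2 * (W P z e) ^ (P.g - 1) * Wz P z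
def Be (z e : ℝ) : ℝ := P.g * z ^ 2 * (W P z e) ^ (P.g - 1) * We P e + P.C * We P e
def Bzz (z e : ℝ) : ℝ := 2 * (W P z e) ^ P.g + 4 * P.g * z * (W P z e) ^ (P.g - 1) * Wz P z
  + P.g * z ^ 2 * (W P z e) ^ (P.g - 1) * Wzz P z
  + P.g * (P.g - 1) * z ^ 2 * (W P z e) ^ (P.g - 2) * Wz P z ^ 2
def Bze (z e : ℝ) : ℝ := 2 * P.g * z * (W P z e) ^ (P.g - 1) * We P e
  + P.g * (P.g - 1) * z ^ 2 * (W P z e) ^ (P.g - 2) * Wz P z * We P e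
def Bee (z e : ℝ) : ℝ := P.g * z ^ 2 * (W P z e) ^ (P.g - 1) * Wee P e
  + P.g * (P.g - 1) * z ^ 2 * (W P z e) ^ (P.g - 2) * We P e ^ 2 + P.C * Wee P e

lemma rr_pos (z : ℝ) : 0 < rr P z := by
  have := P.hk; unfold rr; positivity

lemma W_pos (z e : ℝ) : 0 < W P z e := by
  have h1 := rr_pos P z; have h2 := rr_pos P e
  unfold W; positivity

lemma hasDerivAt_rr {F : ℝ → ℝ} {a t : ℝ} (hF : HasDerivAt F a t) :
    HasDerivAt (fun t => rr P (F t)) (2 * F t * a) t := by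
  unfold rr
  refine HasDerivAt.congr_deriv ((hF.pow 2).add_const (P.k ^ 2)) ?_
  simp

lemma hasDerivAt_rr_rpow {F : ℝ → ℝ} {a t : ℝ} (c : ℝ) (hF : HasDerivAt F a t) :
    HasDerivAt (fun t => rr P (F t) ^ c) (2 * c * F t * (rr P (F t)) ^ (c - 1) * a) t := by
  refine HasDerivAt.congr_deriv ((hasDerivAt_rr P hF).rpow_const (p := c) (Or.inl (rr_pos P (F t)).ne')) ?_
  ring

lemma hasDerivAt_W {F G : ℝ → ℝ} {a b t : ℝ} (hF : HasDerivAt F a t) (hG : HasDerivAt G b t) :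
    HasDerivAt (fun t => W P (F t) (G t)) (Wz P (F t) * a + We P (G t) * b) t := by
  unfold W Wz We
  refine HasDerivAt.congr_deriv ((hasDerivAt_rr_rpow P (P.p / 2) hF).add (hasDerivAt_rr_rpow P (P.q / 2) hG)) ?_
  ring

lemma hasDerivAt_W_rpow {F G : ℝ → ℝ} {a b t : ℝ} (c : ℝ) (hF : HasDerivAt F a t)
    (hG : HasDerivAt G b t) :
    HasDerivAt (fun t => W P (F t) (G t) ^ c)
      (c * W P (F t) (G t) ^ (c - 1) * (Wz P (F t) * a + We P (G t) * b)) t := by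
  refine HasDerivAt.congr_deriv ((hasDerivAt_W P hF hG).rpow_const (p := c) (Or.inl (W_pos P (F t) (G t)).ne')) ?_
  ring

lemma hasDerivAt_Wz {F : ℝ → ℝ} {a t : ℝ} (hF : HasDerivAt F a t) :
    HasDerivAt (fun t => Wz P (F t)) (Wzz P (F t) * a) t := by
  unfold Wz Wzz
  refine HasDerivAt.congr_deriv ((hF.const_mul P.p).mul (hasDerivAt_rr_rpow P (P.p / 2 - 1) hF)) ?_
  rw [show P.p / 2 - 1 - 1 = P.p / 2 - 2 by ring]
  ring

lemma hasDerivAt_We {F : ℝ → ℝ} {a t : ℝ} (hF : HasDerivAt F a t) :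
    HasDerivAt (fun t => We P (F t)) (Wee P (F t) * a) t := by
  unfold We Wee
  refine HasDerivAt.congr_deriv ((hF.const_mul P.q).mul (hasDerivAt_rr_rpow P (P.q / 2 - 1) hF)) ?_
  rw [show P.q / 2 - 1 - 1 = P.q / 2 - 2 by ring]
  ring

lemma hasDerivAt_B {F G : ℝ → ℝ} {a b t : ℝ} (hF : HasDerivAt F a t) (hG : HasDerivAt G b t) :
    HasDerivAt (fun t => B P (F t) (G t)) (Bz P (F t) (G t) * a + Be P (F t) (G t) * b) t := by
  unfold B Bz Be
  refine HasDerivAt.congr_deriv (((hF.pow 2).mul (hasDerivAt_W_rpow P P.g hF hG)).add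
    ((hasDerivAt_rr_rpow P (P.q / 2) hG).const_mul P.C)) ?_
  unfold We
  simp only [Nat.cast_ofNat, Nat.add_one_sub_one, pow_one, Pi.pow_apply]
  ring

lemma hasDerivAt_Bz {F G : ℝ → ℝ} {a b t : ℝ} (hF : HasDerivAt F a t) (hG : HasDerivAt G b t) :
    HasDerivAt (fun t => Bz P (F t) (G t)) (Bzz P (F t) (G t) * a + Bze P (F t) (G t) * b) t := by
  unfold Bz Bzz Bze
  refine HasDerivAt.congr_deriv (((hF.const_mul 2).mul (hasDerivAt_W_rpow P P.g hF hG)).add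
    ((((hF.pow 2).const_mul P.g).mul (hasDerivAt_W_rpow P (P.g - 1) hF hG)).mul
      (hasDerivAt_Wz P hF))) ?_
  simp only [Nat.cast_ofNat, Nat.add_one_sub_one, pow_one, Pi.pow_apply, Pi.mul_apply]
  rw [show P.g - 1 - 1 = P.g - 2 by ring]
  ring

lemma hasDerivAt_Be {F G : ℝ → ℝ} {a b t : ℝ} (hF : HasDerivAt F a t) (hG : HasDerivAt G b t) :
    HasDerivAt (fun t => Be P (F t) (G t)) (Bze P (F t) (G t) * a + Bee P (F t) (G t) * b) t := by
  unfold Be Bee Bze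
  refine HasDerivAt.congr_deriv (((((hF.pow 2).const_mul P.g).mul (hasDerivAt_W_rpow P (P.g - 1) hF hG)).mul
      (hasDerivAt_We P hG)).add ((hasDerivAt_We P hG).const_mul P.C)) ?_
  simp only [Nat.cast_ofNat, Nat.add_one_sub_one, pow_one, Pi.pow_apply, Pi.mul_apply]
  rw [show P.g - 1 - 1 = P.g - 2 by ring]
  ring

lemma cont_rr : Continuous (rr P) := by unfold rr; fun_prop

lemma cont_rr_rpow (c : ℝ) : Continuous (fun z => rr P z ^ c) :=
  (cont_rr P).rpow_const (fun z => Or.inl (rr_pos P z).ne')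

lemma cont_W_rpow (c : ℝ) : Continuous (fun z : ℝ × ℝ => W P z.1 z.2 ^ c) := by
  refine Continuous.rpow_const ?_ (fun z => Or.inl (W_pos P z.1 z.2).ne')
  unfold W
  exact ((cont_rr_rpow P _).comp continuous_fst).add ((cont_rr_rpow P _).comp continuous_snd)

lemma cont_Wz : Continuous (Wz P) := by
  unfold Wz; have := cont_rr_rpow P (P.p / 2 - 1); fun_prop
lemma cont_We : Continuous (We P) := by
  unfold We; have := cont_rr_rpow P (P.q / 2 - 1); fun_prop
lemma cont_Wzz : Continuous (Wzz P) := by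
  unfold Wzz; have := cont_rr_rpow P (P.p / 2 - 1); have := cont_rr_rpow P (P.p / 2 - 2); fun_prop
lemma cont_Wee : Continuous (Wee P) := by
  unfold Wee; have := cont_rr_rpow P (P.q / 2 - 1); have := cont_rr_rpow P (P.q / 2 - 2); fun_prop

lemma cont_B : Continuous (fun z : ℝ × ℝ => B P z.1 z.2) := by
  unfold B
  have h1 := cont_W_rpow P P.g
  have h2 := (cont_rr_rpow P (P.q / 2)).comp (continuous_snd (X := ℝ) (Y := ℝ))
  exact ((continuous_fst.pow 2).mul h1).add (h2.const_mul _)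

lemma cont_Bz : Continuous (fun z : ℝ × ℝ => Bz P z.1 z.2) := by
  unfold Bz
  have h1 := cont_W_rpow P P.g
  have h1' := cont_W_rpow P (P.g - 1)
  have h2 := cont_Wz P
  fun_prop

lemma cont_Be : Continuous (fun z : ℝ × ℝ => Be P z.1 z.2) := by
  unfold Be
  have h1' := cont_W_rpow P (P.g - 1)
  have h2 := cont_We P
  fun_prop

lemma cont_Bzz : Continuous (fun z : ℝ × ℝ => Bzz P z.1 z.2) := by
  unfold Bzz
  have h1 := cont_W_rpow P P.g
  have h1' := cont_W_rpow P (P.g - 1)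
  have h1'' := cont_W_rpow P (P.g - 2)
  have h2 := cont_Wz P
  have h3 := cont_Wzz P
  fun_prop

lemma cont_Bze : Continuous (fun z : ℝ × ℝ => Bze P z.1 z.2) := by
  unfold Bze
  have h1' := cont_W_rpow P (P.g - 1)
  have h1'' := cont_W_rpow P (P.g - 2)
  have h2 := cont_Wz P
  have h3 := cont_We P
  fun_prop

lemma cont_Bee : Continuous (fun z : ℝ × ℝ => Bee P z.1 z.2) := by
  unfold Bee
  have h1' := cont_W_rpow P (P.g - 1)
  have h1'' := cont_W_rpow P (P.g - 2)
  have h2 := cont_Wee P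
  have h3 := cont_We P
  fun_prop

lemma g_pos : 0 < P.g := by
  have := P.hq; have := P.hq2; unfold Par.g; apply div_pos <;> linarith
lemma g_eq : 1 - P.g = 2 / P.p := by
  have h := P.hpq; have := P.hq; have := P.hp
  unfold Par.g; field_simp at h ⊢; nlinarith
lemma g_lt : P.g < 1 := by
  have := g_eq P; have h : 0 < 2 / P.p := by have := P.hp; positivity
  linarith
lemma g_eq2 : P.q / 2 * P.g = 1 - P.q / 2 := by
  have := P.hq; unfold Par.g; field_simp
lemma g_eq3 : P.p / 2 * P.g = P.p / 2 - 1 := by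
  have := g_eq P; have hp := P.hp
  have : P.g = 1 - 2 / P.p := by linarith
  rw [this]; field_simp

set_option maxHeartbeats 1000000 in
/-- Lower bound of the Hessian of the Bellman function. -/
lemma hess_lower (z e a b : ℝ) :
    (W P z e) ^ P.g * a ^ 2 + (rr P e) ^ (P.q / 2 - 1) * b ^ 2
      ≤ Bzz P z e * a ^ 2 + 2 * Bze P z e * (a * b) + Bee P z e * b ^ 2 := by
  have hp := P.hp; have hq := P.hq; have hq2 := P.hq2
  have hg := g_pos P; have hg1 := g_lt P
  have hW := W_pos P z e
  have hr := rr_pos P z; have hs := rr_pos P e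
  set w := W P z e with hw
  set r := rr P z with hrdef
  set s := rr P e with hsdef
  set g := P.g with hgdef
  have hz2 : z ^ 2 ≤ r := by rw [hrdef]; unfold rr; nlinarith [sq_nonneg P.k]
  have he2 : e ^ 2 ≤ s := by rw [hsdef]; unfold rr; nlinarith [sq_nonneg P.k]
  -- abbreviations
  set A := w ^ (g - 1) with hA
  have hApos : 0 < A := by positivity
  have hwA : w ^ g = A * w := by
    rw [hA, ← Real.rpow_add_one hW.ne']; congr 1; ring
  have hwA2 : A = w ^ (g - 2) * w := by
    rw [hA, ← Real.rpow_add_one hW.ne']; congr 1; ring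
  set A2 := w ^ (g - 2) with hA2
  have hA2pos : 0 < A2 := by positivity
  set R := r ^ (P.p / 2 - 2) with hR
  have hRpos : 0 < R := by positivity
  have hR1 : r ^ (P.p / 2 - 1) = R * r := by
    rw [hR, ← Real.rpow_add_one hr.ne']; congr 1; ring
  have hR2 : r ^ (P.p / 2) = R * r * r := by
    rw [← hR1, ← Real.rpow_add_one hr.ne']; congr 1; ring
  set S := s ^ (P.q / 2 - 2) with hS
  have hSpos : 0 < S := by positivity
  have hS1 : s ^ (P.q / 2 - 1) = S * s := by
    rw [hS, ← Real.rpow_add_one hs.ne']; congr 1; ring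
  have hS2 : s ^ (P.q / 2) = S * s * s := by
    rw [← hS1, ← Real.rpow_add_one hs.ne']; congr 1; ring
  have hwdef : w = R * r * r + S * s * s := by
    rw [hw]; unfold W; rw [← hrdef, ← hsdef, hR2, hS2]
  have hz2A : z ^ 2 * A ≤ 1 := by
    have h1 : r ≤ w ^ (1 - g) := by
      have : r = (r ^ (P.p / 2)) ^ (1 - g) := by
        rw [g_eq, ← Real.rpow_mul hr.le]
        rw [show P.p / 2 * (2 / P.p) = 1 by field_simp]; simp
      rw [this]
      apply Real.rpow_le_rpow (by positivity) _ (by linarith)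
      rw [hR2, hwdef]; nlinarith [mul_pos (mul_pos hSpos hs) hs]
    have h2 : w ^ (1 - g) * A = 1 := by
      rw [hA, ← Real.rpow_add hW]; simp
    calc z ^ 2 * A ≤ w ^ (1 - g) * A := by gcongr; linarith
      _ = 1 := h2
  have hWe2 : We P e ^ 2 ≤ P.q ^ 2 * (S * s) * w := by
    unfold We; rw [← hsdef, hS1]
    have : (P.q * e * (S * s)) ^ 2 = P.q ^ 2 * (S * s) * (e ^ 2 * (S * s)) := by ring
    rw [this]
    gcongr
    rw [hwdef]
    have h3 : e ^ 2 * (S * s) ≤ s * (S * s) := by gcongr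
    nlinarith [mul_pos (mul_pos hRpos hr) hr]
  have hWee : P.q * (P.q - 1) * (S * s) ≤ Wee P e := by
    unfold Wee; rw [← hsdef, hS1, ← hS]
    have : 0 ≤ P.q * (2 - P.q) * S * (s - e ^ 2) := by
      have : 0 ≤ 2 - P.q := by linarith
      have : 0 ≤ s - e ^ 2 := by linarith
      positivity
    nlinarith
  have hzz : 2 * w ^ g ≤ Bzz P z e := by
    unfold Bzz Wz Wzz
    rw [← hw, ← hrdef, ← hgdef, hR1, ← hA, ← hA2, ← hR]
    -- w ≥ R r r, A = A2 w
    have k1 : A2 * (R * r * r) ≤ A := by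
      rw [hwA2]; gcongr; rw [hwdef]; nlinarith [mul_pos (mul_pos hSpos hs) hs]
    have k2 : z ^ 2 * z ^ 2 * R * (A2 * (R * r * r)) ≤ z ^ 2 * z ^ 2 * R * A := by
      gcongr
    have k3 : z ^ 2 * z ^ 2 * R * A ≤ z ^ 2 * r * R * A := by gcongr
    have h1g : 0 ≤ 1 - g := by linarith
    have k4 : g * (1 - g) * P.p ^ 2 * (z ^ 2 * z ^ 2 * R * (A2 * (R * r * r)))
        ≤ g * (1 - g) * P.p ^ 2 * (z ^ 2 * z ^ 2 * R * A) := by gcongr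
    have k5 : 0 ≤ g * (5 * P.p) * (z ^ 2 * r * R * A - z ^ 2 * z ^ 2 * R * A) := by
      have : 0 ≤ z ^ 2 * r * R * A - z ^ 2 * z ^ 2 * R * A := by linarith
      positivity
    have k6 : 0 ≤ g * (z ^ 2 * z ^ 2 * R * A) * (5 * P.p + P.p * (P.p - 2) - (1 - g) * P.p ^ 2) := by
      have : 5 * P.p + P.p * (P.p - 2) - (1 - g) * P.p ^ 2 = 3 * P.p + g * P.p ^ 2 := by ring
      rw [this]; positivity
    linarith
  have hee : (1 + (2 + P.p) ^ 2 * P.q ^ 2) * (S * s) ≤ Bee P z e := by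
    unfold Bee
    rw [← hw, ← hgdef, ← hA, ← hA2]
    have h1g : 0 ≤ 1 - g := by linarith
    have k1 : 0 ≤ g * z ^ 2 * A * Wee P e := by
      have : 0 ≤ Wee P e := le_trans (by have : 0 ≤ P.q - 1 := by linarith
                                         positivity) hWee
      positivity
    have k2 : g * (1 - g) * z ^ 2 * A2 * We P e ^ 2 ≤ P.q ^ 2 * (S * s) := by
      calc g * (1 - g) * z ^ 2 * A2 * We P e ^ 2
          ≤ g * (1 - g) * z ^ 2 * A2 * (P.q ^ 2 * (S * s) * w) := by gcongr
        _ = (g * (1 - g)) * ((z ^ 2 * A) * (P.q ^ 2 * (S * s))) := by rw [hwA2]; ring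
        _ ≤ 1 * (1 * (P.q ^ 2 * (S * s))) := by
          gcongr
          nlinarith
        _ = _ := by ring
    have k3 : (1 + P.q ^ 2 + (2 + P.p) ^ 2 * P.q ^ 2) * (S * s) ≤ P.C * Wee P e := by
      have hqq : 0 < P.q * (P.q - 1) := by apply mul_pos <;> linarith
      calc (1 + P.q ^ 2 + (2 + P.p) ^ 2 * P.q ^ 2) * (S * s)
          = P.C * (P.q * (P.q - 1) * (S * s)) := by
            unfold Par.C; rw [← mul_assoc ((1 + P.q ^ 2 + (2 + P.p) ^ 2 * P.q ^ 2) / (P.q * (P.q - 1))), div_mul_cancel₀ _ hqq.ne']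
        _ ≤ _ := by
          have : 0 < P.C := by unfold Par.C; positivity
          gcongr
    linarith
  have hze : Bze P z e ^ 2 ≤ (2 + P.p) ^ 2 * P.q ^ 2 * (S * s) * w ^ g := by
    have e1 : Bze P z e = We P e * (z * (g * (2 * A - (1 - g) * A2 * (z * Wz P z)))) := by
      unfold Bze; rw [← hw, ← hgdef, ← hA, ← hA2]; ring
    have hzWz : 0 ≤ z * Wz P z ∧ z * Wz P z ≤ P.p * w := by
      unfold Wz; rw [← hrdef, hR1]
      have : z * (P.p * z * (R * r)) = P.p * (z ^ 2 * (R * r)) := by ring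
      rw [this]
      refine ⟨by positivity, ?_⟩
      gcongr
      have : z ^ 2 * (R * r) ≤ r * (R * r) := by gcongr
      rw [hwdef]; nlinarith [mul_pos (mul_pos hSpos hs) hs]
    have h1g : 0 ≤ 1 - g := by linarith
    have e2 : |g * (2 * A - (1 - g) * A2 * (z * Wz P z))| ≤ (2 + P.p) * A := by
      have k1 : (1 - g) * A2 * (z * Wz P z) ≤ P.p * A := by
        calc (1 - g) * A2 * (z * Wz P z) ≤ 1 * A2 * (P.p * w) := by
              apply mul_le_mul _ hzWz.2 hzWz.1 (by positivity)
              gcongr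
              linarith
          _ = P.p * A := by rw [hwA2]; ring
      have k2 : 0 ≤ (1 - g) * A2 * (z * Wz P z) := by have := hzWz.1; positivity
      rw [abs_mul, abs_of_pos hg]
      have k3 : |2 * A - (1 - g) * A2 * (z * Wz P z)| ≤ (2 + P.p) * A := by
        rw [abs_le]; constructor <;> nlinarith
      calc g * |2 * A - (1 - g) * A2 * (z * Wz P z)| ≤ 1 * ((2 + P.p) * A) := by gcongr
        _ = _ := one_mul _
    have e3 : (g * (2 * A - (1 - g) * A2 * (z * Wz P z))) ^ 2 ≤ ((2 + P.p) * A) ^ 2 := by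
      rw [← sq_abs]; gcongr
    rw [e1, mul_pow, mul_pow]
    calc We P e ^ 2 * (z ^ 2 * (g * (2 * A - (1 - g) * A2 * (z * Wz P z))) ^ 2)
        ≤ (P.q ^ 2 * (S * s) * w) * (z ^ 2 * ((2 + P.p) * A) ^ 2) := by gcongr
      _ = (2 + P.p) ^ 2 * P.q ^ 2 * (S * s) * (A * w) * (z ^ 2 * A) := by ring
      _ ≤ (2 + P.p) ^ 2 * P.q ^ 2 * (S * s) * (A * w) * 1 := by gcongr
      _ = _ := by rw [hwA, mul_one]
  rw [hS1]
  have hwg : 0 < w ^ g := by positivity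
  -- cross term
  have hcross : -(w ^ g * a ^ 2 + (2 + P.p) ^ 2 * P.q ^ 2 * (S * s) * b ^ 2) ≤ 2 * Bze P z e * (a * b) := by
    set D := (2 + P.p) ^ 2 * P.q ^ 2 * (S * s) with hD
    have hDpos : 0 < D := by positivity
    have h1 : |Bze P z e| ≤ Real.sqrt D * Real.sqrt (w ^ g) := by
      rw [← Real.sqrt_mul hDpos.le]; exact Real.abs_le_sqrt hze
    have h2 : Real.sqrt D ^ 2 = D := Real.sq_sqrt hDpos.le
    have h3 : Real.sqrt (w ^ g) ^ 2 = w ^ g := Real.sq_sqrt hwg.le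
    have h4 : |2 * Bze P z e * (a * b)| ≤ 2 * (Real.sqrt D * Real.sqrt (w ^ g)) * (|a| * |b|) := by
      rw [abs_mul, abs_mul, abs_mul, abs_two]; gcongr
    have h5 : 2 * (Real.sqrt D * Real.sqrt (w ^ g)) * (|a| * |b|) ≤ w ^ g * a ^ 2 + D * b ^ 2 := by
      rw [← sq_abs a, ← sq_abs b]
      have h6 := two_mul_le_add_sq (Real.sqrt (w ^ g) * |a|) (Real.sqrt D * |b|)
      rw [mul_pow, mul_pow, h2, h3] at h6
      linarith
    linarith [neg_abs_le (2 * Bze P z e * (a * b))]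
  linarith [mul_le_mul_of_nonneg_right hzz (sq_nonneg a), mul_le_mul_of_nonneg_right hee (sq_nonneg b)]

lemma prod_ge_one (z e : ℝ) : 1 ≤ (W P z e) ^ P.g * (rr P e) ^ (P.q / 2 - 1) := by
  have hr := rr_pos P z; have hs := rr_pos P e
  have hg := g_pos P
  have h1 : ((rr P e) ^ (P.q / 2)) ^ P.g ≤ (W P z e) ^ P.g := by
    apply Real.rpow_le_rpow (by positivity) _ hg.le
    unfold W
    have : 0 < (rr P z) ^ (P.p / 2) := by positivity
    linarith
  rw [← Real.rpow_mul hs.le, g_eq2] at h1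
  calc (1:ℝ) = (rr P e) ^ (1 - P.q / 2) * (rr P e) ^ (P.q / 2 - 1) := by
        rw [← Real.rpow_add hs]; simp
    _ ≤ _ := by gcongr

/-- vector form used later -/
lemma hess_lower_sum {ι : Type*} [Fintype ι] (z e : ℝ) (a b : ι → ℝ) (i j : ι) :
    2 * (|a i| * |b j|) ≤ ∑ l, (Bzz P z e * a l ^ 2 + 2 * Bze P z e * (a l * b l) + Bee P z e * b l ^ 2) := by
  set X := (W P z e) ^ P.g
  set Y := (rr P e) ^ (P.q / 2 - 1)
  have hX : 0 < X := Real.rpow_pos_of_pos (W_pos P z e) _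
  have hY : 0 < Y := Real.rpow_pos_of_pos (rr_pos P e) _
  have h1 : ∑ l, (X * a l ^ 2 + Y * b l ^ 2) ≤
    ∑ l, (Bzz P z e * a l ^ 2 + 2 * Bze P z e * (a l * b l) + Bee P z e * b l ^ 2) :=
    Finset.sum_le_sum (fun l _ => hess_lower P z e (a l) (b l))
  refine le_trans ?_ h1
  rw [Finset.sum_add_distrib]
  have h2 : X * a i ^ 2 ≤ ∑ l, X * a l ^ 2 :=
    Finset.single_le_sum (f := fun l => X * a l ^ 2) (fun l _ => by positivity) (Finset.mem_univ i)
  have h3 : Y * b j ^ 2 ≤ ∑ l, Y * b l ^ 2 :=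
    Finset.single_le_sum (f := fun l => Y * b l ^ 2) (fun l _ => by positivity) (Finset.mem_univ j)
  have h4 := prod_ge_one P z e
  have h5 : 2 * (|a i| * |b j|) ≤ X * a i ^ 2 + Y * b j ^ 2 := by
    have hx2 : Real.sqrt X ^ 2 = X := Real.sq_sqrt hX.le
    have hy2 : Real.sqrt Y ^ 2 = Y := Real.sq_sqrt hY.le
    have hxy : 1 ≤ Real.sqrt X * Real.sqrt Y := by
      rw [← Real.sqrt_mul hX.le]; exact Real.one_le_sqrt.mpr h4
    have : 2 * (|a i| * |b j|) ≤ 2 * (Real.sqrt X * |a i|) * (Real.sqrt Y * |b j|) := by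
      have : 0 ≤ |a i| * |b j| := by positivity
      nlinarith
    rw [← sq_abs (a i), ← sq_abs (b j)]
    have h6 := two_mul_le_add_sq (Real.sqrt X * |a i|) (Real.sqrt Y * |b j|)
    rw [mul_pow, mul_pow, hx2, hy2] at h6
    linarith
  linarith

/-- nonnegativity and upper bound -/
lemma B_nonneg (z e : ℝ) : 0 ≤ B P z e - B P 0 0 := by
  have hs := rr_pos P e
  have hW := W_pos P z e
  have hC : 0 < P.C := by
    have hq := P.hq
    unfold Par.C; have : 0 < P.q - 1 := by linarith
    positivity
  unfold B
  have : (rr P 0) ^ (P.q / 2) ≤ (rr P e) ^ (P.q / 2) := by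
    apply Real.rpow_le_rpow (rr_pos P 0).le _ (by have := P.hq; linarith)
    unfold rr; nlinarith [sq_nonneg e]
  have h2 : 0 ≤ z ^ 2 * (W P z e) ^ P.g := by positivity
  nlinarith

end Bell

namespace Bell
variable (P : Par)

lemma C_pos : 0 < P.C := by
  have hq := P.hq
  unfold Par.C; have : 0 < P.q - 1 := by linarith
  positivity

/-- `(a + b)^s ≤ 2^s (a^s + b^s)`. -/
lemma add_rpow_two {a b s : ℝ} (ha : 0 ≤ a) (hb : 0 ≤ b) (hs : 0 ≤ s) :
    (a + b) ^ s ≤ 2 ^ s * (a ^ s + b ^ s) := by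
  have h1 : (a + b) ^ s ≤ (2 * max a b) ^ s := by
    apply Real.rpow_le_rpow (by positivity) _ hs
    linarith [le_max_left a b, le_max_right a b]
  rw [Real.mul_rpow (by norm_num) (le_max_of_le_left ha)] at h1
  refine h1.trans (mul_le_mul_of_nonneg_left ?_ (by positivity))
  have ha' := Real.rpow_nonneg ha s
  have hb' := Real.rpow_nonneg hb s
  rcases le_total a b with h | h
  · rw [max_eq_right h]; linarith
  · rw [max_eq_left h]; linarith

lemma sq_rpow (z s : ℝ) : (z ^ 2) ^ s = |z| ^ (2 * s) := by
  rw [← sq_abs, ← Real.rpow_natCast, ← Real.rpow_mul (abs_nonneg z)]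
  norm_num

lemma mixed (z e : ℝ) : z ^ 2 * |e| ^ (2 - P.q) ≤ |z| ^ P.p + |e| ^ P.q := by
  have hp := P.hp
  have hq := P.hq
  have hq2 := P.hq2
  have hpq : P.q * (P.p - 1) = P.p := by
    have := P.hpq
    field_simp at this
    linarith
  have hzp := Real.rpow_nonneg (abs_nonneg z) P.p
  have hep := Real.rpow_nonneg (abs_nonneg e) P.q
  rcases le_total (|e| ^ P.q) (|z| ^ P.p) with h | h
  · have h1 : |e| ^ (2 - P.q) ≤ |z| ^ (P.p - 2) := by
      have : (|e| ^ P.q) ^ ((2 - P.q) / P.q) ≤ (|z| ^ P.p) ^ ((2 - P.q) / P.q) :=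
        Real.rpow_le_rpow hep h (by apply div_nonneg <;> linarith)
      rw [← Real.rpow_mul (abs_nonneg _), ← Real.rpow_mul (abs_nonneg _)] at this
      have e1 : P.q * ((2 - P.q) / P.q) = 2 - P.q := by field_simp
      have e2 : P.p * ((2 - P.q) / P.q) = P.p - 2 := by
        field_simp; nlinarith
      rwa [e1, e2] at this
    calc z ^ 2 * |e| ^ (2 - P.q) ≤ z ^ 2 * |z| ^ (P.p - 2) := by gcongr
      _ = |z| ^ P.p := by
        rw [← sq_abs]
        by_cases hz : |z| = 0
        · rw [hz, Real.zero_rpow (show P.p - 2 ≠ 0 by linarith), Real.zero_rpow (show P.p ≠ 0 by linarith)]; ring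
        · have : 0 < |z| := lt_of_le_of_ne (abs_nonneg z) (Ne.symm hz)
          rw [← Real.rpow_natCast, ← Real.rpow_add this]; norm_num
      _ ≤ _ := by linarith
  · have h1 : z ^ 2 ≤ |e| ^ (2 * P.q / P.p) := by
      have : (|z| ^ P.p) ^ (2 / P.p) ≤ (|e| ^ P.q) ^ (2 / P.p) :=
        Real.rpow_le_rpow hzp h (by positivity)
      rw [← Real.rpow_mul (abs_nonneg _), ← Real.rpow_mul (abs_nonneg _)] at this
      have e1 : P.p * (2 / P.p) = 2 := by field_simp
      rw [e1, Real.rpow_two, sq_abs] at this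
      refine this.trans_eq ?_
      congr 1; ring
    calc z ^ 2 * |e| ^ (2 - P.q) ≤ |e| ^ (2 * P.q / P.p) * |e| ^ (2 - P.q) := by gcongr
      _ = |e| ^ P.q := by
        rw [← Real.rpow_add_of_nonneg (abs_nonneg _) (by positivity) (by linarith)]
        congr 1
        field_simp
        nlinarith
      _ ≤ _ := by linarith

lemma z_pow (z : ℝ) : z ^ 2 * |z| ^ (P.p - 2) = |z| ^ P.p := by
  have hp := P.hp
  rw [← sq_abs]
  by_cases hz : |z| = 0
  · rw [hz, Real.zero_rpow (show P.p - 2 ≠ 0 by linarith), Real.zero_rpow (show P.p ≠ 0 by linarith)]; ring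
  · have : 0 < |z| := lt_of_le_of_ne (abs_nonneg z) (Ne.symm hz)
    rw [← Real.rpow_natCast, ← Real.rpow_add this]; norm_num

/-- A constant independent of `k`. -/
def Par.C1 : ℝ := 2 * 2 ^ (P.p / 2) + 4 + P.C

lemma B_upper (z e : ℝ) : B P z e - B P 0 0 ≤
    P.C1 * (|z| ^ P.p + |e| ^ P.q) + P.C1 * (P.k ^ (P.p - 2) + P.k ^ (2 - P.q)) * z ^ 2 := by
  have hp := P.hp
  have hq := P.hq
  have hq2 := P.hq2
  have hk := P.hk
  have hC := C_pos P
  have hg := g_pos P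
  have hg1 := g_lt P
  have hz := rr_pos P z
  have he := rr_pos P e
  set X := |z| ^ P.p
  set Y := |e| ^ P.q
  have hX : 0 ≤ X := Real.rpow_nonneg (abs_nonneg z) P.p
  have hY : 0 ≤ Y := Real.rpow_nonneg (abs_nonneg e) P.q
  have hm := mixed P z e
  have a1 : (rr P z) ^ (P.p / 2 - 1) ≤ 2 ^ (P.p / 2) * (|z| ^ (P.p - 2) + P.k ^ (P.p - 2)) := by
    unfold rr
    refine (add_rpow_two (sq_nonneg z) (sq_nonneg P.k) (by linarith)).trans ?_
    rw [sq_rpow, sq_rpow, abs_of_pos hk]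
    have e1 : 2 * (P.p / 2 - 1) = P.p - 2 := by ring
    rw [e1]
    gcongr
    · norm_num
    · linarith
  have a2 : (rr P e) ^ (1 - P.q / 2) ≤ 2 * (|e| ^ (2 - P.q) + P.k ^ (2 - P.q)) := by
    unfold rr
    refine (add_rpow_two (sq_nonneg e) (sq_nonneg P.k) (by linarith)).trans ?_
    rw [sq_rpow, sq_rpow, abs_of_pos hk]
    have e1 : 2 * (1 - P.q / 2) = 2 - P.q := by ring
    rw [e1]
    gcongr
    calc (2:ℝ) ^ (1 - P.q / 2) ≤ 2 ^ (1:ℝ) := by gcongr; norm_num; linarith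
      _ = 2 := by norm_num
  have a3 : (rr P e) ^ (P.q / 2) ≤ Y + P.k ^ P.q := by
    unfold rr
    refine (Real.rpow_add_le_add_rpow (sq_nonneg e) (sq_nonneg P.k) (by linarith) (by linarith)).trans ?_
    rw [sq_rpow, sq_rpow, abs_of_pos hk]
    have e1 : 2 * (P.q / 2) = P.q := by ring
    rw [e1]
  have a4 : (W P z e) ^ P.g ≤ (rr P z) ^ (P.p / 2 - 1) + (rr P e) ^ (1 - P.q / 2) := by
    unfold W
    refine (Real.rpow_add_le_add_rpow (by positivity) (by positivity) hg.le hg1.le).trans ?_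
    rw [← Real.rpow_mul hz.le, ← Real.rpow_mul he.le, g_eq2, g_eq3]
  have a5 : (rr P 0) ^ (P.q / 2) = P.k ^ P.q := by
    unfold rr
    rw [zero_pow two_ne_zero, zero_add, sq_rpow, abs_of_pos hk]
    congr 1; ring
  have hzp := z_pow P z
  set T : ℝ := 2 ^ (P.p / 2)
  have hT : 0 < T := by positivity
  set k1 := P.k ^ (P.p - 2)
  set k2 := P.k ^ (2 - P.q)
  have hk1 : 0 < k1 := by positivity
  have hk2 : 0 < k2 := by positivity
  have b1 : z ^ 2 * (W P z e) ^ P.g ≤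
      z ^ 2 * (T * (|z| ^ (P.p - 2) + k1) + 2 * (|e| ^ (2 - P.q) + k2)) := by
    apply mul_le_mul_of_nonneg_left _ (sq_nonneg z)
    linarith
  have b2 : z ^ 2 * (T * (|z| ^ (P.p - 2) + k1) + 2 * (|e| ^ (2 - P.q) + k2))
      = T * (z ^ 2 * |z| ^ (P.p - 2)) + 2 * (z ^ 2 * |e| ^ (2 - P.q)) + T * (k1 * z ^ 2)
        + 2 * (k2 * z ^ 2) := by ring
  rw [b2, hzp] at b1
  have b3 : P.C * (rr P e) ^ (P.q / 2) ≤ P.C * Y + P.C * P.k ^ P.q := by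
    rw [← mul_add]; gcongr
  have n1 : 0 ≤ k1 * z ^ 2 := by positivity
  have n2 : 0 ≤ k2 * z ^ 2 := by positivity
  have n3 : 0 ≤ T * (k1 * z ^ 2) := by positivity
  have n4 : 0 ≤ T * (k2 * z ^ 2) := by positivity
  have n5 : 0 ≤ P.C * (k1 * z ^ 2) := by positivity
  have n6 : 0 ≤ P.C * (k2 * z ^ 2) := by positivity
  have n7 : 0 ≤ T * X := by positivity
  have n8 : 0 ≤ T * Y := by positivity
  have n9 : 0 ≤ P.C * X := by positivity
  unfold B Par.C1
  rw [a5]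
  linarith

end Bell

namespace HK
variable {d : ℕ}

/-- standard basis vector -/
def ee (i : Fin d) : E d := EuclideanSpace.single i 1
/-- Kronecker delta -/
def dl (i j : Fin d) : ℝ := if i = j then 1 else 0

/-- heat kernel and its derivatives -/
def K (t : ℝ) (z : E d) : ℝ := (4 * Real.pi * t) ^ (-(d : ℝ) / 2) * Real.exp (-‖z‖ ^ 2 / (4 * t))
def K1 (i : Fin d) (t : ℝ) (z : E d) : ℝ := -(z i) / (2 * t) * K t z
def K2 (i j : Fin d) (t : ℝ) (z : E d) : ℝ := (z i * z j / (4 * t ^ 2) - dl i j / (2 * t)) * K t z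
def K3 (i j l : Fin d) (t : ℝ) (z : E d) : ℝ :=
  (-(z i * z j * z l) / (8 * t ^ 3) + (dl i j * z l + dl i l * z j + dl j l * z i) / (4 * t ^ 2)) * K t z

lemma dl_comm (i j : Fin d) : dl i j = dl j i := by
  unfold dl; simp [eq_comm]

lemma hasDerivAt_coord (z : E d) (i j : Fin d) (s : ℝ) :
    HasDerivAt (fun s : ℝ => (z + s • ee i) j) (dl i j) s := by
  have : (fun s : ℝ => (z + s • ee i) j) = fun s => z j + s * dl i j := by
    ext s; simp [ee, dl, eq_comm]
  rw [this]
  simpa using ((hasDerivAt_id s).mul_const (dl i j)).const_add (z j)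

lemma hasDerivAt_normsq (z : E d) (i : Fin d) (s : ℝ) :
    HasDerivAt (fun s : ℝ => ‖z + s • ee i‖ ^ 2) (2 * (z + s • ee i) i) s := by
  have h1 : HasDerivAt (fun s : ℝ => z + s • ee i) (ee i) s := by
    simpa using ((hasDerivAt_id s).smul_const (ee i)).const_add z
  refine h1.norm_sq.congr_deriv ?_
  simp [ee, EuclideanSpace.inner_single_right]

lemma hasDerivAt_K_line {t : ℝ} (ht : 0 < t) (z : E d) (i : Fin d) (s : ℝ) :
    HasDerivAt (fun s : ℝ => K t (z + s • ee i)) (K1 i t (z + s • ee i)) s := by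
  unfold K1 K
  have h := (((hasDerivAt_normsq z i s).neg.div_const (4 * t)).exp).const_mul
    ((4 * Real.pi * t) ^ (-(d : ℝ) / 2))
  refine h.congr_deriv ?_
  simp only [Pi.neg_apply]
  field_simp
  ring

lemma hasDerivAt_K1_line {t : ℝ} (ht : 0 < t) (z : E d) (i j : Fin d) (s : ℝ) :
    HasDerivAt (fun s : ℝ => K1 i t (z + s • ee j)) (K2 i j t (z + s • ee j)) s := by
  have h := ((hasDerivAt_coord z j i s).neg.div_const (2 * t)).mul (hasDerivAt_K_line ht z j s)
  refine h.congr_deriv ?_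
  unfold K2 K1
  rw [dl_comm i j]
  simp only [Pi.neg_apply]
  field_simp
  ring

lemma hasDerivAt_K2_line {t : ℝ} (ht : 0 < t) (z : E d) (i j l : Fin d) (s : ℝ) :
    HasDerivAt (fun s : ℝ => K2 i j t (z + s • ee l)) (K3 i j l t (z + s • ee l)) s := by
  have h := ((((hasDerivAt_coord z l i s).mul (hasDerivAt_coord z l j s)).div_const
    (4 * t ^ 2)).sub_const (dl i j / (2 * t))).mul (hasDerivAt_K_line ht z l s)
  refine h.congr_deriv ?_
  unfold K3 K1
  rw [dl_comm i l, dl_comm j l]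
  simp only [Pi.mul_apply]
  field_simp
  ring

lemma normsq_eq (z : E d) : ‖z‖ ^ 2 = ∑ i, z i * z i := by
  rw [EuclideanSpace.norm_sq_eq]
  apply Finset.sum_congr rfl; intro i _
  rw [Real.norm_eq_abs, sq_abs]; ring

lemma sum_K2 (t : ℝ) (z : E d) :
    ∑ i, K2 i i t z = (‖z‖ ^ 2 / (4 * t ^ 2) - d / (2 * t)) * K t z := by
  unfold K2
  rw [← Finset.sum_mul, Finset.sum_sub_distrib, ← Finset.sum_div, ← normsq_eq]
  simp [dl]
  left; ring

lemma hasDerivAt_K_t {t : ℝ} (ht : 0 < t) (z : E d) :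
    HasDerivAt (fun s : ℝ => K s z) (∑ i, K2 i i t z) t := by
  have h1 : HasDerivAt (fun s : ℝ => 4 * Real.pi * s) (4 * Real.pi) t := by
    simpa using (hasDerivAt_id t).const_mul (4 * Real.pi)
  have h2 := h1.rpow_const (p := -(d : ℝ) / 2) (Or.inl (by positivity))
  have h3 : HasDerivAt (fun s : ℝ => -‖z‖ ^ 2 / (4 * s)) (‖z‖ ^ 2 / (4 * t ^ 2)) t := by
    have h4 : HasDerivAt (fun s : ℝ => 4 * s) 4 t := by
      simpa using (hasDerivAt_id t).const_mul (4:ℝ)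
    refine ((hasDerivAt_const t (-‖z‖ ^ 2)).div h4 (by positivity)).congr_deriv ?_
    field_simp; ring
  refine (h2.mul h3.exp).congr_deriv ?_
  rw [sum_K2]
  unfold K
  have : (4 * Real.pi * t) ^ (-(d : ℝ) / 2 - 1) = (4 * Real.pi * t) ^ (-(d : ℝ) / 2) / (4 * Real.pi * t) := by
    rw [Real.rpow_sub_one (by positivity)]
  rw [this]
  field_simp
  ring

lemma cont_K {t : ℝ} : Continuous (K t : E d → ℝ) := by unfold K; fun_prop
lemma cont_K1 {t : ℝ} (i : Fin d) : Continuous (K1 i t) := by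
  unfold K1; have := @cont_K d t; fun_prop
lemma cont_K2 {t : ℝ} (i j : Fin d) : Continuous (K2 i j t) := by
  unfold K2; have := @cont_K d t; fun_prop
lemma cont_K3 {t : ℝ} (i j l : Fin d) : Continuous (K3 i j l t) := by
  unfold K3; have := @cont_K d t; fun_prop

lemma K_pos {t : ℝ} (ht : 0 < t) (z : E d) : 0 < K t z := by unfold K; positivity

/-- weight -/
def om (z : E d) : ℝ := ((1 + ‖z‖) ^ (d + 1))⁻¹

lemma om_pos (z : E d) : 0 < om z := by unfold om; positivity
lemma om_le_one (z : E d) : om z ≤ 1 := by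
  unfold om; apply inv_le_one_of_one_le₀; apply one_le_pow₀; linarith [norm_nonneg z]
lemma cont_om : Continuous (om : E d → ℝ) := by
  unfold om
  apply Continuous.inv₀ (by fun_prop)
  intro x; positivity
lemma om_integrable : Integrable (om : E d → ℝ) := by
  have h := integrable_one_add_norm (E := E d) (μ := volume) (r := (d + 1 : ℕ)) (by simp)
  refine h.congr (Eventually.of_forall fun x => ?_)
  simp only [om]
  rw [Real.rpow_neg (by positivity), Real.rpow_natCast]

lemma exp_bound {s : ℝ} (hs : 0 ≤ s) (n : ℕ) :
    Real.exp (-s) * (1 + s) ^ n ≤ Real.exp 1 * n.factorial := by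
  have h := Real.pow_div_factorial_le_exp (x := 1 + s) (by positivity) n
  rw [div_le_iff₀ (by positivity), Real.exp_add] at h
  calc Real.exp (-s) * (1 + s) ^ n ≤ Real.exp (-s) * (Real.exp 1 * Real.exp s * n.factorial) := by gcongr
    _ = Real.exp (-s) * Real.exp s * (Real.exp 1 * n.factorial) := by ring
    _ = _ := by rw [← Real.exp_add]; simp

lemma coord_le (z : E d) (i : Fin d) : |z i| ≤ ‖z‖ := by
  rw [← Real.norm_eq_abs]; exact PiLp.norm_apply_le z i

lemma dl_abs (i j : Fin d) : |dl i j| ≤ 1 := by unfold dl; split_ifs <;> simp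

lemma K_le {a t : ℝ} (ha : 0 < a) (hat : a ≤ t) (z : E d) :
    K t z ≤ (4 * Real.pi * a) ^ (-(d : ℝ) / 2) * Real.exp (-(‖z‖ ^ 2 / (4 * t))) := by
  unfold K
  rw [neg_div (4 * t)]
  refine mul_le_mul_of_nonneg_right ?_ (by positivity)
  apply Real.rpow_le_rpow_of_nonpos (by positivity) (by gcongr)
  rw [neg_div]; simp; positivity

/-- uniform weighted bounds for polynomial times kernel -/
lemma poly_K_bound {a b : ℝ} (ha : 0 < a) :
    ∃ C : ℝ, 0 ≤ C ∧ ∀ t ∈ Icc a b, ∀ z : E d, (1 + ‖z‖) ^ 2 * K t z ≤ C * om z := by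
  refine ⟨(4 * Real.pi * a) ^ (-(d : ℝ) / 2) * ((2 + 8 * |b|) ^ (d + 3) *
    (Real.exp 1 * (d + 3).factorial)), by positivity, ?_⟩
  intro t ht z
  have ht0 : 0 < t := lt_of_lt_of_le ha ht.1
  have hb : t ≤ |b| := ht.2.trans (le_abs_self b)
  set s := ‖z‖ ^ 2 / (4 * t) with hs
  have hs0 : 0 ≤ s := by positivity
  have hz : ‖z‖ ^ 2 = 4 * t * s := by rw [hs]; field_simp
  have h1 : 1 + ‖z‖ ≤ (2 + 8 * |b|) * (1 + s) := by
    have h2 : 1 + ‖z‖ ≤ 2 + ‖z‖ ^ 2 := by nlinarith [sq_nonneg (‖z‖ - 1), norm_nonneg z]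
    have h3 : t * s ≤ |b| * s := by gcongr
    nlinarith [abs_nonneg b]
  have h2 := exp_bound hs0 (d + 3)
  have h3 := K_le ha ht.1 z
  rw [← hs] at h3
  unfold om
  rw [le_mul_inv_iff₀ (by positivity)]
  calc (1 + ‖z‖) ^ 2 * K t z * (1 + ‖z‖) ^ (d + 1) = (1 + ‖z‖) ^ (d + 3) * K t z := by ring
    _ ≤ ((2 + 8 * |b|) * (1 + s)) ^ (d + 3) * ((4 * Real.pi * a) ^ (-(d : ℝ) / 2) * Real.exp (-s)) := by
      have := (K_pos ht0 z).le
      gcongr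
    _ = (4 * Real.pi * a) ^ (-(d : ℝ) / 2) * ((2 + 8 * |b|) ^ (d + 3) *
        (Real.exp (-s) * (1 + s) ^ (d + 3))) := by rw [mul_pow]; ring
    _ ≤ _ := by gcongr

lemma K_bounds {a b : ℝ} (ha : 0 < a) :
    ∃ C : ℝ, 0 ≤ C ∧ ∀ t ∈ Icc a b, ∀ z : E d, |K t z| ≤ C * om z ∧
      (∀ i, |K1 i t z| ≤ C * om z) ∧ (∀ i j, |K2 i j t z| ≤ C * om z) := by
  obtain ⟨C, hC, h⟩ := poly_K_bound (d := d) (b := b) ha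
  refine ⟨(1 + 1 / a + 1 / a ^ 2) * C, by positivity, ?_⟩
  intro t ht z
  have ht0 : 0 < t := lt_of_lt_of_le ha ht.1
  have hK := K_pos ht0 z
  have hz := norm_nonneg z
  have key : ∀ c : ℝ, |c| ≤ (1 + 1 / a + 1 / a ^ 2) * (1 + ‖z‖) ^ 2 →
      |c * K t z| ≤ (1 + 1 / a + 1 / a ^ 2) * C * om z := by
    intro c hc
    rw [abs_mul, abs_of_pos hK]
    calc |c| * K t z ≤ (1 + 1 / a + 1 / a ^ 2) * (1 + ‖z‖) ^ 2 * K t z := by gcongr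
      _ = (1 + 1 / a + 1 / a ^ 2) * ((1 + ‖z‖) ^ 2 * K t z) := by ring
      _ ≤ (1 + 1 / a + 1 / a ^ 2) * (C * om z) := mul_le_mul_of_nonneg_left (h t ht z) (by positivity)
      _ = _ := by ring
  have ia : 0 < 1 / a := by positivity
  have ia2 : 0 < 1 / a ^ 2 := by positivity
  have hta : 1 / t ≤ 1 / a := one_div_le_one_div_of_le ha ht.1
  have hta2 : 1 / t ^ 2 ≤ 1 / a ^ 2 :=
    one_div_le_one_div_of_le (by positivity) (pow_le_pow_left₀ ha.le ht.1 2)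
  have it : 0 < 1 / t := by positivity
  have it2 : 0 < 1 / t ^ 2 := by positivity
  have e1 : 1 ≤ (1 + ‖z‖) ^ 2 := by nlinarith
  have e2 : ‖z‖ ≤ (1 + ‖z‖) ^ 2 := by nlinarith
  have e3 : ‖z‖ * ‖z‖ ≤ (1 + ‖z‖) ^ 2 := by nlinarith
  refine ⟨?_, ?_, ?_⟩
  · rw [← one_mul (K t z)]
    apply key
    rw [abs_one]
    calc (1:ℝ) = 1 * 1 := by ring
      _ ≤ _ := by gcongr; linarith
  · intro i
    apply key
    rw [abs_div, abs_neg, abs_of_pos (by positivity : 0 < 2 * t)]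
    calc |z i| / (2 * t) = (1 / t) * |z i| / 2 := by field_simp
      _ ≤ (1 / t) * |z i| := half_le_self (by positivity)
      _ ≤ (1 + 1 / a + 1 / a ^ 2) * (1 + ‖z‖) ^ 2 := by
        gcongr
        · linarith
        · exact (coord_le z i).trans e2
  · intro i j
    apply key
    have a1 : |z i * z j / (4 * t ^ 2)| ≤ 1 / a ^ 2 * (1 + ‖z‖) ^ 2 := by
      rw [abs_div, abs_mul, abs_of_pos (by positivity : 0 < 4 * t ^ 2)]
      calc |z i| * |z j| / (4 * t ^ 2) ≤ |z i| * |z j| / t ^ 2 := by gcongr; nlinarith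
        _ = 1 / t ^ 2 * (|z i| * |z j|) := by field_simp
        _ ≤ 1 / a ^ 2 * (‖z‖ * ‖z‖) := by
          gcongr
          · exact coord_le z i
          · exact coord_le z j
        _ ≤ _ := by gcongr
    have a2 : |dl i j / (2 * t)| ≤ 1 / a * (1 + ‖z‖) ^ 2 := by
      rw [abs_div, abs_of_pos (by positivity : 0 < 2 * t)]
      calc |dl i j| / (2 * t) ≤ 1 / t := by
            gcongr
            · exact dl_abs i j
            · linarith
        _ ≤ 1 / a * 1 := by linarith
        _ ≤ _ := by gcongr
    calc _ ≤ |z i * z j / (4 * t ^ 2)| + |dl i j / (2 * t)| := abs_sub _ _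
      _ ≤ _ := by nlinarith

end HK

namespace HK
variable {d : ℕ}

lemma integrable_of_om {k : E d → ℝ} (hk : Continuous k) {C : ℝ} (h : ∀ z, |k z| ≤ C * om z) :
    Integrable k :=
  (om_integrable.const_mul C).mono' hk.aestronglyMeasurable (Eventually.of_forall h)

lemma K_bounds1 {t : ℝ} (ht : 0 < t) :
    ∃ C : ℝ, 0 ≤ C ∧ ∀ z : E d, |K t z| ≤ C * om z ∧
      (∀ i, |K1 i t z| ≤ C * om z) ∧ (∀ i j, |K2 i j t z| ≤ C * om z) := by
  obtain ⟨C, hC, h⟩ := K_bounds (d := d) (a := t) (b := t) ht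
  exact ⟨C, hC, h t ⟨le_rfl, le_rfl⟩⟩

lemma int_K {t : ℝ} (ht : 0 < t) : Integrable (K t : E d → ℝ) := by
  obtain ⟨C, hC, h⟩ := K_bounds1 (d := d) ht
  exact integrable_of_om cont_K fun z => (h z).1
lemma int_K1 {t : ℝ} (ht : 0 < t) (i : Fin d) : Integrable (K1 i t) := by
  obtain ⟨C, hC, h⟩ := K_bounds1 (d := d) ht
  exact integrable_of_om (cont_K1 i) fun z => (h z).2.1 i
lemma int_K2 {t : ℝ} (ht : 0 < t) (i j : Fin d) : Integrable (K2 i j t) := by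
  obtain ⟨C, hC, h⟩ := K_bounds1 (d := d) ht
  exact integrable_of_om (cont_K2 i j) fun z => (h z).2.2 i j

lemma integral_K {t : ℝ} (ht : 0 < t) : ∫ z : E d, K t z = 1 := by
  unfold K
  rw [integral_const_mul]
  have := GaussianFourier.integral_rexp_neg_mul_sq_norm (V := E d) (b := 1 / (4 * t)) (by positivity)
  have e : (fun z : E d => Real.exp (-‖z‖ ^ 2 / (4 * t))) = fun z => Real.exp (-(1 / (4 * t)) * ‖z‖ ^ 2) := by
    ext z; congr 1; ring
  rw [e, this]
  have e2 : Real.pi / (1 / (4 * t)) = 4 * Real.pi * t := by field_simp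
  rw [e2, ← Real.rpow_add (by positivity)]
  simp
  rw [neg_div, neg_add_cancel, Real.rpow_zero]

/-- the integral of a line derivative vanishes -/
lemma integral_lineDeriv_zero {H H' : E d → ℝ} {v : E d} (hH : Integrable H) (hH' : Integrable H')
    (h : ∀ x, HasLineDerivAt ℝ H (H' x) x v) : ∫ x, H' x = 0 := by
  have := integral_bilinear_hasLineDerivAt_right_eq_neg_left_of_integrable (μ := (volume : Measure (E d)))
    (f := fun _ : E d => (1:ℝ)) (f' := fun _ => (0:ℝ)) (g := H) (g' := H') (v := v)
    (B := ContinuousLinearMap.mul ℝ ℝ) (by simp) (by simpa using hH') (by simpa using hH)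
    (fun x _ => by unfold HasLineDerivAt; exact hasDerivAt_const _ _) (fun x _ => h x)
  simpa using this

lemma integral_K1 {t : ℝ} (ht : 0 < t) (i : Fin d) : ∫ z, K1 i t z = 0 :=
  integral_lineDeriv_zero (v := ee i) (int_K ht) (int_K1 ht i) fun x => by
    have := hasDerivAt_K_line ht x i 0
    unfold HasLineDerivAt
    simpa using this

lemma integral_K2 {t : ℝ} (ht : 0 < t) (i j : Fin d) : ∫ z, K2 i j t z = 0 :=
  integral_lineDeriv_zero (v := ee j) (int_K1 ht i) (int_K2 ht i j) fun x => by
    have := hasDerivAt_K1_line ht x i j 0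
    unfold HasLineDerivAt
    simpa using this

lemma K_mul {t : ℝ} (ht : 0 < t) (ζ e : E d) :
    K t (ζ - e) * K t (ζ + e) = K (2 * t) ((2:ℝ) • e) * K (t / 2) ζ := by
  unfold K
  have h := parallelogram_law_with_norm ℝ ζ e
  have e1 : (4 * Real.pi * t) ^ (-(d : ℝ) / 2) * (4 * Real.pi * t) ^ (-(d : ℝ) / 2) =
      (4 * Real.pi * (2 * t)) ^ (-(d : ℝ) / 2) * (4 * Real.pi * (t / 2)) ^ (-(d : ℝ) / 2) := by
    rw [← Real.mul_rpow (by positivity) (by positivity), ← Real.mul_rpow (by positivity) (by positivity)]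
    congr 1; ring
  have e2 : Real.exp (-‖ζ - e‖ ^ 2 / (4 * t)) * Real.exp (-‖ζ + e‖ ^ 2 / (4 * t)) =
      Real.exp (-‖(2:ℝ) • e‖ ^ 2 / (4 * (2 * t))) * Real.exp (-‖ζ‖ ^ 2 / (4 * (t / 2))) := by
    rw [← Real.exp_add, ← Real.exp_add]
    congr 1
    rw [norm_smul]
    norm_num
    field_simp
    nlinarith
  calc _ = ((4 * Real.pi * t) ^ (-(d : ℝ) / 2) * (4 * Real.pi * t) ^ (-(d : ℝ) / 2)) *
      (Real.exp (-‖ζ - e‖ ^ 2 / (4 * t)) * Real.exp (-‖ζ + e‖ ^ 2 / (4 * t))) := by ring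
    _ = _ := by rw [e1, e2]; ring

lemma semigroup0 {t : ℝ} (ht : 0 < t) (i j : Fin d) (e : E d) :
    ∫ ζ, K1 i t (ζ - e) * K1 j t (ζ + e) = - K2 i j (2 * t) ((2:ℝ) • e) := by
  have h2 : 0 < t / 2 := by positivity
  have key : ∀ ζ : E d, K1 i t (ζ - e) * K1 j t (ζ + e) =
      K (2 * t) ((2:ℝ) • e) / (4 * t ^ 2) * (t ^ 2 * K2 i j (t / 2) ζ + (t * dl i j - e i * e j) * K (t / 2) ζ
        + (-(t * e j)) * K1 i (t / 2) ζ + (t * e i) * K1 j (t / 2) ζ) := by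
    intro ζ
    have : K1 i t (ζ - e) * K1 j t (ζ + e) =
      (ζ i - e i) * (ζ j + e j) / (4 * t ^ 2) * (K t (ζ - e) * K t (ζ + e)) := by
      unfold K1; simp only [PiLp.sub_apply, PiLp.add_apply]; field_simp; ring
    rw [this, K_mul ht]
    unfold K1 K2
    field_simp
    ring
  simp_rw [key]
  rw [integral_const_mul, integral_add, integral_add, integral_add, integral_const_mul, integral_const_mul,
    integral_const_mul, integral_const_mul, integral_K2 h2, integral_K h2, integral_K1 h2, integral_K1 h2]
  · unfold K2
    simp only [PiLp.smul_apply, smul_eq_mul]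
    field_simp
    ring
  · exact (int_K2 h2 i j).const_mul _
  · exact (int_K h2).const_mul _
  · exact ((int_K2 h2 i j).const_mul _).add ((int_K h2).const_mul _)
  · exact (int_K1 h2 i).const_mul _
  · exact (((int_K2 h2 i j).const_mul _).add ((int_K h2).const_mul _)).add ((int_K1 h2 i).const_mul _)
  · exact (int_K1 h2 j).const_mul _

lemma semigroup {t : ℝ} (ht : 0 < t) (i j : Fin d) (x y : E d) :
    ∫ z, K1 i t (z - x) * K1 j t (z - y) = - K2 i j (2 * t) (x - y) := by
  have h := semigroup0 ht i j ((1/2 : ℝ) • (x - y))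
  rw [smul_smul] at h
  norm_num at h
  rw [← h, ← integral_add_right_eq_self _ ((1/2 : ℝ) • (x + y))]
  congr 1; ext z
  have e1 : z + (1/2 : ℝ) • (x + y) - x = z - (1/2 : ℝ) • (x - y) := by module
  have e2 : z + (1/2 : ℝ) • (x + y) - y = z + (1/2 : ℝ) • (x - y) := by module
  rw [e1, e2]

lemma K2_decay : ∃ C : ℝ, 0 < C ∧ ∀ t : ℝ, 0 < t → ∀ (z : E d) (i j : Fin d),
    |K2 i j t z| ≤ C * (t + ‖z‖ ^ 2) ^ (-((d : ℝ) / 2 + 1)) := by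
  refine ⟨(4 * Real.pi) ^ (-(d : ℝ) / 2) * (Real.exp 1 * (d + 2).factorial) * (4 : ℝ) ^ ((d : ℝ) / 2 + 1),
    by positivity, ?_⟩
  intro t ht z i j
  set s := ‖z‖ ^ 2 / (4 * t) with hs
  have hs0 : 0 ≤ s := by positivity
  have hz : ‖z‖ ^ 2 = 4 * t * s := by rw [hs]; field_simp
  have hK : K t z = (4 * Real.pi) ^ (-(d : ℝ) / 2) * t ^ (-(d : ℝ) / 2) * Real.exp (-s) := by
    unfold K; rw [Real.mul_rpow (by positivity) ht.le, hs, neg_div (4 * t)]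
  have h1 : |z i * z j / (4 * t ^ 2) - dl i j / (2 * t)| ≤ (1 + s) / t := by
    have a1 : |z i * z j / (4 * t ^ 2)| ≤ s / t := by
      rw [abs_div, abs_mul, abs_of_pos (by positivity : 0 < 4 * t ^ 2)]
      calc |z i| * |z j| / (4 * t ^ 2) ≤ ‖z‖ * ‖z‖ / (4 * t ^ 2) := by
            gcongr
            · exact coord_le z i
            · exact coord_le z j
        _ = s / t := by rw [← sq, hz]; field_simp
    have a2 : |dl i j / (2 * t)| ≤ 1 / t := by
      rw [abs_div, abs_of_pos (by positivity : 0 < 2 * t)]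
      gcongr
      · exact dl_abs i j
      · linarith
    calc _ ≤ |z i * z j / (4 * t ^ 2)| + |dl i j / (2 * t)| := abs_sub _ _
      _ ≤ s / t + 1 / t := add_le_add a1 a2
      _ = _ := by ring
  have h2 := exp_bound hs0 (d + 2)
  have h3 : Real.exp (-s) * (1 + s) ≤ Real.exp 1 * (d + 2).factorial * (1 + s) ^ (-((d : ℝ) / 2 + 1)) := by
    rw [Real.rpow_neg (by positivity), ← div_eq_mul_inv, le_div_iff₀ (by positivity)]
    refine le_trans ?_ h2
    rw [mul_assoc]
    gcongr
    calc (1 + s) * (1 + s) ^ ((d : ℝ) / 2 + 1) = (1 + s) ^ ((d : ℝ) / 2 + 2) := by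
          rw [show (d : ℝ) / 2 + 2 = 1 + ((d : ℝ) / 2 + 1) by ring, Real.rpow_add (by positivity) 1,
            Real.rpow_one]
      _ ≤ (1 + s) ^ ((d + 2 : ℕ) : ℝ) := by
        apply Real.rpow_le_rpow_of_exponent_le (by linarith)
        push_cast
        have : (0:ℝ) ≤ d := Nat.cast_nonneg d
        linarith
      _ = _ := Real.rpow_natCast _ _
  have h4 : (t + ‖z‖ ^ 2) ^ (-((d : ℝ) / 2 + 1)) * (4 : ℝ) ^ ((d : ℝ) / 2 + 1) ≥
      (t * (1 + s)) ^ (-((d : ℝ) / 2 + 1)) := by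
    have : (4 : ℝ) ^ ((d : ℝ) / 2 + 1) = (1 / 4 : ℝ) ^ (-((d : ℝ) / 2 + 1)) := by
      rw [one_div, Real.inv_rpow (by norm_num), Real.rpow_neg (by norm_num), inv_inv]
    rw [this, ← Real.mul_rpow (by positivity) (by positivity)]
    apply Real.rpow_le_rpow_of_nonpos (by positivity)
    · nlinarith
    · have : (0:ℝ) ≤ d := Nat.cast_nonneg d
      linarith
  unfold K2
  rw [abs_mul, abs_of_pos (K_pos ht z), hK]
  have e5 : t ^ (-(d : ℝ) / 2) / t = t ^ (-((d : ℝ) / 2 + 1)) := by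
    rw [← Real.rpow_sub_one ht.ne']; congr 1; ring
  calc _ ≤ (1 + s) / t * ((4 * Real.pi) ^ (-(d : ℝ) / 2) * t ^ (-(d : ℝ) / 2) * Real.exp (-s)) := by
        gcongr
    _ = (4 * Real.pi) ^ (-(d : ℝ) / 2) * (t ^ (-(d : ℝ) / 2) / t) * (Real.exp (-s) * (1 + s)) := by
        field_simp
    _ ≤ (4 * Real.pi) ^ (-(d : ℝ) / 2) * t ^ (-((d : ℝ) / 2 + 1)) *
        (Real.exp 1 * (d + 2).factorial * (1 + s) ^ (-((d : ℝ) / 2 + 1))) := by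
        rw [e5]; gcongr
    _ = (4 * Real.pi) ^ (-(d : ℝ) / 2) * (Real.exp 1 * (d + 2).factorial) *
        (t * (1 + s)) ^ (-((d : ℝ) / 2 + 1)) := by
        rw [Real.mul_rpow ht.le (by positivity)]; ring
    _ ≤ (4 * Real.pi) ^ (-(d : ℝ) / 2) * (Real.exp 1 * (d + 2).factorial) *
        ((t + ‖z‖ ^ 2) ^ (-((d : ℝ) / 2 + 1)) * (4 : ℝ) ^ ((d : ℝ) / 2 + 1)) := by gcongr
    _ = _ := by ring

end HK

namespace HK
variable {d : ℕ}

/-- bounded measurable with bounded support -/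
structure BC (f : E d → ℝ) : Prop where
  meas : Measurable f
  bdd : ∃ M : ℝ, ∀ x, |f x| ≤ M
  supp : ∃ L : ℝ, 0 ≤ L ∧ ∀ x, L ≤ ‖x‖ → f x = 0

def conv (k f : E d → ℝ) (x : E d) : ℝ := ∫ y, k (x - y) * f y

lemma BC.integrable {f : E d → ℝ} (hf : BC f) : Integrable f := by
  obtain ⟨M, hM⟩ := hf.bdd
  obtain ⟨L, hL, hs⟩ := hf.supp
  have : Integrable ((ball (0 : E d) L).indicator fun _ => M) :=
    (integrable_indicator_iff measurableSet_ball).2 (by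
      apply integrableOn_const
      · exact measure_ball_lt_top.ne
      · exact enorm_ne_top)
  refine this.mono' hf.meas.aestronglyMeasurable (Eventually.of_forall fun x => ?_)
  by_cases hx : x ∈ ball (0 : E d) L
  · rw [indicator_of_mem hx]; exact hM x
  · rw [indicator_of_notMem hx, hs x (by simpa using hx)]; simp

lemma BC.mul {f g : E d → ℝ} (hf : BC f) (hg : Measurable g) {M : ℝ} (hM : ∀ x, |g x| ≤ M) :
    BC (fun x => g x * f x) := by
  obtain ⟨M', hM'⟩ := hf.bdd
  obtain ⟨L, hL, hs⟩ := hf.supp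
  refine ⟨hg.mul hf.meas, ⟨M * M', fun x => ?_⟩, ⟨L, hL, fun x hx => by rw [hs x hx]; simp⟩⟩
  rw [abs_mul]
  exact mul_le_mul (hM x) (hM' x) (abs_nonneg _) ((abs_nonneg _).trans (hM x))

lemma conv_integrable {k f : E d → ℝ} (hf : Integrable f) (hk : Continuous k) {C : ℝ}
    (hC : ∀ z, |k z| ≤ C) (x : E d) : Integrable (fun y => k (x - y) * f y) :=
  hf.bdd_mul (c := C) (by fun_prop) (Eventually.of_forall fun y => hC _)

/-- the weight is slowly varying -/
lemma om_shift {L : ℝ} {x y : E d} (hy : ‖y‖ ≤ L) : om (x - y) ≤ (1 + L) ^ (d + 1) * om x := by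
  unfold om
  have h1 : 1 + ‖x‖ ≤ (1 + L) * (1 + ‖x - y‖) := by
    have : ‖x‖ ≤ ‖x - y‖ + ‖y‖ := by simpa using norm_add_le (x - y) y
    nlinarith [norm_nonneg (x - y), norm_nonneg y]
  rw [← div_eq_mul_inv, le_div_iff₀ (by positivity), inv_mul_le_iff₀ (by positivity)]
  calc (1 + ‖x‖) ^ (d + 1) ≤ ((1 + L) * (1 + ‖x - y‖)) ^ (d + 1) := by gcongr
    _ = _ := by rw [mul_pow]; ring

lemma conv_bound {f : E d → ℝ} (hf : BC f) : ∃ A : ℝ, 0 ≤ A ∧ ∀ (k : E d → ℝ), Continuous k →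
    ∀ C : ℝ, 0 ≤ C → (∀ z, |k z| ≤ C * om z) → ∀ x, |conv k f x| ≤ C * A * om x := by
  obtain ⟨L, hL, hs⟩ := hf.supp
  refine ⟨(1 + L) ^ (d + 1) * ∫ y, |f y|, by positivity, ?_⟩
  intro k hk C hC hkC x
  unfold conv
  calc |∫ y, k (x - y) * f y| ≤ ∫ y, |k (x - y) * f y| := abs_integral_le_integral_abs
    _ ≤ ∫ y, (C * ((1 + L) ^ (d + 1) * om x)) * |f y| := by
      apply integral_mono_of_nonneg (Eventually.of_forall fun y => abs_nonneg _)
        (hf.integrable.abs.const_mul _) (Eventually.of_forall fun y => ?_)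
      simp only
      by_cases hy : L ≤ ‖y‖
      · rw [hs y hy]; simp
      · rw [abs_mul]
        gcongr
        refine (hkC _).trans ?_
        gcongr
        exact om_shift (le_of_not_ge hy)
    _ = _ := by rw [integral_const_mul]; ring

lemma conv_cont {k f : E d → ℝ} (hf : Integrable f) (hk : Continuous k) {C : ℝ}
    (hC : ∀ z, |k z| ≤ C) : Continuous (conv k f) := by
  unfold conv
  apply continuous_of_dominated (bound := fun y => C * |f y|)
  · intro x; exact (conv_integrable hf hk hC x).aestronglyMeasurable
  · intro x; refine Eventually.of_forall fun y => ?_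
    rw [norm_mul]
    exact mul_le_mul_of_nonneg_right (hC _) (norm_nonneg _)
  · exact hf.abs.const_mul C
  · refine Eventually.of_forall fun y => ?_
    fun_prop

lemma conv_hasDerivAt {f : E d → ℝ} (hf : Integrable f) {κ κ' : ℝ → E d → ℝ} {s₀ C : ℝ} {S : Set ℝ}
    (hS : S ∈ nhds s₀) (hd : ∀ s ∈ S, ∀ z, HasDerivAt (fun s => κ s z) (κ' s z) s)
    (hb' : ∀ s ∈ S, ∀ z, |κ' s z| ≤ C) (hc : ∀ s, Continuous (κ s)) (hc' : Continuous (κ' s₀))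
    {C0 : ℝ} (hb : ∀ z, |κ s₀ z| ≤ C0) (x : E d) :
    HasDerivAt (fun s => conv (κ s) f x) (conv (κ' s₀) f x) s₀ := by
  unfold conv
  refine (hasDerivAt_integral_of_dominated_loc_of_deriv_le (F := fun s y => κ s (x - y) * f y)
    (F' := fun s y => κ' s (x - y) * f y) (bound := fun y => C * |f y|) hS
    (Eventually.of_forall fun s => ?_) (conv_integrable hf (hc s₀) hb x) ?_
    (Eventually.of_forall fun y s hs => ?_)
    (hf.abs.const_mul C) (Eventually.of_forall fun y s hs => ?_)).2
  · have := hc s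
    exact AEStronglyMeasurable.mul (by fun_prop) hf.aestronglyMeasurable
  · exact AEStronglyMeasurable.mul (by fun_prop) hf.aestronglyMeasurable
  · rw [norm_mul]
    exact mul_le_mul_of_nonneg_right (hb' s hs _) (norm_nonneg _)
  · exact (hd s hs (x - y)).mul_const (f y)

lemma conv_shift (k f : E d → ℝ) (x v : E d) : conv k f (x + v) = conv (fun z => k (z + v)) f x := by
  unfold conv
  congr 1; ext y
  rw [show x + v - y = x - y + v by abel]

lemma bdd_of_om {k : E d → ℝ} {C : ℝ} (hC : 0 ≤ C) (h : ∀ z, |k z| ≤ C * om z) (z : E d) : |k z| ≤ C :=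
  (h z).trans (by have := om_le_one z; nlinarith)

lemma conv_line1 {f : E d → ℝ} (hf : Integrable f) {t : ℝ} (ht : 0 < t) (x : E d) (i : Fin d) (s : ℝ) :
    HasDerivAt (fun s : ℝ => conv (K t) f (x + s • ee i)) (conv (K1 i t) f (x + s • ee i)) s := by
  obtain ⟨C, hC, h⟩ := K_bounds1 (d := d) ht
  simp_rw [conv_shift]
  have hk : ∀ z : E d, |K t z| ≤ C := bdd_of_om hC fun z => (h z).1
  have hk1 : ∀ z : E d, |K1 i t z| ≤ C := bdd_of_om hC fun z => (h z).2.1 i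
  have c1 := @cont_K d t
  have c2 := @cont_K1 d t i
  exact conv_hasDerivAt hf (κ := fun s z => K t (z + s • ee i)) (κ' := fun s z => K1 i t (z + s • ee i))
    (S := univ) (C := C) (C0 := C) univ_mem (fun s _ z => hasDerivAt_K_line ht z i s) (fun s _ z => hk1 _)
    (fun s => by fun_prop) (by fun_prop) (fun z => hk _) x

lemma conv_line2 {f : E d → ℝ} (hf : Integrable f) {t : ℝ} (ht : 0 < t) (x : E d) (i j : Fin d) (s : ℝ) :
    HasDerivAt (fun s : ℝ => conv (K1 i t) f (x + s • ee j)) (conv (K2 i j t) f (x + s • ee j)) s := by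
  obtain ⟨C, hC, h⟩ := K_bounds1 (d := d) ht
  simp_rw [conv_shift]
  have hk1 : ∀ z : E d, |K1 i t z| ≤ C := bdd_of_om hC fun z => (h z).2.1 i
  have hk2 : ∀ z : E d, |K2 i j t z| ≤ C := bdd_of_om hC fun z => (h z).2.2 i j
  have c1 := @cont_K1 d t i
  have c2 := @cont_K2 d t i j
  exact conv_hasDerivAt hf (κ := fun s z => K1 i t (z + s • ee j)) (κ' := fun s z => K2 i j t (z + s • ee j))
    (S := univ) (C := C) (C0 := C) univ_mem (fun s _ z => hasDerivAt_K1_line ht z i j s) (fun s _ z => hk2 _)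
    (fun s => by fun_prop) (by fun_prop) (fun z => hk1 _) x

lemma conv_sum {f : E d → ℝ} (hf : Integrable f) {t : ℝ} (ht : 0 < t) (x : E d) :
    conv (fun z => ∑ i, K2 i i t z) f x = ∑ i, conv (K2 i i t) f x := by
  unfold conv
  obtain ⟨C, hC, h⟩ := K_bounds1 (d := d) ht
  simp_rw [Finset.sum_mul]
  rw [integral_finset_sum]
  intro i _
  exact conv_integrable hf (cont_K2 i i) (bdd_of_om hC fun z => (h z).2.2 i i) x

lemma conv_t {f : E d → ℝ} (hf : Integrable f) {t : ℝ} (ht : 0 < t) (x : E d) :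
    HasDerivAt (fun t : ℝ => conv (K t) f x) (∑ i, conv (K2 i i t) f x) t := by
  rw [← conv_sum hf ht]
  obtain ⟨C, hC, h⟩ := K_bounds (d := d) (a := t / 2) (b := 2 * t) (by positivity)
  have htm : t ∈ Icc (t / 2) (2 * t) := ⟨by linarith, by linarith⟩
  exact conv_hasDerivAt hf (κ := fun s z => K s z) (κ' := fun s z => ∑ i, K2 i i s z)
    (S := Icc (t / 2) (2 * t)) (C := ∑ _i : Fin d, C) (C0 := C) (Icc_mem_nhds (by linarith) (by linarith))
    (fun s hs z => hasDerivAt_K_t (by have := hs.1; linarith) z)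
    (fun s hs z => (Finset.abs_sum_le_sum_abs _ _).trans
      (Finset.sum_le_sum fun i _ => bdd_of_om hC (fun z => (h s hs z).2.2 i i) z))
    (fun s => cont_K) (continuous_finset_sum _ fun i _ => cont_K2 i i)
    (fun z => bdd_of_om hC (fun z => (h t htm z).1) z) x

lemma conv_K_cont {f : E d → ℝ} (hf : Integrable f) {t : ℝ} (ht : 0 < t) : Continuous (conv (K t) f) := by
  obtain ⟨C, hC, h⟩ := K_bounds1 (d := d) ht
  exact conv_cont hf cont_K (bdd_of_om hC fun z => (h z).1)
lemma conv_K1_cont {f : E d → ℝ} (hf : Integrable f) {t : ℝ} (ht : 0 < t) (i : Fin d) :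
    Continuous (conv (K1 i t) f) := by
  obtain ⟨C, hC, h⟩ := K_bounds1 (d := d) ht
  exact conv_cont hf (cont_K1 i) (bdd_of_om hC fun z => (h z).2.1 i)
lemma conv_K2_cont {f : E d → ℝ} (hf : Integrable f) {t : ℝ} (ht : 0 < t) (i j : Fin d) :
    Continuous (conv (K2 i j t) f) := by
  obtain ⟨C, hC, h⟩ := K_bounds1 (d := d) ht
  exact conv_cont hf (cont_K2 i j) (bdd_of_om hC fun z => (h z).2.2 i j)

lemma conv_K_bounds {f : E d → ℝ} (hf : BC f) {a b : ℝ} (ha : 0 < a) :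
    ∃ C : ℝ, 0 ≤ C ∧ ∀ t ∈ Icc a b, ∀ x : E d, |conv (K t) f x| ≤ C * om x ∧
      (∀ i, |conv (K1 i t) f x| ≤ C * om x) ∧ (∀ i j, |conv (K2 i j t) f x| ≤ C * om x) := by
  obtain ⟨C, hC, h⟩ := K_bounds (d := d) (b := b) ha
  obtain ⟨A, hA, hA2⟩ := conv_bound hf
  refine ⟨C * A, by positivity, fun t ht x => ⟨?_, fun i => ?_, fun i j => ?_⟩⟩
  · exact hA2 _ cont_K C hC (fun z => (h t ht z).1) x
  · exact hA2 _ (cont_K1 i) C hC (fun z => (h t ht z).2.1 i) x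
  · exact hA2 _ (cont_K2 i j) C hC (fun z => (h t ht z).2.2 i j) x

end HK

namespace HK
variable {d : ℕ}

lemma bdd_comp {b : ℝ × ℝ → ℝ} (hb : Continuous b) (M : ℝ) :
    ∃ D : ℝ, 0 ≤ D ∧ ∀ z e : ℝ, |z| ≤ M → |e| ≤ M → |b (z, e)| ≤ D := by
  have hc : IsCompact (Icc (-M) M ×ˢ Icc (-M) M) := isCompact_Icc.prod isCompact_Icc
  obtain ⟨D, hD⟩ := hc.exists_bound_of_continuousOn hb.continuousOn
  refine ⟨|D|, abs_nonneg _, fun z e hz he => ?_⟩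
  exact (hD (z, e) ⟨abs_le.1 hz, abs_le.1 he⟩).trans (le_abs_self D)

open Bell in
lemma bell_deriv (P : Par) {f g : E d → ℝ} (hf : BC f) (hg : BC g) {t : ℝ} (ht : 0 < t) :
    HasDerivAt (fun t => ∫ x, (B P (conv (K t) f x) (conv (K t) g x) - B P 0 0))
      (-∫ x, ∑ l, (Bzz P (conv (K t) f x) (conv (K t) g x) * conv (K1 l t) f x ^ 2 +
        2 * Bze P (conv (K t) f x) (conv (K t) g x) * (conv (K1 l t) f x * conv (K1 l t) g x) +
        Bee P (conv (K t) f x) (conv (K t) g x) * conv (K1 l t) g x ^ 2)) t ∧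
    Integrable (fun x => ∑ l, (Bzz P (conv (K t) f x) (conv (K t) g x) * conv (K1 l t) f x ^ 2 +
        2 * Bze P (conv (K t) f x) (conv (K t) g x) * (conv (K1 l t) f x * conv (K1 l t) g x) +
        Bee P (conv (K t) f x) (conv (K t) g x) * conv (K1 l t) g x ^ 2)) := by
  have hfi := hf.integrable
  have hgi := hg.integrable
  obtain ⟨C, hC, hFb⟩ := conv_K_bounds hf (a := t / 2) (b := 2 * t) (by positivity)
  obtain ⟨C', hC', hGb⟩ := conv_K_bounds hg (a := t / 2) (b := 2 * t) (by positivity)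
  set M := max C C' with hM
  have hM0 : 0 ≤ M := le_max_of_le_left hC
  obtain ⟨D1, hD1, hBz⟩ := bdd_comp (cont_Bz P) M
  obtain ⟨D2, hD2, hBe⟩ := bdd_comp (cont_Be P) M
  obtain ⟨D3, hD3, hBzz⟩ := bdd_comp (cont_Bzz P) M
  obtain ⟨D4, hD4, hBze⟩ := bdd_comp (cont_Bze P) M
  obtain ⟨D5, hD5, hBee⟩ := bdd_comp (cont_Bee P) M
  have htm : t ∈ Icc (t / 2) (2 * t) := ⟨by linarith, by linarith⟩
  have oM : ∀ x : E d, C * om x ≤ M * om x ∧ C' * om x ≤ M * om x := fun x =>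
    ⟨mul_le_mul_of_nonneg_right (le_max_left _ _) (om_pos x).le,
     mul_le_mul_of_nonneg_right (le_max_right _ _) (om_pos x).le⟩
  have oM1 : ∀ x : E d, M * om x ≤ M := fun x => by have := om_le_one x; nlinarith
  -- bounds
  have F0 : ∀ s ∈ Icc (t / 2) (2 * t), ∀ x, |conv (K s) f x| ≤ M * om x :=
    fun s hs x => (hFb s hs x).1.trans (oM x).1
  have G0 : ∀ s ∈ Icc (t / 2) (2 * t), ∀ x, |conv (K s) g x| ≤ M * om x :=
    fun s hs x => (hGb s hs x).1.trans (oM x).2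
  have F0' : ∀ s ∈ Icc (t / 2) (2 * t), ∀ x, |conv (K s) f x| ≤ M := fun s hs x => (F0 s hs x).trans (oM1 x)
  have G0' : ∀ s ∈ Icc (t / 2) (2 * t), ∀ x, |conv (K s) g x| ≤ M := fun s hs x => (G0 s hs x).trans (oM1 x)
  have F1 : ∀ i x, |conv (K1 i t) f x| ≤ M * om x := fun i x => ((hFb t htm x).2.1 i).trans (oM x).1
  have G1 : ∀ i x, |conv (K1 i t) g x| ≤ M * om x := fun i x => ((hGb t htm x).2.1 i).trans (oM x).2
  have F1' : ∀ i x, |conv (K1 i t) f x| ≤ M := fun i x => (F1 i x).trans (oM1 x)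
  have G1' : ∀ i x, |conv (K1 i t) g x| ≤ M := fun i x => (G1 i x).trans (oM1 x)
  have F2 : ∀ s ∈ Icc (t / 2) (2 * t), ∀ i j x, |conv (K2 i j s) f x| ≤ M * om x :=
    fun s hs i j x => ((hFb s hs x).2.2 i j).trans (oM x).1
  have G2 : ∀ s ∈ Icc (t / 2) (2 * t), ∀ i j x, |conv (K2 i j s) g x| ≤ M * om x :=
    fun s hs i j x => ((hGb s hs x).2.2 i j).trans (oM x).2
  -- continuity
  have cF := fun s (hs : 0 < s) => conv_K_cont hfi hs
  have cG := fun s (hs : 0 < s) => conv_K_cont hgi hs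
  have cF1 := conv_K1_cont hfi ht
  have cG1 := conv_K1_cont hgi ht
  have cF2 := conv_K2_cont hfi ht
  have cG2 := conv_K2_cont hgi ht
  have cFG : ∀ s, 0 < s → Continuous (fun x => (conv (K s) f x, conv (K s) g x)) :=
    fun s hs => (cF s hs).prodMk (cG s hs)
  have cB := fun s hs => (cont_B P).comp (cFG s hs)
  have cBz := (cont_Bz P).comp (cFG t ht)
  have cBe := (cont_Be P).comp (cFG t ht)
  have cBzz := (cont_Bzz P).comp (cFG t ht)
  have cBze := (cont_Bze P).comp (cFG t ht)
  have cBee := (cont_Bee P).comp (cFG t ht)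
  simp only [Function.comp_def] at cB cBz cBe cBzz cBze cBee
  have two : ∀ {a b A Bo : ℝ} {x : E d}, |a| ≤ A → |b| ≤ Bo * om x → |a * b| ≤ A * Bo * om x := by
    intro a b A Bo x ha hb
    rw [abs_mul, mul_assoc]
    exact mul_le_mul ha hb (abs_nonneg _) ((abs_nonneg _).trans ha)
  -- integrability of pieces
  have iQ1 : ∀ l, Integrable (fun x => Bzz P (conv (K t) f x) (conv (K t) g x) * conv (K1 l t) f x ^ 2) := by
    intro l
    refine integrable_of_om (C := D3 * (M * M)) (cBzz.mul ((cF1 l).pow 2)) fun x => ?_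
    exact two (hBzz _ _ (F0' t htm x) (G0' t htm x)) (by rw [sq]; exact two (F1' l x) (F1 l x))
  have iQ2 : ∀ l, Integrable (fun x => 2 * Bze P (conv (K t) f x) (conv (K t) g x) *
      (conv (K1 l t) f x * conv (K1 l t) g x)) := by
    intro l
    refine integrable_of_om (C := (2 * D4) * (M * M)) ((continuous_const.mul cBze).mul ((cF1 l).mul (cG1 l)))
      fun x => ?_
    refine two ?_ (two (F1' l x) (G1 l x))
    rw [abs_mul, abs_two]
    exact mul_le_mul_of_nonneg_left (hBze _ _ (F0' t htm x) (G0' t htm x)) (by norm_num)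
  have iQ3 : ∀ l, Integrable (fun x => Bee P (conv (K t) f x) (conv (K t) g x) * conv (K1 l t) g x ^ 2) := by
    intro l
    refine integrable_of_om (C := D5 * (M * M)) (cBee.mul ((cG1 l).pow 2)) fun x => ?_
    exact two (hBee _ _ (F0' t htm x) (G0' t htm x)) (by rw [sq]; exact two (G1' l x) (G1 l x))
  have iQ : ∀ l, Integrable (fun x => Bzz P (conv (K t) f x) (conv (K t) g x) * conv (K1 l t) f x ^ 2 +
        2 * Bze P (conv (K t) f x) (conv (K t) g x) * (conv (K1 l t) f x * conv (K1 l t) g x) +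
        Bee P (conv (K t) f x) (conv (K t) g x) * conv (K1 l t) g x ^ 2) :=
    fun l => ((iQ1 l).add (iQ2 l)).add (iQ3 l)
  have iS : ∀ l, Integrable (fun x => Bz P (conv (K t) f x) (conv (K t) g x) * conv (K2 l l t) f x +
        Be P (conv (K t) f x) (conv (K t) g x) * conv (K2 l l t) g x) := by
    intro l
    refine Integrable.add ?_ ?_
    · exact integrable_of_om (C := D1 * M) (cBz.mul (cF2 l l)) fun x =>
        two (hBz _ _ (F0' t htm x) (G0' t htm x)) (F2 t htm l l x)
    · exact integrable_of_om (C := D2 * M) (cBe.mul (cG2 l l)) fun x =>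
        two (hBe _ _ (F0' t htm x) (G0' t htm x)) (G2 t htm l l x)
  have iH : ∀ l, Integrable (fun x => Bz P (conv (K t) f x) (conv (K t) g x) * conv (K1 l t) f x +
        Be P (conv (K t) f x) (conv (K t) g x) * conv (K1 l t) g x) := by
    intro l
    refine Integrable.add ?_ ?_
    · exact integrable_of_om (C := D1 * M) (cBz.mul (cF1 l)) fun x =>
        two (hBz _ _ (F0' t htm x) (G0' t htm x)) (F1 l x)
    · exact integrable_of_om (C := D2 * M) (cBe.mul (cG1 l)) fun x =>
        two (hBe _ _ (F0' t htm x) (G0' t htm x)) (G1 l x)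
  have zero : ∀ l, ∫ x, ((Bz P (conv (K t) f x) (conv (K t) g x) * conv (K2 l l t) f x +
        Be P (conv (K t) f x) (conv (K t) g x) * conv (K2 l l t) g x) +
      (Bzz P (conv (K t) f x) (conv (K t) g x) * conv (K1 l t) f x ^ 2 +
        2 * Bze P (conv (K t) f x) (conv (K t) g x) * (conv (K1 l t) f x * conv (K1 l t) g x) +
        Bee P (conv (K t) f x) (conv (K t) g x) * conv (K1 l t) g x ^ 2)) = 0 := by
    intro l
    refine integral_lineDeriv_zero (v := ee l) (iH l) ((iS l).add (iQ l)) fun x => ?_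
    have a1 := conv_line1 hfi ht x l 0
    have a2 := conv_line1 hgi ht x l 0
    have a3 := conv_line2 hfi ht x l l 0
    have a4 := conv_line2 hgi ht x l l 0
    have b1 := hasDerivAt_Bz P a1 a2
    have b2 := hasDerivAt_Be P a1 a2
    have b3 := (b1.mul a3).add (b2.mul a4)
    unfold HasLineDerivAt
    refine b3.congr_deriv ?_
    simp only [zero_smul, add_zero]
    ring
  refine ⟨?_, integrable_finset_sum _ fun l _ => iQ l⟩
  have main : HasDerivAt (fun t => ∫ x, (B P (conv (K t) f x) (conv (K t) g x) - B P 0 0))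
      (∫ x, (Bz P (conv (K t) f x) (conv (K t) g x) * (∑ l, conv (K2 l l t) f x) +
        Be P (conv (K t) f x) (conv (K t) g x) * (∑ l, conv (K2 l l t) g x))) t := by
    have hsum : ∀ s ∈ Icc (t / 2) (2 * t), ∀ x, |∑ l, conv (K2 l l s) f x| ≤ d * M * om x ∧
        |∑ l, conv (K2 l l s) g x| ≤ d * M * om x := by
      intro s hs x
      constructor
      · refine (Finset.abs_sum_le_sum_abs _ _).trans ((Finset.sum_le_sum fun l _ => F2 s hs l l x).trans ?_)
        simp [mul_assoc]
      · refine (Finset.abs_sum_le_sum_abs _ _).trans ((Finset.sum_le_sum fun l _ => G2 s hs l l x).trans ?_)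
        simp [mul_assoc]
    refine (hasDerivAt_integral_of_dominated_loc_of_deriv_le
      (F := fun s x => B P (conv (K s) f x) (conv (K s) g x) - B P 0 0)
      (F' := fun s x => Bz P (conv (K s) f x) (conv (K s) g x) * (∑ l, conv (K2 l l s) f x) +
        Be P (conv (K s) f x) (conv (K s) g x) * (∑ l, conv (K2 l l s) g x))
      (bound := fun x => (D1 * (d * M) + D2 * (d * M)) * om x)
      (Icc_mem_nhds (by linarith) (by linarith) : Icc (t / 2) (2 * t) ∈ nhds t) ?_ ?_ ?_ ?_
      (om_integrable.const_mul _) ?_).2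
    · filter_upwards [lt_mem_nhds ht] with s hs
      exact ((cB s hs).sub continuous_const).aestronglyMeasurable
    · -- integrability of B - B0
      refine integrable_of_om (C := P.C1 * (M ^ P.p + M ^ P.q) + P.C1 *
        (P.k ^ (P.p - 2) + P.k ^ (2 - P.q)) * M ^ 2) ((cB t ht).sub continuous_const) fun x => ?_
      rw [abs_of_nonneg (B_nonneg P _ _)]
      refine (B_upper P _ _).trans ?_
      have hC1 : 0 ≤ P.C1 := by have := C_pos P; unfold Par.C1; positivity
      have hk := P.hk
      have pw : ∀ {r a : ℝ}, 1 ≤ r → |a| ≤ M * om x → |a| ^ r ≤ M ^ r * om x := by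
        intro r a hr ha
        calc |a| ^ r ≤ (M * om x) ^ r := Real.rpow_le_rpow (abs_nonneg _) ha (by linarith)
          _ = M ^ r * om x ^ r := Real.mul_rpow hM0 (om_pos x).le
          _ ≤ M ^ r * om x ^ (1:ℝ) := by
            gcongr ?_ * ?_
            exact Real.rpow_le_rpow_of_exponent_ge (om_pos x) (om_le_one x) hr
          _ = _ := by rw [Real.rpow_one]
      have p1 := pw (by linarith [P.hp] : 1 ≤ P.p) (F0 t htm x)
      have p2 := pw (by linarith [P.hq] : 1 ≤ P.q) (G0 t htm x)
      have p3 := pw (by norm_num : (1:ℝ) ≤ 2) (F0 t htm x)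
      rw [Real.rpow_two, Real.rpow_two, sq_abs] at p3
      calc _ ≤ P.C1 * (M ^ P.p * om x + M ^ P.q * om x) +
            P.C1 * (P.k ^ (P.p - 2) + P.k ^ (2 - P.q)) * (M ^ 2 * om x) := by gcongr
        _ = _ := by ring
    · exact ((cBz.mul (continuous_finset_sum _ fun l _ => cF2 l l)).add
        (cBe.mul (continuous_finset_sum _ fun l _ => cG2 l l))).aestronglyMeasurable
    · refine Eventually.of_forall fun x s hs => ?_
      have h1 := two (hBz _ _ (F0' s hs x) (G0' s hs x)) (hsum s hs x).1
      have h2 := two (hBe _ _ (F0' s hs x) (G0' s hs x)) (hsum s hs x).2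
      refine (abs_add_le _ _).trans ((add_le_add h1 h2).trans_eq ?_)
      ring
    · refine Eventually.of_forall fun x s hs => ?_
      have hs0 : 0 < s := by have := hs.1; linarith
      exact (hasDerivAt_B P (conv_t hfi hs0 x) (conv_t hgi hs0 x)).sub_const _
  refine main.congr_deriv ?_
  have e1 : ∀ x, Bz P (conv (K t) f x) (conv (K t) g x) * (∑ l, conv (K2 l l t) f x) +
        Be P (conv (K t) f x) (conv (K t) g x) * (∑ l, conv (K2 l l t) g x) =
      ∑ l, (Bz P (conv (K t) f x) (conv (K t) g x) * conv (K2 l l t) f x +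
        Be P (conv (K t) f x) (conv (K t) g x) * conv (K2 l l t) g x) := by
    intro x; rw [Finset.mul_sum, Finset.mul_sum, Finset.sum_add_distrib]
  simp_rw [e1]
  rw [integral_finset_sum _ fun l _ => iS l, integral_finset_sum _ fun l _ => iQ l, ← Finset.sum_neg_distrib]
  refine Finset.sum_congr rfl fun l _ => ?_
  have := zero l
  rw [integral_add (iS l) (iQ l)] at this
  linarith

end HK

namespace HK
variable {d : ℕ}

lemma BC.rpow {f : E d → ℝ} (hf : BC f) {r : ℝ} (hr : 0 < r) : BC (fun x => |f x| ^ r) := by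
  obtain ⟨M, hM⟩ := hf.bdd
  obtain ⟨L, hL, hs⟩ := hf.supp
  refine ⟨hf.meas.abs.pow_const r, ⟨M ^ r, fun x => ?_⟩, ⟨L, hL, fun x hx => ?_⟩⟩
  · rw [abs_of_nonneg (Real.rpow_nonneg (abs_nonneg _) _)]
    exact Real.rpow_le_rpow (abs_nonneg _) (hM x) hr.le
  · rw [hs x hx, abs_zero, Real.zero_rpow hr.ne']

lemma conv_K_jensen {f : E d → ℝ} (hf : BC f) {r r' : ℝ} (hr : r.HolderConjugate r') {t : ℝ} (ht : 0 < t)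
    (x : E d) : |conv (K t) f x| ^ r ≤ conv (K t) (fun y => |f y| ^ r) x := by
  obtain ⟨C, hC, h⟩ := K_bounds1 (d := d) ht
  have hkb : ∀ z : E d, |K t z| ≤ C := bdd_of_om hC fun z => (h z).1
  have hr0 := hr.pos
  have hfr := (hf.rpow hr0).integrable
  have i1 := conv_integrable hfr cont_K hkb x
  have i2 := conv_integrable hf.integrable.abs cont_K hkb x
  have i3 : Integrable (fun y => K t (x - y)) := (int_K ht).comp_sub_left x
  have i3' : ∫ y, K t (x - y) = 1 := by rw [integral_sub_left_eq_self (K t) volume x, integral_K ht]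
  set m := |conv (K t) f x| with hm
  have hm0 : 0 ≤ m := abs_nonneg _
  have h1 : m ≤ ∫ y, K t (x - y) * |f y| := by
    rw [hm]; unfold conv
    refine abs_integral_le_integral_abs.trans_eq ?_
    congr 1; ext y; rw [abs_mul, abs_of_pos (K_pos ht _)]
  have h2 : (∫ y, K t (x - y) * |f y|) * m ^ (r - 1) ≤
      (∫ y, K t (x - y) * |f y| ^ r) / r + m ^ r / r' := by
    have : ∀ y, K t (x - y) * |f y| * m ^ (r - 1) ≤
        K t (x - y) * |f y| ^ r * (1 / r) + K t (x - y) * (m ^ r / r') := by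
      intro y
      have hy := Real.young_inequality_of_nonneg (abs_nonneg (f y)) (Real.rpow_nonneg hm0 (r - 1)) hr
      rw [← Real.rpow_mul hm0, hr.sub_one_mul_conj] at hy
      calc _ = K t (x - y) * (|f y| * m ^ (r - 1)) := by ring
        _ ≤ K t (x - y) * (|f y| ^ r / r + m ^ r / r') :=
          mul_le_mul_of_nonneg_left hy (K_pos ht _).le
        _ = _ := by ring
    rw [← integral_mul_const]
    refine (integral_mono (i2.mul_const _) ((i1.mul_const _).add (i3.mul_const _)) this).trans_eq ?_
    simp only [Pi.add_apply]
    rw [integral_add (i1.mul_const _) (i3.mul_const _), integral_mul_const, integral_mul_const, i3']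
    ring
  have h3 : m ^ r ≤ (∫ y, K t (x - y) * |f y|) * m ^ (r - 1) := by
    rcases hm0.eq_or_lt with h0 | h0
    · rw [← h0, Real.zero_rpow hr.ne_zero]
      apply mul_nonneg _ (Real.rpow_nonneg le_rfl _)
      exact integral_nonneg fun y => mul_nonneg (K_pos ht _).le (abs_nonneg _)
    · calc m ^ r = m * m ^ (r - 1) := by rw [Real.rpow_sub_one h0.ne']; field_simp
        _ ≤ _ := by gcongr
  have h4 := hr.inv_add_inv_eq_one
  unfold conv
  have h5 : m ^ r ≤ (∫ y, K t (x - y) * |f y| ^ r) / r + m ^ r / r' := h3.trans h2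
  have h6 : m ^ r / r' = m ^ r - m ^ r / r := by
    rw [div_eq_mul_inv, div_eq_mul_inv]
    have : r'⁻¹ = 1 - r⁻¹ := by linarith
    rw [this]; ring
  have h7 : m ^ r / r ≤ (∫ y, K t (x - y) * |f y| ^ r) / r := by linarith
  exact (div_le_div_iff_of_pos_right hr0).1 h7

lemma conv_K_integral {h : E d → ℝ} (hh : Integrable h) {t : ℝ} (ht : 0 < t) :
    Integrable (conv (K t) h) ∧ ∫ x, conv (K t) h x = ∫ x, h x := by
  have e : conv (K t) h = convolution h (K t) (ContinuousLinearMap.mul ℝ ℝ) volume := by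
    ext x; unfold conv convolution
    congr 1; ext y; simp [mul_comm]
  constructor
  · rw [e]; exact hh.integrable_convolution _ (int_K ht)
  · rw [e, integral_convolution _ hh (int_K ht), integral_K ht]
    simp

lemma conv_K_Lr {f : E d → ℝ} (hf : BC f) {r r' : ℝ} (hr : r.HolderConjugate r') {t : ℝ} (ht : 0 < t) :
    ∫ x, |conv (K t) f x| ^ r ≤ ∫ x, |f x| ^ r := by
  have h := conv_K_integral (hf.rpow hr.pos).integrable ht
  rw [← h.2]
  exact integral_mono_of_nonneg (Eventually.of_forall fun x => Real.rpow_nonneg (abs_nonneg _) _) h.1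
    (Eventually.of_forall fun x => conv_K_jensen hf hr ht x)

lemma conv_K_pow_int {f : E d → ℝ} (hf : BC f) {r r' : ℝ} (hr : r.HolderConjugate r') {t : ℝ} (ht : 0 < t) :
    Integrable (fun x => |conv (K t) f x| ^ r) := by
  refine (conv_K_integral (hf.rpow hr.pos).integrable ht).1.mono'
    (((conv_K_cont hf.integrable ht).abs.rpow_const fun x => Or.inr hr.pos.le).aestronglyMeasurable)
    (Eventually.of_forall fun x => ?_)
  rw [Real.norm_of_nonneg (Real.rpow_nonneg (abs_nonneg _) _)]
  exact conv_K_jensen hf hr ht x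

lemma near_gt {p q : ℝ} (hp : 2 < p) (hpq : p.HolderConjugate q) : ∃ C : ℝ, 0 ≤ C ∧
    ∀ f g : E d → ℝ, BC f → BC g → ∀ (i j : Fin d) (θ θ' ψ ψ' : ℝ → ℝ),
      (∀ t, 0 < t → HasDerivAt θ (θ' t) t) → (∀ t, 0 < t → HasDerivAt ψ (ψ' t) t) →
      (∀ t, 0 < t → |θ' t| ≤ 2 * (∫ x, |conv (K1 i t) f x| * |conv (K1 j t) g x|) - ψ' t) →
      (∀ t, 0 < t → 0 ≤ ψ t) → ∀ ε T, 0 < ε → ε ≤ T →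
      |θ T - θ ε| ≤ C * ((∫ x, |f x| ^ p) + ∫ x, |g x| ^ q) + ψ ε := by
  have hq1 : 1 < q := hpq.symm.lt
  have hq2 : q < 2 := by
    have h1 := hpq.mul_eq_add
    nlinarith
  have hs : 1 / p + 1 / q = 1 := by simpa [one_div] using hpq.inv_add_inv_eq_one
  refine ⟨(Bell.Par.mk p q 1 hp hq1 hq2 hs one_pos).C1, ?_, ?_⟩
  · have := Bell.C_pos (Bell.Par.mk p q 1 hp hq1 hq2 hs one_pos); unfold Bell.Par.C1; positivity
  intro f g hf hg i j θ θ' ψ ψ' hθ hψ hle hψ0 ε T hε hεT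
  set C := (Bell.Par.mk p q 1 hp hq1 hq2 hs one_pos).C1
  have hC : 0 ≤ C := by
    have := Bell.C_pos (Bell.Par.mk p q 1 hp hq1 hq2 hs one_pos)
    simp only [C]; unfold Bell.Par.C1; positivity
  have h22 : (2:ℝ).HolderConjugate 2 := by
    rw [Real.holderConjugate_iff]; norm_num
  have key : ∀ k : ℝ, 0 < k → |θ T - θ ε| ≤ C * ((∫ x, |f x| ^ p) + ∫ x, |g x| ^ q) +
      C * (k ^ (p - 2) + k ^ (2 - q)) * (∫ x, |conv (K ε) f x| ^ (2:ℝ)) + ψ ε := by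
    intro k hk
    let P : Bell.Par := Bell.Par.mk p q k hp hq1 hq2 hs hk
    set φ : ℝ → ℝ := fun t => ∫ x, (Bell.B P (conv (K t) f x) (conv (K t) g x) - Bell.B P 0 0) with hφ
    have hφd := fun t (ht : 0 < t) => bell_deriv P hf hg ht
    set Q : ℝ → ℝ := fun t => ∫ x, ∑ l, (Bell.Bzz P (conv (K t) f x) (conv (K t) g x) * conv (K1 l t) f x ^ 2 +
        2 * Bell.Bze P (conv (K t) f x) (conv (K t) g x) * (conv (K1 l t) f x * conv (K1 l t) g x) +
        Bell.Bee P (conv (K t) f x) (conv (K t) g x) * conv (K1 l t) g x ^ 2) with hQ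
    have hQd : ∀ t, 0 < t → HasDerivAt φ (-Q t) t := fun t ht => (hφd t ht).1
    have hQ2 : ∀ t, 0 < t → 2 * (∫ x, |conv (K1 i t) f x| * |conv (K1 j t) g x|) ≤ Q t := by
      intro t ht
      rw [← integral_const_mul]
      refine integral_mono_of_nonneg (Eventually.of_forall fun x => by positivity) (hφd t ht).2
        (Eventually.of_forall fun x => ?_)
      exact Bell.hess_lower_sum P _ _ (fun l => conv (K1 l t) f x) (fun l => conv (K1 l t) g x) i j
    have hφ0 : ∀ t, 0 ≤ φ t := fun t => integral_nonneg fun x => Bell.B_nonneg P _ _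
    have pos : ∀ t ∈ Icc ε T, 0 < t := fun t ht => lt_of_lt_of_le hε ht.1
    have pos' : ∀ t ∈ Ico ε T, 0 < t := fun t ht => lt_of_lt_of_le hε ht.1
    have main := image_norm_le_of_norm_deriv_right_le_deriv_boundary' (a := ε) (b := T)
      (f := fun t => θ t - θ ε) (f' := θ') (B := fun t => (φ ε + ψ ε) - (φ t + ψ t))
      (B' := fun t => -(-Q t + ψ' t))
      (fun t ht => ((hθ t (pos t ht)).sub_const _).continuousAt.continuousWithinAt)
      (fun t ht => ((hθ t (pos' t ht)).sub_const _).hasDerivWithinAt)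
      (by simp)
      (fun t ht => ((((hQd t (pos t ht)).add (hψ t (pos t ht)))).const_sub _).continuousAt.continuousWithinAt)
      (fun t ht => ((((hQd t (pos' t ht)).add (hψ t (pos' t ht)))).const_sub _).hasDerivWithinAt)
      (fun t ht => by
        rw [Real.norm_eq_abs]
        have h1 := hle t (pos' t ht)
        have h2 := hQ2 t (pos' t ht)
        linarith)
      (right_mem_Icc.2 hεT)
    rw [Real.norm_eq_abs] at main
    have hT0 := hφ0 T
    have hT1 := hψ0 T (lt_of_lt_of_le hε hεT)
    have up : φ ε ≤ C * ((∫ x, |f x| ^ p) + ∫ x, |g x| ^ q) +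
      C * (k ^ (p - 2) + k ^ (2 - q)) * (∫ x, |conv (K ε) f x| ^ (2:ℝ)) := by
      have i1 := conv_K_pow_int hf hpq hε
      have i2 := conv_K_pow_int hg hpq.symm hε
      have i3 := conv_K_pow_int hf h22 hε
      have u1 : φ ε ≤ ∫ x, (C * (|conv (K ε) f x| ^ p + |conv (K ε) g x| ^ q) +
          C * (k ^ (p - 2) + k ^ (2 - q)) * |conv (K ε) f x| ^ (2:ℝ)) := by
        refine integral_mono_of_nonneg (Eventually.of_forall fun x => Bell.B_nonneg P _ _)
          (((i1.add i2).const_mul _).add (i3.const_mul _)) (Eventually.of_forall fun x => ?_)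
        have := Bell.B_upper P (conv (K ε) f x) (conv (K ε) g x)
        beta_reduce
        rw [Real.rpow_two, sq_abs]
        exact this
      have i12 : Integrable (fun x => |conv (K ε) f x| ^ p + |conv (K ε) g x| ^ q) := i1.add i2
      rw [integral_add (i12.const_mul C) (i3.const_mul _), integral_const_mul, integral_const_mul,
        integral_add i1 i2] at u1
      refine u1.trans ?_
      have v1 := conv_K_Lr hf hpq hε
      have v2 := conv_K_Lr hg hpq.symm hε
      gcongr
    linarith
  have lim : Tendsto (fun k : ℝ => C * ((∫ x, |f x| ^ p) + ∫ x, |g x| ^ q) +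
      C * (k ^ (p - 2) + k ^ (2 - q)) * (∫ x, |conv (K ε) f x| ^ (2:ℝ)) + ψ ε) (nhdsWithin 0 (Ioi 0))
      (nhds (C * ((∫ x, |f x| ^ p) + ∫ x, |g x| ^ q) +
      C * ((0:ℝ) ^ (p - 2) + (0:ℝ) ^ (2 - q)) * (∫ x, |conv (K ε) f x| ^ (2:ℝ)) + ψ ε)) := by
    apply tendsto_nhdsWithin_of_tendsto_nhds
    have c1 := Real.continuous_rpow_const (q := p - 2) (by linarith)
    have c2 := Real.continuous_rpow_const (q := 2 - q) (by linarith)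
    have : Continuous (fun k : ℝ => C * ((∫ x, |f x| ^ p) + ∫ x, |g x| ^ q) +
      C * (k ^ (p - 2) + k ^ (2 - q)) * (∫ x, |conv (K ε) f x| ^ (2:ℝ)) + ψ ε) :=
      (continuous_const.add ((continuous_const.mul (c1.add c2)).mul continuous_const)).add continuous_const
    exact this.tendsto 0
  rw [Real.zero_rpow (by linarith), Real.zero_rpow (by linarith)] at lim
  simp only [add_zero, mul_zero, zero_mul] at lim
  refine ge_of_tendsto lim ?_
  filter_upwards [self_mem_nhdsWithin] with k hk
  exact key k hk

lemma near {p q : ℝ} (hp : p ≠ 2) (hpq : p.HolderConjugate q) : ∃ C : ℝ, 0 ≤ C ∧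
    ∀ f g : E d → ℝ, BC f → BC g → ∀ (i j : Fin d) (θ θ' ψ ψ' : ℝ → ℝ),
      (∀ t, 0 < t → HasDerivAt θ (θ' t) t) → (∀ t, 0 < t → HasDerivAt ψ (ψ' t) t) →
      (∀ t, 0 < t → |θ' t| ≤ 2 * (∫ x, |conv (K1 i t) f x| * |conv (K1 j t) g x|) - ψ' t) →
      (∀ t, 0 < t → 0 ≤ ψ t) → ∀ ε T, 0 < ε → ε ≤ T →
      |θ T - θ ε| ≤ C * ((∫ x, |f x| ^ p) + ∫ x, |g x| ^ q) + ψ ε := by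
  rcases lt_or_gt_of_ne hp with h | h
  · have hq : 2 < q := by
      have h1 := hpq.mul_eq_add
      have h2 := hpq.lt
      have h3 := hpq.symm.lt
      nlinarith
    obtain ⟨C, hC, hh⟩ := near_gt (d := d) hq hpq.symm
    refine ⟨C, hC, fun f g hf hg i j θ θ' ψ ψ' h1 h2 h3 h4 ε T h5 h6 => ?_⟩
    have := hh g f hg hf j i θ θ' ψ ψ' h1 h2 (fun t ht => by
      refine (h3 t ht).trans_eq ?_
      simp_rw [mul_comm]) h4 ε T h5 h6
    rwa [add_comm (∫ x, |g x| ^ q)] at this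
  · exact near_gt h hpq

end HK

namespace HK
variable {d : ℕ}

/-- coordinate derivative -/
def D (i : Fin d) (v : E d → ℝ) (x : E d) : ℝ := fderiv ℝ v x (ee i)

lemma D_cont {m : E d → ℝ} (hm : ContDiff ℝ 1 m) (i : Fin d) : Continuous (D i m) := by
  unfold D
  exact (hm.continuous_fderiv one_ne_zero).clm_apply continuous_const

lemma D_supp {m : E d → ℝ} (hm : HasCompactSupport m) (i : Fin d) : HasCompactSupport (D i m) :=
  hm.fderiv_apply ℝ (ee i)

lemma D_C1 {v : E d → ℝ} (hv : ContDiff ℝ 2 v) (i : Fin d) : ContDiff ℝ 1 (D i v) := by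
  unfold D
  exact (hv.fderiv_right (m := 1) le_rfl).clm_apply contDiff_const

lemma D_comm {v : E d → ℝ} (hv : ContDiff ℝ 2 v) (i j : Fin d) : D i (D j v) = D j (D i v) := by
  ext x
  have hd : Differentiable ℝ (fderiv ℝ v) := (hv.fderiv_right (m := 1) le_rfl).differentiable one_ne_zero
  have e : ∀ i j : Fin d, D i (D j v) x = fderiv ℝ (fderiv ℝ v) x (ee i) (ee j) := by
    intro i j
    show fderiv ℝ (fun y => fderiv ℝ v y (ee j)) x (ee i) = _
    rw [fderiv_clm_apply hd.differentiableAt (differentiableAt_const _)]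
    simp
  rw [e, e]
  have := (hv.contDiffAt (x := x)).isSymmSndFDerivAt (by simp)
  exact this.eq _ _

lemma K2_comm (i j : Fin d) (t : ℝ) : K2 i j t = K2 j i t := by
  ext z; unfold K2; rw [dl_comm i j]; ring

lemma K3_swap (i j l : Fin d) (t : ℝ) : K3 i j l t = K3 i l j t := by
  ext z; unfold K3; rw [dl_comm j l]; ring

lemma conv_ibp {t : ℝ} (ht : 0 < t) (a b c : Fin d) {m : E d → ℝ} (hm : ContDiff ℝ 1 m)
    (hs : HasCompactSupport m) (x : E d) :
    conv (K2 a b t) (D c m) x = conv (K3 a b c t) m x := by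
  have h := integral_bilinear_hasLineDerivAt_right_eq_neg_left_of_integrable (μ := (volume : Measure (E d)))
    (f := fun y : E d => K2 a b t (x - y)) (f' := fun y => -K3 a b c t (x - y)) (g := m) (g' := D c m) (v := ee c)
    (B := ContinuousLinearMap.mul ℝ ℝ)
    (by
      have c1 := @cont_K3 d t a b c
      refine Continuous.integrable_of_hasCompactSupport ?_ ?_
      · simp only [ContinuousLinearMap.mul_apply']
        exact ((c1.comp (continuous_const.sub continuous_id)).neg).mul hm.continuous
      · exact hs.mul_left)
    (by
      have c1 := @cont_K2 d t a b
      refine Continuous.integrable_of_hasCompactSupport ?_ ?_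
      · simp only [ContinuousLinearMap.mul_apply']
        exact (c1.comp (continuous_const.sub continuous_id)).mul (D_cont hm c)
      · exact (D_supp hs c).mul_left)
    (by
      have c1 := @cont_K2 d t a b
      refine Continuous.integrable_of_hasCompactSupport ?_ ?_
      · simp only [ContinuousLinearMap.mul_apply']
        exact (c1.comp (continuous_const.sub continuous_id)).mul hm.continuous
      · exact hs.mul_left)
    (fun y _ => by
      unfold HasLineDerivAt
      have h1 := (hasDerivAt_K2_line ht (x - y) a b c (-0)).scomp (0:ℝ) (hasDerivAt_neg (0:ℝ))
      simp only [neg_zero, zero_smul, add_zero, smul_eq_mul, neg_mul, one_mul] at h1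
      refine h1.congr_of_eventuallyEq (Eventually.of_forall fun s => ?_)
      simp only [Function.comp]
      congr 1
      module)
    (fun y _ => ((hm.differentiable one_ne_zero) y).hasFDerivAt.hasLineDerivAt (ee c))
  unfold conv
  simp only [ContinuousLinearMap.mul_apply', neg_mul, integral_neg, neg_neg] at h
  exact h

lemma conv_swap {t : ℝ} (ht : 0 < t) (a b c : Fin d) {m : E d → ℝ} (hm : ContDiff ℝ 1 m)
    (hs : HasCompactSupport m) (x : E d) :
    conv (K2 a b t) (D c m) x = conv (K2 a c t) (D b m) x := by
  rw [conv_ibp ht a b c hm hs, conv_ibp ht a c b hm hs, K3_swap]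

lemma conv_lap {t : ℝ} (ht : 0 < t) (i j : Fin d) {v : E d → ℝ} (hv : ContDiff ℝ 2 v)
    (hs : HasCompactSupport v) (x : E d) :
    ∑ l, conv (K2 l l t) (D i (D j v)) x = conv (K2 i j t) (fun y => ∑ l, D l (D l v) y) x := by
  have e : ∀ l, conv (K2 l l t) (D i (D j v)) x = conv (K2 i j t) (D l (D l v)) x := by
    intro l
    rw [conv_swap ht l l i (D_C1 hv j) (D_supp hs j), D_comm hv l j, K2_comm l i,
      conv_swap ht i l j (D_C1 hv l) (D_supp hs l)]
  simp_rw [e]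
  unfold conv
  simp_rw [Finset.mul_sum]
  rw [integral_finsetSum]
  intro l _
  refine Continuous.integrable_of_hasCompactSupport ?_ (D_supp (D_supp hs l) l).mul_left
  exact ((@cont_K2 d t i j).comp (continuous_const.sub continuous_id)).mul (D_cont (D_C1 hv l) l)

lemma BC.of_cont {w : E d → ℝ} (hw : Continuous w) (hs : HasCompactSupport w) : BC w := by
  refine ⟨hw.measurable, ?_, ?_⟩
  · obtain ⟨C, hC⟩ := hs.exists_bound_of_continuous hw
    exact ⟨C, hC⟩
  · obtain ⟨L, hL⟩ := hs.isBounded.subset_closedBall 0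
    refine ⟨|L| + 1, by positivity, fun x hx => ?_⟩
    by_contra h
    have := hL (subset_tsupport w h)
    rw [mem_closedBall_zero_iff] at this
    linarith [le_abs_self L]

lemma theta_deriv {w g : E d → ℝ} (hw : BC w) (hg : BC g) {t : ℝ} (ht : 0 < t) :
    HasDerivAt (fun t => ∫ x, conv (K t) w x * g x) (∫ x, (∑ l, conv (K2 l l t) w x) * g x) t := by
  obtain ⟨C, hC, h⟩ := conv_K_bounds hw (a := t / 2) (b := 2 * t) (by positivity)
  have hpos : ∀ s ∈ Icc (t / 2) (2 * t), 0 < s := fun s hs => by have := hs.1; linarith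
  refine (hasDerivAt_integral_of_dominated_loc_of_deriv_le
    (F := fun t x => conv (K t) w x * g x) (F' := fun t x => (∑ l, conv (K2 l l t) w x) * g x)
    (s := Icc (t / 2) (2 * t)) (bound := fun x => (∑ _l : Fin d, C) * |g x|)
    (Icc_mem_nhds (by linarith) (by linarith)) ?_ ?_ ?_ ?_ ?_ ?_).2
  · filter_upwards [lt_mem_nhds ht] with s hs
    exact (conv_K_cont hw.integrable hs).aestronglyMeasurable.mul hg.meas.aestronglyMeasurable
  · refine hg.integrable.bdd_mul (c := C) (conv_K_cont hw.integrable ht).aestronglyMeasurable ?_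
    refine Eventually.of_forall fun x => ?_
    exact bdd_of_om hC (fun x => (h t ⟨by linarith, by linarith⟩ x).1) x
  · refine Continuous.aestronglyMeasurable ?_ |>.mul hg.meas.aestronglyMeasurable
    exact continuous_finsetSum _ fun l _ => conv_K2_cont hw.integrable ht l l
  · refine Eventually.of_forall fun x s hs => ?_
    rw [norm_mul]
    refine mul_le_mul_of_nonneg_right ?_ (abs_nonneg _)
    refine (norm_sum_le _ _).trans (Finset.sum_le_sum fun l _ => ?_)
    exact bdd_of_om hC (fun x => (h s hs x).2.2 l l) x
  · exact hg.integrable.abs.const_mul _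
  · refine Eventually.of_forall fun x s hs => ?_
    exact (conv_t hw.integrable (hpos s hs) x).mul_const _

lemma theta_T {w g : E d → ℝ} (hd : 0 < d) (hw : BC w) (hg : BC g) :
    Tendsto (fun t => ∫ x, conv (K t) w x * g x) atTop (nhds 0) := by
  have key : ∀ t : ℝ, 0 < t → ‖∫ x, conv (K t) w x * g x‖ ≤
      ((4 * Real.pi * t) ^ (-((d : ℝ) / 2)) * ∫ y, |w y|) * ∫ x, |g x| := by
    intro t ht
    have hK : ∀ z : E d, |K t z| ≤ (4 * Real.pi * t) ^ (-((d : ℝ) / 2)) := by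
      intro z
      rw [abs_of_pos (K_pos ht z)]
      unfold K
      rw [neg_div]
      refine mul_le_of_le_one_right (by positivity) (Real.exp_le_one_iff.2 ?_)
      rw [neg_div]
      have : 0 ≤ ‖z‖ ^ 2 / (4 * t) := by positivity
      linarith
    have hc : ∀ x, |conv (K t) w x| ≤ (4 * Real.pi * t) ^ (-((d : ℝ) / 2)) * ∫ y, |w y| := by
      intro x
      unfold conv
      rw [← integral_const_mul]
      show ‖∫ y, K t (x - y) * w y‖ ≤ _
      refine norm_integral_le_of_norm_le (hw.integrable.abs.const_mul _) (Eventually.of_forall fun y => ?_)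
      rw [norm_mul]
      exact mul_le_mul_of_nonneg_right (hK _) (abs_nonneg _)
    rw [← integral_const_mul]
    refine norm_integral_le_of_norm_le (hg.integrable.abs.const_mul _) (Eventually.of_forall fun y => ?_)
    rw [norm_mul]
    exact mul_le_mul_of_nonneg_right (hc _) (abs_nonneg _)
  have lim : Tendsto (fun t : ℝ => ((4 * Real.pi * t) ^ (-((d : ℝ) / 2)) * ∫ y, |w y|) * ∫ x, |g x|) atTop
      (nhds ((0 * ∫ y, |w y|) * ∫ x, |g x|)) := by
    refine Tendsto.mul_const _ (Tendsto.mul_const _ ?_)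
    have h0 : (0:ℝ) < (d:ℝ) / 2 := by positivity
    exact (tendsto_rpow_neg_atTop h0).comp (tendsto_id.const_mul_atTop (by positivity))
  simp only [zero_mul] at lim
  refine squeeze_zero_norm' ?_ lim
  filter_upwards [eventually_gt_atTop 0] with t ht using key t ht

lemma K_scale {c : ℝ} (hc : 0 < c) (z : E d) : c ^ d * K 1 (c • z) = K ((c ^ 2)⁻¹) z := by
  unfold K
  rw [← mul_assoc]
  congr 1
  · rw [mul_one, Real.mul_rpow (x := 4 * Real.pi) (y := (c ^ 2)⁻¹) (by positivity) (by positivity), mul_comm]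
    congr 1
    rw [Real.inv_rpow (by positivity), ← Real.rpow_natCast c 2, ← Real.rpow_mul hc.le, ← Real.rpow_neg hc.le,
      ← Real.rpow_natCast]
    congr 1
    push_cast; ring
  · congr 1
    rw [norm_smul, Real.norm_of_nonneg hc.le]
    field_simp

lemma conv_K_tendsto {w : E d → ℝ} (hw : Continuous w) (hs : HasCompactSupport w) (x : E d) :
    Tendsto (fun c : ℝ => conv (K ((c ^ 2)⁻¹)) w x) atTop (nhds (w x)) := by
  have hf : Module.finrank ℝ (E d) = d := by simp
  have := tendsto_integral_comp_smul_smul_of_integrable' (μ := (volume : Measure (E d))) (φ := K 1) (g := w) (x₀ := x)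
    (fun z => (K_pos one_pos z).le) (integral_K one_pos) (by
      obtain ⟨C, hC, h⟩ := K_bounds1 (d := d) one_pos
      have lim : Tendsto (fun x : E d => C * (1 + ‖x‖)⁻¹) (Bornology.cobounded (E d)) (nhds (C * 0)) :=
        (tendsto_inv_atTop_zero.comp (tendsto_atTop_add_const_left _ 1 tendsto_norm_cobounded_atTop)).const_mul C
      rw [mul_zero] at lim
      refine squeeze_zero (fun x => by have := (K_pos one_pos x).le; positivity) (fun x => ?_) lim
      have h1 := (le_abs_self _).trans (h x).1
      rw [hf]
      calc ‖x‖ ^ d * K 1 x ≤ ‖x‖ ^ d * (C * om x) := mul_le_mul_of_nonneg_left h1 (by positivity)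
        _ ≤ (1 + ‖x‖) ^ d * (C * om x) := by
          refine mul_le_mul_of_nonneg_right ?_ (mul_nonneg hC (om_pos x).le)
          gcongr; linarith
        _ = C * (1 + ‖x‖)⁻¹ := by
          unfold om; field_simp; ring) ((hw.integrable_of_hasCompactSupport hs)) hw.continuousAt
  rw [hf] at this
  refine this.congr' ?_
  filter_upwards [eventually_gt_atTop 0] with c hc
  unfold conv
  congr 1; ext y
  rw [K_scale hc, smul_eq_mul]

lemma theta_0 {w g : E d → ℝ} (hw : Continuous w) (hs : HasCompactSupport w) (hg : BC g) :
    Tendsto (fun c : ℝ => ∫ x, conv (K ((c ^ 2)⁻¹)) w x * g x) atTop (nhds (∫ x, w x * g x)) := by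
  obtain ⟨M, hM⟩ := (BC.of_cont hw hs).bdd
  have hwi := hw.integrable_of_hasCompactSupport hs (μ := (volume : Measure (E d)))
  refine tendsto_integral_filter_of_dominated_convergence (fun x => M * |g x|) ?_ ?_ ?_ ?_
  · filter_upwards [eventually_gt_atTop 0] with c hc
    exact (conv_K_cont hwi (by positivity)).aestronglyMeasurable.mul hg.meas.aestronglyMeasurable
  · filter_upwards [eventually_gt_atTop 0] with c hc
    refine Eventually.of_forall fun x => ?_
    rw [norm_mul]
    refine mul_le_mul_of_nonneg_right ?_ (abs_nonneg _)
    have hc' : 0 < (c^2)⁻¹ := by positivity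
    have h1 : ∫ y, K ((c^2)⁻¹) (x - y) * M = M := by
      rw [integral_mul_const, integral_sub_left_eq_self (fun z => K ((c^2)⁻¹) z), integral_K hc', one_mul]
    rw [← h1]
    unfold conv
    show ‖∫ y, K ((c^2)⁻¹) (x - y) * w y‖ ≤ _
    refine norm_integral_le_of_norm_le (((int_K hc').comp_sub_left x).mul_const M) (Eventually.of_forall fun y => ?_)
    rw [norm_mul, Real.norm_of_nonneg (K_pos hc' _).le]
    exact mul_le_mul_of_nonneg_left (hM y) (K_pos hc' _).le
  · exact hg.integrable.abs.const_mul _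
  · exact Eventually.of_forall fun x => (conv_K_tendsto hw hs x).mul_const _

end HK

namespace HK
variable {d : ℕ}

/-- volume of the unit ball -/
def vb (d : ℕ) : ℝ := (volume (ball (0 : E d) 1)).toReal

lemma vb_pos : 0 < vb d :=
  ENNReal.toReal_pos (measure_ball_pos _ _ one_pos).ne' measure_ball_lt_top.ne

lemma vol_ball (z : E d) {r : ℝ} (hr : 0 < r) : volume (ball z r) = ENNReal.ofReal (vb d * r ^ (d : ℝ)) := by
  rw [Measure.addHaar_ball_of_pos volume z hr, mul_comm (vb d), ENNReal.ofReal_mul (by positivity), vb,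
    ENNReal.ofReal_toReal measure_ball_lt_top.ne, Real.rpow_natCast]
  simp

/-- Morrey bound. -/
def MB (p l : ℝ) (G : E d → ℝ≥0∞) (M : ℝ≥0∞) : Prop :=
  ∀ z : E d, ∀ r : ℝ, 0 < r → ∫⁻ y in ball z r, G y ^ p ≤ M ^ p * ENNReal.ofReal (r ^ l)

lemma MB.mono {p l : ℝ} (hp : 0 ≤ p) {G G' : E d → ℝ≥0∞} {M M' : ℝ≥0∞} (h : MB p l G M)
    (hG : ∀ᵐ x, G' x ≤ G x) (hM : M ≤ M') : MB p l G' M' := by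
  intro z r hr
  refine le_trans (lintegral_mono_ae ?_) ((h z r hr).trans ?_)
  · exact (ae_restrict_of_ae hG).mono fun x hx => ENNReal.rpow_le_rpow hx hp
  · exact mul_le_mul_left (ENNReal.rpow_le_rpow hM hp) _

lemma MB.add {p l : ℝ} (hp : 1 ≤ p) {G G' : E d → ℝ≥0∞} {M M' : ℝ≥0∞} (h : MB p l G M) (h' : MB p l G' M')
    (hG : AEMeasurable G) (hG' : AEMeasurable G') : MB p l (fun x => G x + G' x) (M + M') := by
  intro z r hr
  have hp0 : 0 < p := by linarith
  have m := ENNReal.lintegral_Lp_add_le (μ := volume.restrict (ball z r)) hG.restrict hG'.restrict hp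
  have e1 : ∀ {H : E d → ℝ≥0∞} {N : ℝ≥0∞}, MB p l H N →
      (∫⁻ y in ball z r, H y ^ p) ^ (1 / p) ≤ N * (ENNReal.ofReal (r ^ l)) ^ (1 / p) := by
    intro H N hH
    refine (ENNReal.rpow_le_rpow (hH z r hr) (by positivity)).trans_eq ?_
    rw [ENNReal.mul_rpow_of_nonneg _ _ (by positivity), ← ENNReal.rpow_mul, mul_one_div_cancel hp0.ne',
      ENNReal.rpow_one]
  have m2 := m.trans (add_le_add (e1 h) (e1 h'))
  rw [← add_mul] at m2
  have m3 := ENNReal.rpow_le_rpow m2 hp0.le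
  rw [← ENNReal.rpow_mul, one_div_mul_cancel hp0.ne', ENNReal.rpow_one, ENNReal.mul_rpow_of_nonneg _ _ hp0.le,
    ← ENNReal.rpow_mul, one_div_mul_cancel hp0.ne', ENNReal.rpow_one] at m3
  exact m3

lemma MB.const_mul {p l : ℝ} (hp : 0 ≤ p) {G : E d → ℝ≥0∞} {M : ℝ≥0∞} (h : MB p l G M) (hG : AEMeasurable G)
    (c : ℝ≥0∞) : MB p l (fun x => c * G x) (c * M) := by
  intro z r hr
  simp_rw [ENNReal.mul_rpow_of_nonneg _ _ hp]
  rw [lintegral_const_mul'' _ (hG.restrict.pow_const p), mul_assoc]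
  exact mul_le_mul_right (h z r hr) _

/-- Hölder -/
lemma MB.L1 {p q μ : ℝ} (hpq : p.HolderConjugate q) {G : E d → ℝ≥0∞} {M : ℝ≥0∞}
    (h : MB p (d - p * μ) G M) (hG : AEMeasurable G) (z : E d) {r : ℝ} (hr : 0 < r) :
    ∫⁻ y in ball z r, G y ≤ M * ENNReal.ofReal (vb d ^ (1 / q) * r ^ (d - μ)) := by
  have hp0 := hpq.pos
  have hq0 := hpq.symm.pos
  have h1 := ENNReal.lintegral_mul_le_Lp_mul_Lq (volume.restrict (ball z r)) hpq (f := G) (g := fun _ => 1)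
    hG.restrict aemeasurable_const
  simp only [Pi.mul_apply, mul_one, ENNReal.one_rpow, lintegral_const, one_mul, MeasurableSet.univ,
    Measure.restrict_apply, univ_inter] at h1
  refine h1.trans ?_
  have h2 := ENNReal.rpow_le_rpow (h z r hr) (z := 1 / p) (by positivity)
  rw [ENNReal.mul_rpow_of_nonneg _ _ (by positivity), ← ENNReal.rpow_mul, mul_one_div_cancel hp0.ne',
    ENNReal.rpow_one] at h2
  refine (mul_le_mul_left h2 _).trans_eq ?_
  rw [vol_ball z hr, mul_assoc, ENNReal.ofReal_rpow_of_nonneg (by positivity) (by positivity),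
    ENNReal.ofReal_rpow_of_nonneg (by have := vb_pos (d := d); positivity) (by positivity),
    ← ENNReal.ofReal_mul (by positivity)]
  congr 2
  rw [Real.mul_rpow vb_pos.le (by positivity), ← Real.rpow_mul hr.le, ← Real.rpow_mul hr.le, mul_left_comm,
    ← Real.rpow_add hr]
  congr 2
  have := hpq.inv_add_inv_eq_one
  have h3 : q⁻¹ = 1 - p⁻¹ := by linarith
  rw [one_div, one_div, h3]
  field_simp
  ring

/-- dyadic bound for the kernel `(a²+|x-y|²)^{-(d/2+1)}` -/
lemma far_kernel {μ : ℝ} (hμ : 0 < μ) {F : E d → ℝ≥0∞} (hF : Measurable F) {M : ℝ≥0∞} {x : E d}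
    (h : ∀ r : ℝ, 0 < r → ∫⁻ y in ball x r, F y ≤ M * ENNReal.ofReal (r ^ (d - μ))) {a : ℝ} (ha : 0 < a) :
    ∫⁻ y, ENNReal.ofReal ((a ^ 2 + ‖x - y‖ ^ 2) ^ (-((d : ℝ) / 2 + 1))) * F y ≤
      M * ENNReal.ofReal (2 ^ (d - μ + 1) * a ^ (-2 - μ)) := by
  have pt : ∀ y, ENNReal.ofReal ((a ^ 2 + ‖x - y‖ ^ 2) ^ (-((d : ℝ) / 2 + 1))) * F y ≤
      ∑' k : ℕ, ENNReal.ofReal ((2 ^ k * a) ^ (-((d : ℝ) + 2))) * (ball x (2 ^ (k + 1) * a)).indicator F y := by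
    intro y
    have hex : ∃ k : ℕ, ‖x - y‖ < 2 ^ (k + 1) * a := by
      obtain ⟨n, hn⟩ := pow_unbounded_of_one_lt (‖x - y‖ / a) (one_lt_two)
      rw [div_lt_iff₀ ha] at hn
      refine ⟨n, hn.trans_le ?_⟩
      rw [pow_succ]
      nlinarith [pow_pos (two_pos : (0:ℝ) < 2) n]
    classical
    set k := Nat.find hex
    have hk := Nat.find_spec hex
    refine le_trans ?_ (ENNReal.le_tsum k)
    have hy : y ∈ ball x (2 ^ (k + 1) * a) := by
      rw [mem_ball, dist_eq_norm, norm_sub_rev]; exact hk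
    rw [indicator_of_mem hy]
    refine mul_le_mul_left (ENNReal.ofReal_le_ofReal ?_) _
    have hlow : (2 ^ k * a) ^ 2 ≤ a ^ 2 + ‖x - y‖ ^ 2 := by
      rcases Nat.eq_zero_or_pos k with h0 | h0
      · rw [h0]; simp
      · have := Nat.find_min hex (m := k - 1) (by omega)
        rw [not_lt, Nat.sub_add_cancel h0] at this
        have h3 : (2 ^ k * a) ^ 2 ≤ ‖x - y‖ ^ 2 := by gcongr
        nlinarith
    calc (a ^ 2 + ‖x - y‖ ^ 2) ^ (-((d : ℝ) / 2 + 1)) ≤ ((2 ^ k * a) ^ 2) ^ (-((d : ℝ) / 2 + 1)) := by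
          refine Real.rpow_le_rpow_of_nonpos (by positivity) hlow ?_
          have : (0:ℝ) ≤ d := by positivity
          linarith
      _ = (2 ^ k * a) ^ (-((d : ℝ) + 2)) := by
          rw [← Real.rpow_natCast (2 ^ k * a) 2, ← Real.rpow_mul (by positivity)]
          congr 1; push_cast; ring
  calc _ ≤ ∫⁻ y, ∑' k : ℕ, ENNReal.ofReal ((2 ^ k * a) ^ (-((d : ℝ) + 2))) * (ball x (2 ^ (k + 1) * a)).indicator F y :=
        lintegral_mono pt
    _ = ∑' k : ℕ, ENNReal.ofReal ((2 ^ k * a) ^ (-((d : ℝ) + 2))) * ∫⁻ y in ball x (2 ^ (k + 1) * a), F y := by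
        rw [lintegral_tsum fun k => ((hF.indicator measurableSet_ball).const_mul _).aemeasurable]
        congr 1; ext k
        rw [lintegral_const_mul _ (hF.indicator measurableSet_ball), lintegral_indicator measurableSet_ball]
    _ ≤ ∑' k : ℕ, (M * ENNReal.ofReal (2 ^ (d - μ) * a ^ (-2 - μ))) * 2⁻¹ ^ k := by
        refine ENNReal.tsum_le_tsum fun k => ?_
        refine (mul_le_mul_right (h _ (by positivity)) _).trans ?_
        rw [mul_left_comm, mul_assoc]
        refine mul_le_mul_right ?_ _
        have e2 : (2⁻¹ : ℝ≥0∞) ^ k = ENNReal.ofReal ((2:ℝ)⁻¹ ^ k) := by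
          rw [ENNReal.ofReal_pow (by norm_num), ENNReal.ofReal_inv_of_pos two_pos]; simp
        rw [e2, ← ENNReal.ofReal_mul (by positivity), ← ENNReal.ofReal_mul (by positivity)]
        refine ENNReal.ofReal_le_ofReal ?_
        have hb : (0:ℝ) < 2 ^ k * a := by positivity
        have e3 : (2:ℝ) ^ (k + 1) * a = 2 * (2 ^ k * a) := by rw [pow_succ]; ring
        rw [e3, Real.mul_rpow two_pos.le hb.le, mul_left_comm, ← Real.rpow_add hb,
          show -((d:ℝ) + 2) + (d - μ) = -2 - μ by ring, Real.mul_rpow (by positivity) ha.le, mul_assoc, mul_comm (a ^ (-2 - μ))]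
        refine mul_le_mul_of_nonneg_left (mul_le_mul_of_nonneg_right ?_ (by positivity)) (by positivity)
        rw [inv_pow, ← Real.rpow_neg_one]
        refine Real.rpow_le_rpow_of_exponent_le (one_le_pow₀ one_le_two) (by linarith)
    _ = _ := by
        rw [ENNReal.tsum_mul_left, ENNReal.tsum_geometric_two, mul_assoc]
        congr 1
        rw [show (2:ℝ≥0∞) = ENNReal.ofReal 2 by simp, ← ENNReal.ofReal_mul (by positivity)]
        congr 1
        rw [Real.rpow_add two_pos, Real.rpow_one]; ring

lemma int_prod {k f : E d → ℝ} (hk : Integrable k) (hf : Integrable f) :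
    Integrable (fun p : E d × E d => k (p.1 - p.2) * f p.2) (volume.prod volume) := by
  have := hf.convolution_integrand (ContinuousLinearMap.mul ℝ ℝ) hk
  refine this.congr (Eventually.of_forall fun p => ?_)
  simp [mul_comm]

lemma near_id {f g : E d → ℝ} (hf : Integrable f) (hg : Integrable g) {t : ℝ} (ht : 0 < t) (i j : Fin d) :
    ∫ z, conv (K1 i t) f z * conv (K1 j t) g z = - ∫ y, f y * conv (K2 i j (2 * t)) g y := by
  obtain ⟨C, hC, hb⟩ := K_bounds1 (d := d) ht
  have hb1 : ∀ i, ∀ z : E d, |K1 i t z| ≤ C := fun i => bdd_of_om hC fun z => (hb z).2.1 i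
  have hGb : ∀ z, |conv (K1 j t) g z| ≤ C * ∫ y, |g y| := by
    intro x
    unfold conv
    rw [← integral_const_mul]
    show ‖∫ y, K1 j t (x - y) * g y‖ ≤ _
    refine norm_integral_le_of_norm_le (hg.abs.const_mul _) (Eventually.of_forall fun y => ?_)
    rw [norm_mul]
    exact mul_le_mul_of_nonneg_right (hb1 j _) (abs_nonneg _)
  have hGc := conv_K1_cont hg ht j
  have inner : ∀ y, ∫ z, K1 i t (z - y) * conv (K1 j t) g z = - conv (K2 i j (2 * t)) g y := by
    intro y
    calc ∫ z, K1 i t (z - y) * conv (K1 j t) g z = ∫ z, ∫ x, K1 i t (z - y) * (K1 j t (z - x) * g x) := by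
          congr 1; ext z; rw [integral_const_mul]; rfl
      _ = ∫ x, ∫ z, K1 i t (z - y) * (K1 j t (z - x) * g x) := by
          refine integral_integral_swap ?_
          refine (int_prod (int_K1 ht j) hg).bdd_mul (c := C) ?_ (Eventually.of_forall fun p => hb1 i _)
          exact (((cont_K1 i).comp (continuous_fst.sub continuous_const))).aestronglyMeasurable
      _ = ∫ x, -(K2 i j (2 * t) (y - x) * g x) := by
          congr 1; ext x
          simp_rw [← mul_assoc]
          rw [integral_mul_const, semigroup ht]; ring
      _ = _ := by rw [integral_neg]; rfl
  calc ∫ z, conv (K1 i t) f z * conv (K1 j t) g z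
      = ∫ z, ∫ y, conv (K1 j t) g z * (K1 i t (z - y) * f y) := by
        congr 1; ext z; rw [integral_const_mul, mul_comm]; rfl
    _ = ∫ y, ∫ z, conv (K1 j t) g z * (K1 i t (z - y) * f y) := by
        refine integral_integral_swap ?_
        refine (int_prod (int_K1 ht i) hf).bdd_mul (c := C * ∫ y, |g y|) ?_ (Eventually.of_forall fun p => hGb _)
        exact (hGc.comp continuous_fst).aestronglyMeasurable
    _ = ∫ y, -(f y * conv (K2 i j (2 * t)) g y) := by
        congr 1; ext y
        rw [← mul_neg, ← inner y, ← integral_const_mul]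
        congr 1; ext z; ring
    _ = _ := by rw [integral_neg]

end HK

namespace HK
variable {d : ℕ}

lemma far_pt {p q μ : ℝ} (hpq : p.HolderConjugate q) (hμ : 0 < μ) : ∃ C : ℝ, 0 ≤ C ∧
    ∀ f : E d → ℝ, Measurable f → ∀ M : ℝ, 0 ≤ M → MB p (d - p * μ) (fun x => ENNReal.ofReal |f x|) (ENNReal.ofReal M) →
    ∀ (f2 : E d → ℝ) (x : E d) (r t : ℝ), 0 < r → 0 < t → (∀ y, |f2 y| ≤ |f y|) → (∀ y ∈ ball x r, f2 y = 0) →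
    ∀ i j, |conv (K2 i j (2 * t)) f2 x| ≤ C * M * (t + r ^ 2) ^ (-(μ / 2) - 1) := by
  obtain ⟨C0, hC0, hdec⟩ := K2_decay (d := d)
  refine ⟨C0 * 2 ^ ((d:ℝ) / 2 + 1) * (vb d ^ (1 / q) * 2 ^ (d - μ + 1)), by have := vb_pos (d := d); positivity, ?_⟩
  intro f hf M hM hMB f2 x r t hr ht hle hz i j
  set a := Real.sqrt (t + r ^ 2) with ha'
  have ha2 : a ^ 2 = t + r ^ 2 := Real.sq_sqrt (by positivity)
  have ha : 0 < a := Real.sqrt_pos.2 (by positivity)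
  have hv := vb_pos (d := d)
  have fk := far_kernel (μ := μ) hμ (F := fun y => ENNReal.ofReal |f y|) (by fun_prop)
    (M := ENNReal.ofReal M * ENNReal.ofReal (vb d ^ (1 / q))) (x := x) (fun R hR => by
      have := hMB.L1 hpq (by fun_prop) x hR
      refine this.trans_eq ?_
      rw [ENNReal.ofReal_mul (by positivity), mul_assoc]) ha
  have pt : ∀ y, ‖K2 i j (2 * t) (x - y) * f2 y‖ₑ ≤ ENNReal.ofReal (C0 * 2 ^ ((d:ℝ) / 2 + 1)) *
      (ENNReal.ofReal ((a ^ 2 + ‖x - y‖ ^ 2) ^ (-((d : ℝ) / 2 + 1))) * ENNReal.ofReal |f y|) := by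
    intro y
    rw [Real.enorm_eq_ofReal_abs, ← ENNReal.ofReal_mul (by positivity), ← ENNReal.ofReal_mul (by positivity)]
    refine ENNReal.ofReal_le_ofReal ?_
    rw [abs_mul, ← mul_assoc]
    by_cases hy : y ∈ ball x r
    · rw [hz y hy]; simp; positivity
    · rw [mem_ball, dist_eq_norm, norm_sub_rev, not_lt] at hy
      refine mul_le_mul ?_ (hle y) (abs_nonneg _) (by positivity)
      refine (hdec (2 * t) (by positivity) _ i j).trans ?_
      rw [mul_assoc]
      refine mul_le_mul_of_nonneg_left ?_ hC0.le
      have h1 : (a ^ 2 + ‖x - y‖ ^ 2) / 2 ≤ 2 * t + ‖x - y‖ ^ 2 := by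
        rw [ha2]; nlinarith
      have hdd : (0:ℝ) ≤ d := by positivity
      refine (Real.rpow_le_rpow_of_nonpos (by positivity) h1 (by linarith)).trans_eq ?_
      rw [div_eq_mul_inv, Real.mul_rpow (by positivity) (by norm_num), mul_comm, Real.inv_rpow (by norm_num),
        ← Real.rpow_neg (by norm_num), neg_neg]
  have fin : ENNReal.ofReal |conv (K2 i j (2 * t)) f2 x| ≤ ENNReal.ofReal
      (C0 * 2 ^ ((d:ℝ) / 2 + 1) * (vb d ^ (1 / q) * 2 ^ (d - μ + 1)) * M * (t + r ^ 2) ^ (-(μ / 2) - 1)) := by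
    rw [← Real.enorm_eq_ofReal_abs]
    unfold conv
    refine (enorm_integral_le_lintegral_enorm _).trans ((lintegral_mono pt).trans ?_)
    rw [lintegral_const_mul _ (by fun_prop)]
    refine (mul_le_mul_right fk _).trans_eq ?_
    rw [← ENNReal.ofReal_mul hM, ← ENNReal.ofReal_mul (by positivity), ← ENNReal.ofReal_mul (by positivity)]
    congr 1
    have : a ^ (-2 - μ) = (t + r ^ 2) ^ (-(μ / 2) - 1) := by
      rw [← ha2, ← Real.rpow_natCast a 2, ← Real.rpow_mul ha.le]
      congr 1; push_cast; ring
    rw [this]; ring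
  exact (ENNReal.ofReal_le_ofReal_iff (by positivity)).1 fin

lemma BC.indicator {f : E d → ℝ} (hf : BC f) {S : Set (E d)} (hS : MeasurableSet S) : BC (S.indicator f) := by
  obtain ⟨M, hM⟩ := hf.bdd
  obtain ⟨L, hL, hs⟩ := hf.supp
  refine ⟨hf.meas.indicator hS, ⟨M, fun x => ?_⟩, ⟨L, hL, fun x hx => ?_⟩⟩
  · by_cases h : x ∈ S
    · rw [indicator_of_mem h]; exact hM x
    · rw [indicator_of_notMem h, abs_zero]; exact (abs_nonneg _).trans (hM x)
  · by_cases h : x ∈ S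
    · rw [indicator_of_mem h]; exact hs x hx
    · rw [indicator_of_notMem h]

/-- Laplacian -/
def Lap (v : E d → ℝ) (x : E d) : ℝ := ∑ l, D l (D l v) x

lemma Lap_cont {v : E d → ℝ} (hv : ContDiff ℝ 2 v) : Continuous (Lap v) :=
  continuous_finsetSum _ fun l _ => D_cont (D_C1 hv l) l

lemma Lap_BC {v : E d → ℝ} (hv : ContDiff ℝ 2 v) (hs : HasCompactSupport v) : BC (Lap v) := by
  refine BC.of_cont (Lap_cont hv) ?_
  refine HasCompactSupport.intro (K := ⋃ l, tsupport (D l (D l v)))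
    (isCompact_iUnion fun l => D_supp (D_supp hs l) l) fun x hx => ?_
  refine Finset.sum_eq_zero fun l _ => ?_
  by_contra h
  exact hx (mem_iUnion.2 ⟨l, subset_tsupport _ h⟩)

lemma cz_pre {p q μ : ℝ} (hd : 0 < d) (hpq : p.HolderConjugate q) (hp2 : p ≠ 2) (hμ : 0 < μ) : ∃ C : ℝ, 0 ≤ C ∧
    ∀ v : E d → ℝ, ContDiff ℝ 2 v → HasCompactSupport v → ∀ M : ℝ, 0 ≤ M →
    MB p (d - p * μ) (fun x => ENNReal.ofReal |Lap v x|) (ENNReal.ofReal M) →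
    ∀ (i j : Fin d) (x0 : E d) (r : ℝ), 0 < r → ∀ g : E d → ℝ, BC g → (∀ x, x ∉ ball x0 r → g x = 0) →
    |∫ x, D i (D j v) x * g x| ≤ C * ((∫ x, |(ball x0 (2 * r)).indicator (Lap v) x| ^ p) + ∫ x, |g x| ^ q)
      + C * M * (r ^ (-μ) * ∫ x, |g x|) := by
  obtain ⟨C1, hC1, hnear⟩ := near (d := d) hp2 hpq
  obtain ⟨C2, hC2, hfar⟩ := far_pt (d := d) hpq hμ
  refine ⟨C1 + 4 * C2 / μ, by positivity, ?_⟩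
  intro v hv hs M hM hMB i j x0 r hr g hg hgs
  set f := Lap v with hf
  have hfB : BC f := Lap_BC hv hs
  set f1 := (ball x0 (2 * r)).indicator f with hf1
  set f2 := (ball x0 (2 * r))ᶜ.indicator f with hf2
  have hf1B : BC f1 := hfB.indicator measurableSet_ball
  have hf2B : BC f2 := hfB.indicator measurableSet_ball.compl
  have hf12 : ∀ y, f y = f1 y + f2 y := fun y => by
    have := congrFun (indicator_self_add_compl (ball x0 (2 * r)) f) y
    exact this.symm
  set w := D i (D j v) with hw
  have hwc : Continuous w := D_cont (D_C1 hv j) i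
  have hws : HasCompactSupport w := D_supp (D_supp hs j) i
  have hwB := BC.of_cont hwc hws
  set G := ∫ x, |g x| with hG
  have hG0 : 0 ≤ G := integral_nonneg fun x => abs_nonneg _
  set θ : ℝ → ℝ := fun t => ∫ x, conv (K t) w x * g x with hθ
  have hbd : ∀ (h : E d → ℝ), BC h → ∀ t, 0 < t → Integrable (fun x => conv (K2 i j t) h x * g x) := by
    intro h hh t ht
    obtain ⟨C, hC, hb⟩ := conv_K_bounds hh (a := t) (b := t) ht
    exact hg.integrable.bdd_mul (c := C) (conv_K2_cont hh.integrable ht i j).aestronglyMeasurable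
      (Eventually.of_forall fun x => bdd_of_om hC (fun x => (hb t ⟨le_rfl, le_rfl⟩ x).2.2 i j) x)
  have hderiv : ∀ t, 0 < t → HasDerivAt (fun t => θ (2 * t)) (2 * ∫ x, conv (K2 i j (2 * t)) f x * g x) t := by
    intro t ht
    have h1 := theta_deriv hwB hg (t := 2 * t) (by positivity)
    have h2 := h1.scomp t ((hasDerivAt_id t).const_mul 2)
    refine h2.congr_deriv ?_
    simp only [mul_one, smul_eq_mul]
    congr 2; ext x
    rw [conv_lap (by positivity) i j hv hs]
    rfl
  set A := 2 * C2 * M * G with hA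
  have hA0 : 0 ≤ A := by positivity
  set ψ : ℝ → ℝ := fun t => A * (2 / μ) * (t + r ^ 2) ^ (-(μ / 2)) with hψ
  have hψd : ∀ t, 0 < t → HasDerivAt ψ (-(A * (t + r ^ 2) ^ (-(μ / 2) - 1))) t := by
    intro t ht
    have h1 := (((hasDerivAt_id t).add_const (r ^ 2)).rpow_const (p := -(μ / 2)) (Or.inl (by simp; positivity))).const_mul
      (A * (2 / μ))
    refine h1.congr_deriv ?_
    simp only [id]
    field_simp
  have hmain := hnear f1 g hf1B hg i j (fun t => θ (2 * t)) _ ψ _ hderiv hψd (by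
    intro t ht
    have e1 : ∫ x, conv (K2 i j (2 * t)) f x * g x =
        (∫ x, conv (K2 i j (2 * t)) f1 x * g x) + ∫ x, conv (K2 i j (2 * t)) f2 x * g x := by
      rw [← integral_add (hbd f1 hf1B _ (by positivity)) (hbd f2 hf2B _ (by positivity))]
      congr 1; ext x
      rw [← add_mul]; congr 1
      unfold conv
      obtain ⟨C, hC, hb⟩ := K_bounds1 (d := d) (t := 2 * t) (by positivity)
      have hb2 := bdd_of_om hC fun z => (hb z).2.2 i j
      rw [← integral_add (conv_integrable hf1B.integrable (cont_K2 i j) hb2 x)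
        (conv_integrable hf2B.integrable (cont_K2 i j) hb2 x)]
      congr 1; ext y; rw [hf12]; ring
    have e2 : |∫ x, conv (K2 i j (2 * t)) f1 x * g x| ≤ ∫ x, |conv (K1 i t) f1 x| * |conv (K1 j t) g x| := by
      have := near_id hg.integrable hf1B.integrable ht j i
      rw [K2_comm j i] at this
      have e : ∫ x, conv (K2 i j (2 * t)) f1 x * g x = - ∫ z, conv (K1 j t) g z * conv (K1 i t) f1 z := by
        rw [this, neg_neg]; congr 1; ext x; ring
      rw [e, abs_neg]
      refine abs_integral_le_integral_abs.trans_eq ?_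
      congr 1; ext x; rw [abs_mul, mul_comm]
    have e3 : |∫ x, conv (K2 i j (2 * t)) f2 x * g x| ≤ C2 * M * (t + r ^ 2) ^ (-(μ / 2) - 1) * G := by
      rw [hG, ← integral_const_mul]
      show ‖∫ x, conv (K2 i j (2 * t)) f2 x * g x‖ ≤ _
      refine norm_integral_le_of_norm_le (hg.integrable.abs.const_mul _) (Eventually.of_forall fun x => ?_)
      by_cases hx : x ∈ ball x0 r
      · rw [norm_mul]
        refine mul_le_mul_of_nonneg_right ?_ (abs_nonneg _)
        refine hfar f hfB.meas M hM hMB f2 x r t hr ht (fun y => ?_) (fun y hy => ?_) i j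
        · rw [hf2]; exact norm_indicator_le_norm_self f y
        · rw [hf2, indicator_of_notMem]
          rw [mem_compl_iff, not_not, mem_ball]
          have h1 := dist_triangle y x x0
          rw [mem_ball] at hx hy
          linarith
      · rw [hgs x hx]; simp
    rw [abs_mul, abs_two, e1, sub_neg_eq_add]
    have := abs_add_le (∫ x, conv (K2 i j (2 * t)) f1 x * g x) (∫ x, conv (K2 i j (2 * t)) f2 x * g x)
    have e4 : A * (t + r ^ 2) ^ (-(μ / 2) - 1) = 2 * (C2 * M * (t + r ^ 2) ^ (-(μ / 2) - 1) * G) := by rw [hA]; ring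
    rw [e4]
    linarith) (by intro t ht; positivity)
  set R := C1 * ((∫ x, |f1 x| ^ p) + ∫ x, |g x| ^ q) + A * (2 / μ) * r ^ (-μ) with hR
  have hψle : ∀ ε, 0 < ε → ψ ε ≤ A * (2 / μ) * r ^ (-μ) := by
    intro ε hε
    refine mul_le_mul_of_nonneg_left ?_ (by positivity)
    have : r ^ (-μ) = (r ^ 2) ^ (-(μ / 2)) := by
      rw [← Real.rpow_natCast r 2, ← Real.rpow_mul hr.le]; congr 1; push_cast; ring
    rw [this]
    exact Real.rpow_le_rpow_of_nonpos (by positivity) (by linarith) (by linarith)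
  have h1 : ∀ ε, 0 < ε → |θ (2 * ε)| ≤ R := by
    intro ε hε
    have lim : Tendsto (fun T => |θ (2 * T) - θ (2 * ε)|) atTop (nhds |0 - θ (2 * ε)|) :=
      (((theta_T hd hwB hg).comp (tendsto_id.const_mul_atTop two_pos)).sub_const _).abs
    rw [zero_sub, abs_neg] at lim
    refine le_of_tendsto lim ?_
    filter_upwards [eventually_ge_atTop ε] with T hT
    have := hmain ε T hε hT
    have := hψle ε hε
    linarith
  have h2 : |∫ x, w x * g x| ≤ R := by
    refine le_of_tendsto (theta_0 hwc hws hg).abs ?_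
    filter_upwards [eventually_gt_atTop 0] with c hc
    have := h1 ((c ^ 2)⁻¹ / 2) (by positivity)
    rwa [mul_div_cancel₀ _ two_ne_zero] at this
  refine h2.trans ?_
  rw [hR, hA]
  have i1 : 0 ≤ (∫ x, |f1 x| ^ p) + ∫ x, |g x| ^ q :=
    add_nonneg (integral_nonneg fun x => by positivity) (integral_nonneg fun x => by positivity)
  have i2 : 0 ≤ M * (r ^ (-μ) * G) := by positivity
  have e : 2 * C2 * M * G * (2 / μ) * r ^ (-μ) = 4 * C2 / μ * M * (r ^ (-μ) * G) := by ring
  rw [e]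
  have : 0 ≤ 4 * C2 / μ := by positivity
  nlinarith [mul_nonneg this i1, mul_nonneg hC1 i2]

end HK

namespace HK
variable {d : ℕ}

lemma lint_pow {w : E d → ℝ} (hw : BC w) {p : ℝ} (hp : 0 < p) {S : Set (E d)} (hS : MeasurableSet S) :
    ∫⁻ y in S, ENNReal.ofReal |w y| ^ p = ENNReal.ofReal (∫ y, |S.indicator w y| ^ p) := by
  have e : ∀ y, |S.indicator w y| ^ p = S.indicator (fun y => |w y| ^ p) y := by
    intro y
    by_cases hy : y ∈ S
    · rw [indicator_of_mem hy, indicator_of_mem hy]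
    · rw [indicator_of_notMem hy, indicator_of_notMem hy, abs_zero, Real.zero_rpow hp.ne']
  simp_rw [e]
  rw [integral_indicator hS, ofReal_integral_eq_lintegral_ofReal]
  · refine lintegral_congr fun y => ?_
    rw [ENNReal.ofReal_rpow_of_nonneg (abs_nonneg _) hp.le]
  · exact (hw.rpow hp).integrable.integrableOn
  · exact Eventually.of_forall fun y => by positivity

theorem CZ {p q μ : ℝ} (hd : 0 < d) (hpq : p.HolderConjugate q) (hp2 : p ≠ 2) (hμ : 0 < μ) : ∃ C : ℝ, 0 ≤ C ∧
    ∀ v : E d → ℝ, ContDiff ℝ 2 v → HasCompactSupport v → ∀ M : ℝ, 0 ≤ M →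
    MB p (d - p * μ) (fun x => ENNReal.ofReal |Lap v x|) (ENNReal.ofReal M) →
    ∀ (i j : Fin d), MB p (d - p * μ) (fun x => ENNReal.ofReal |D i (D j v) x|) (ENNReal.ofReal (C * M)) := by
  obtain ⟨C0, hC0, hpre⟩ := cz_pre hd hpq hp2 hμ
  have hp0 := hpq.pos
  have hq0 := hpq.symm.pos
  have hp1 := hpq.lt
  have hq1 := hpq.symm.lt
  have hvb := vb_pos (d := d)
  set C := C0 + 1 with hC
  have hCpos : 0 < C := by positivity
  set l := (d:ℝ) - p * μ with hl
  set τ := (1 / (4 * C)) ^ (1 / (q - 1)) with hτ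
  have hτ0 : 0 < τ := by positivity
  have hτq : 2 * C * τ ^ q = τ / 2 := by
    have : τ ^ (q - 1) = 1 / (4 * C) := by
      rw [hτ, ← Real.rpow_mul (by positivity), one_div_mul_cancel (by linarith), Real.rpow_one]
    have e : τ ^ q = τ ^ (q - 1) * τ := by
      rw [← Real.rpow_add_one hτ0.ne']; congr 1; ring
    rw [e, this]; field_simp; norm_num
  set Q := 2 / τ * (C * (2 ^ l + vb d)) with hQ
  have hQ0 : 0 ≤ Q := by positivity
  refine ⟨Q ^ (1 / p), by positivity, ?_⟩
  intro v hv hs M hM hMB i j x0 r hr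
  set w := D i (D j v) with hw
  have hwc : Continuous w := D_cont (D_C1 hv j) i
  have hws : HasCompactSupport w := D_supp (D_supp hs j) i
  have hwB := BC.of_cont hwc hws
  set B := ball x0 r with hB
  set g : E d → ℝ := B.indicator (fun x => τ * (|w x| ^ (p - 2) * w x)) with hg
  have habs : ∀ x, |τ * (|w x| ^ (p - 2) * w x)| = τ * |w x| ^ (p - 1) := by
    intro x
    rw [abs_mul, abs_of_pos hτ0, abs_mul, abs_of_nonneg (by positivity : 0 ≤ |w x| ^ (p - 2))]
    congr 1
    rcases eq_or_ne (w x) 0 with h | h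
    · rw [h, abs_zero, mul_zero, Real.zero_rpow (by linarith)]
    · rw [← Real.rpow_add_one (abs_pos.2 h).ne']; congr 1; ring
  have hgB0 : BC (fun x => τ * (|w x| ^ (p - 2) * w x)) := by
    obtain ⟨W, hW⟩ := hwB.bdd
    obtain ⟨L, hL, hLs⟩ := hwB.supp
    refine ⟨by have := hwB.meas; fun_prop, ⟨τ * W ^ (p - 1), fun x => ?_⟩, L, hL, fun x hx => by rw [hLs x hx]; simp⟩
    rw [habs]
    exact mul_le_mul_of_nonneg_left (Real.rpow_le_rpow (abs_nonneg _) (hW x) (by linarith)) hτ0.le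
  have hgB : BC g := hgB0.indicator measurableSet_ball
  set X := ∫ x, |B.indicator w x| ^ p with hX
  have hX0 : 0 ≤ X := integral_nonneg fun x => by positivity
  have e1 : ∫ x, w x * g x = τ * X := by
    rw [hX, ← integral_const_mul]
    congr 1; ext x
    by_cases hx : x ∈ B
    · rw [hg, indicator_of_mem hx, indicator_of_mem hx]
      rcases eq_or_ne (w x) 0 with h | h
      · rw [h, abs_zero, Real.zero_rpow hp0.ne']; simp
      · have : |w x| ^ p = |w x| ^ (p - 2) * |w x| ^ (2:ℝ) := by
          rw [← Real.rpow_add (abs_pos.2 h)]; congr 1; ring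
        rw [this, Real.rpow_two, sq_abs]; ring
    · rw [hg, indicator_of_notMem hx, indicator_of_notMem hx, abs_zero, Real.zero_rpow hp0.ne']; simp
  have e2 : ∫ x, |g x| ^ q = τ ^ q * X := by
    rw [hX, ← integral_const_mul]
    congr 1; ext x
    by_cases hx : x ∈ B
    · rw [hg, indicator_of_mem hx, indicator_of_mem hx, habs, Real.mul_rpow hτ0.le (by positivity),
        ← Real.rpow_mul (abs_nonneg _)]
      congr 2
      have := hpq.mul_eq_add
      linarith
    · rw [hg, indicator_of_notMem hx, indicator_of_notMem hx, abs_zero, Real.zero_rpow hp0.ne', Real.zero_rpow hq0.ne']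
      simp
  have hind : Integrable (B.indicator fun _ : E d => (M * r ^ (-μ)) ^ p) :=
    (integrable_indicator_iff measurableSet_ball).2 (integrableOn_const measure_ball_lt_top.ne)
  have e3 : M * (r ^ (-μ) * ∫ x, |g x|) ≤ τ ^ q * X + vb d * M ^ p * r ^ l := by
    have h1 : M * (r ^ (-μ) * ∫ x, |g x|) = ∫ x, M * r ^ (-μ) * |g x| := by
      rw [integral_const_mul]; ring
    have h2 : ∫ x, B.indicator (fun _ : E d => (M * r ^ (-μ)) ^ p) x = vb d * M ^ p * r ^ l := by
      rw [integral_indicator measurableSet_ball, setIntegral_const, smul_eq_mul, measureReal_def, vol_ball x0 hr,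
        ENNReal.toReal_ofReal (by positivity), Real.mul_rpow hM (by positivity), ← Real.rpow_mul hr.le, hl]
      rw [show (d:ℝ) - p * μ = d + (-μ * p) by ring, Real.rpow_add hr]; ring
    rw [h1, ← h2, ← e2, ← integral_add (hgB.rpow hq0).integrable hind]
    refine integral_mono_of_nonneg (Eventually.of_forall fun x => by positivity) ((hgB.rpow hq0).integrable.add hind)
      (Eventually.of_forall fun x => ?_)
    show M * r ^ (-μ) * |g x| ≤ |g x| ^ q + B.indicator (fun _ : E d => (M * r ^ (-μ)) ^ p) x
    by_cases hx : x ∈ B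
    · rw [indicator_of_mem hx]
      have y := Real.young_inequality_of_nonneg (a := M * r ^ (-μ)) (b := |g x|) (by positivity) (abs_nonneg _) hpq
      have y1 : (M * r ^ (-μ)) ^ p / p ≤ (M * r ^ (-μ)) ^ p := div_le_self (by positivity) hp1.le
      have y2 : |g x| ^ q / q ≤ |g x| ^ q := div_le_self (by positivity) hq1.le
      linarith
    · rw [indicator_of_notMem hx, hg, indicator_of_notMem hx, abs_zero, Real.zero_rpow hq0.ne']; simp
  have e4 : ∫ x, |(ball x0 (2 * r)).indicator (Lap v) x| ^ p ≤ M ^ p * (2 ^ l * r ^ l) := by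
    have h1 := hMB x0 (2 * r) (by positivity)
    rw [lint_pow (Lap_BC hv hs) hp0 measurableSet_ball, ENNReal.ofReal_rpow_of_nonneg hM hp0.le,
      ← ENNReal.ofReal_mul (by positivity), ENNReal.ofReal_le_ofReal_iff (by positivity),
      Real.mul_rpow two_pos.le hr.le] at h1
    exact h1
  have main := hpre v hv hs M hM hMB i j x0 r hr g hgB (fun x hx => by rw [hg, indicator_of_notMem hx])
  rw [← hw, e1, e2, abs_of_nonneg (by positivity), mul_assoc] at main
  have hXle : X ≤ Q * M ^ p * r ^ l := by
    have h1 : τ * X ≤ C * (M ^ p * (2 ^ l * r ^ l) + τ ^ q * X) + C * (τ ^ q * X + vb d * M ^ p * r ^ l) := by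
      refine main.trans (add_le_add ?_ ?_)
      · exact mul_le_mul (by linarith) (by linarith) (add_nonneg (integral_nonneg fun x => by positivity) (by positivity))
          hCpos.le
      · refine mul_le_mul (by linarith) e3 ?_ hCpos.le
        have : 0 ≤ ∫ x, |g x| := integral_nonneg fun x => abs_nonneg _
        positivity
    have h2 : τ * X ≤ C * (2 ^ l + vb d) * (M ^ p * r ^ l) + (2 * C * τ ^ q) * X := by linarith
    rw [hτq] at h2
    have h3 : τ / 2 * X ≤ C * (2 ^ l + vb d) * (M ^ p * r ^ l) := by linarith
    rw [hQ]
    have h4 : X = 2 / τ * (τ / 2 * X) := by field_simp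
    rw [h4]
    calc 2 / τ * (τ / 2 * X) ≤ 2 / τ * (C * (2 ^ l + vb d) * (M ^ p * r ^ l)) :=
          mul_le_mul_of_nonneg_left h3 (by positivity)
      _ = _ := by ring
  rw [lint_pow hwB hp0 measurableSet_ball, ENNReal.ofReal_rpow_of_nonneg (by positivity) hp0.le,
      ← ENNReal.ofReal_mul (by positivity)]
  refine ENNReal.ofReal_le_ofReal (hXle.trans_eq ?_)
  rw [Real.mul_rpow (by positivity) hM, ← Real.rpow_mul hQ0, one_div_mul_cancel hp0.ne', Real.rpow_one]

end HK

namespace HK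
variable {d : ℕ}

/-- (unnormalized) average of `G` over the ball of radius `s` around `x` -/
def av (s : ℝ) (G : E d → ℝ≥0∞) (x : E d) : ℝ≥0∞ := ∫⁻ ζ in ball (0 : E d) 1, G (x + s • ζ)

lemma av_eq {s : ℝ} (hs : 0 < s) {G : E d → ℝ≥0∞} (hG : Measurable G) (x : E d) :
    ENNReal.ofReal (s ^ (d : ℝ)) * av s G x = ∫⁻ y in ball x s, G y := by
  have e1 : ∫⁻ y in ball x s, G y = ∫⁻ y, (ball x s).indicator G (x + y) := by
    rw [lintegral_add_left_eq_self (fun y => (ball x s).indicator G y) x, lintegral_indicator measurableSet_ball]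
  have hm : Measurable (fun y => (ball x s).indicator G (x + y)) :=
    (hG.indicator measurableSet_ball).comp (measurable_const_add x)
  have e2 : av s G x = ∫⁻ ζ, (fun y => (ball x s).indicator G (x + y)) (s • ζ) := by
    unfold av
    rw [← lintegral_indicator measurableSet_ball]
    refine lintegral_congr fun ζ => ?_
    by_cases h : ζ ∈ ball (0 : E d) 1
    · have h' : x + s • ζ ∈ ball x s := by
        rw [mem_ball_zero_iff] at h
        rw [mem_ball, dist_eq_norm, add_sub_cancel_left, norm_smul, Real.norm_of_nonneg hs.le]
        nlinarith
      simp only [indicator_of_mem h, indicator_of_mem h']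
    · have h' : x + s • ζ ∉ ball x s := by
        rw [mem_ball_zero_iff] at h
        rw [mem_ball, dist_eq_norm, add_sub_cancel_left, norm_smul, Real.norm_of_nonneg hs.le]
        nlinarith
      simp only [indicator_of_notMem h, indicator_of_notMem h']
  have e3 := lintegral_map (μ := (volume : Measure (E d))) hm (measurable_const_smul s)
  rw [Measure.map_addHaar_smul volume hs.ne', lintegral_smul_measure] at e3
  rw [e2, ← e3, e1, smul_eq_mul, ← mul_assoc, ← ENNReal.ofReal_mul (by positivity), finrank_euclideanSpace_fin,
    abs_of_pos (by positivity), Real.rpow_natCast, mul_inv_cancel₀ (by positivity)]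
  simp

lemma av_mono {s : ℝ} {G G' : E d → ℝ≥0∞} (h : ∀ x, G x ≤ G' x) (x : E d) : av s G x ≤ av s G' x :=
  lintegral_mono fun _ => h _

lemma av_add {s : ℝ} {G G' : E d → ℝ≥0∞} (hG : Measurable G) (x : E d) :
    av s (fun x => G x + G' x) x = av s G x + av s G' x := by
  unfold av
  exact lintegral_add_left (by fun_prop) _

lemma av_const {s : ℝ} (c : ℝ≥0∞) (x : E d) : av s (fun _ => c) x = c * ENNReal.ofReal (vb d) := by
  unfold av
  rw [lintegral_const, vb, ENNReal.ofReal_toReal measure_ball_lt_top.ne]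
  simp

/-- restricted maximal function -/
def Mx (h : ℝ) (G : E d → ℝ≥0∞) (x : E d) : ℝ≥0∞ := ⨆ (s : ℝ) (_ : s ∈ Ioc 0 h), av s G x

lemma av_le_Mx {h s : ℝ} (hs : s ∈ Ioc 0 h) (G : E d → ℝ≥0∞) (x : E d) : av s G x ≤ Mx h G x :=
  le_iSup₂_of_le s hs le_rfl

lemma Mx_le {h : ℝ} {G : E d → ℝ≥0∞} {x : E d} {c : ℝ≥0∞} (H : ∀ s ∈ Ioc 0 h, av s G x ≤ c) : Mx h G x ≤ c :=
  iSup₂_le H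

lemma Mx_open (h : ℝ) {G : E d → ℝ≥0∞} (hG : Measurable G) (τ : ℝ≥0∞) : IsOpen {x | τ < Mx h G x} := by
  rw [Metric.isOpen_iff]
  intro x hx
  simp only [mem_setOf_eq, Mx, lt_iSup_iff] at hx
  obtain ⟨s, hs, hx⟩ := hx
  have hs0 := hs.1
  have e := av_eq hs0 hG x
  have hsp : ENNReal.ofReal (s ^ (d:ℝ)) ≠ 0 := by simp; positivity
  have h1 : ENNReal.ofReal (s ^ (d:ℝ)) * τ < ∫⁻ y in ball x s, G y := by
    rw [← e]; exact (ENNReal.mul_lt_mul_iff_right hsp ENNReal.ofReal_ne_top).2 hx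
  -- smaller radius
  have h2 : ∃ n : ℕ, ENNReal.ofReal (s ^ (d:ℝ)) * τ < ∫⁻ y in ball x (s - s / (n + 2)), G y := by
    have hun : ⋃ n : ℕ, ball x (s - s / (n + 2)) = ball x s := by
      ext y
      simp only [mem_iUnion, mem_ball]
      constructor
      · rintro ⟨n, hn⟩
        have : 0 < s / ((n:ℝ) + 2) := by positivity
        linarith
      · intro hy
        obtain ⟨n, hn⟩ := exists_nat_gt (s / (s - dist y x))
        refine ⟨n, ?_⟩
        have hpos : 0 < s - dist y x := by linarith
        rw [div_lt_iff₀ hpos] at hn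
        have : s / ((n:ℝ) + 2) < s - dist y x := by
          rw [div_lt_iff₀ (by positivity)]; nlinarith
        linarith
    have hmono : Monotone (fun n : ℕ => ball x (s - s / ((n:ℝ) + 2))) := by
      intro m n hmn
      apply ball_subset_ball
      have : s / ((n:ℝ) + 2) ≤ s / ((m:ℝ) + 2) := by gcongr
      linarith
    have hl := setLIntegral_iUnion_of_directed (μ := (volume : Measure (E d))) G hmono.directed_le
    rw [hun] at hl
    rw [hl, lt_iSup_iff] at h1
    exact h1
  obtain ⟨n, hn⟩ := h2
  refine ⟨s / (n + 2), by positivity, fun y hy => ?_⟩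
  simp only [mem_setOf_eq]
  refine lt_of_lt_of_le ?_ (av_le_Mx hs G y)
  have h3 : ∫⁻ z in ball x (s - s / (n + 2)), G z ≤ ∫⁻ z in ball y s, G z := by
    refine lintegral_mono_set (ball_subset_ball' ?_)
    rw [mem_ball, dist_comm] at hy
    linarith
  rw [← av_eq hs0 hG y] at h3
  exact (ENNReal.mul_lt_mul_iff_right hsp ENNReal.ofReal_ne_top).1 (lt_of_lt_of_le hn h3)

lemma Mx_meas (h : ℝ) {G : E d → ℝ≥0∞} (hG : Measurable G) : Measurable (Mx h G) :=
  measurable_of_Ioi fun τ => (Mx_open h hG τ).measurableSet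

lemma Mx_weak (h : ℝ) {G : E d → ℝ≥0∞} (hG : Measurable G) (τ : ℝ≥0∞) :
    τ * volume {x | τ < Mx h G x} ≤ ENNReal.ofReal (vb d * 5 ^ (d:ℝ)) * ∫⁻ y, G y := by
  have hch : ∀ x : E d, ∃ s : ℝ, x ∈ {x | τ < Mx h G x} → s ∈ Ioc 0 h ∧ τ < av s G x := by
    intro x
    by_cases hx : x ∈ {x | τ < Mx h G x}
    · have hx' := hx
      simp only [mem_setOf_eq, Mx, lt_iSup_iff] at hx'
      obtain ⟨s, hs, hx'⟩ := hx'
      exact ⟨s, fun _ => ⟨hs, hx'⟩⟩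
    · exact ⟨0, fun h => absurd h hx⟩
  choose s hs using hch
  set U := {x | τ < Mx h G x} with hU
  obtain ⟨u, huU, hdis, hcov⟩ := Vitali.exists_disjoint_subfamily_covering_enlargement_ball U (fun x : E d => x) s h
    (fun a ha => (hs a ha).1.2) 5 (by norm_num)
  have hcnt : u.Countable := by
    refine hdis.countable_of_isOpen (fun a _ => isOpen_ball) (fun a ha => ?_)
    exact ⟨a, mem_ball_self (hs a (huU ha)).1.1⟩
  have hsub : U ⊆ ⋃ b ∈ u, ball b (5 * s b) := by
    intro a ha
    obtain ⟨b, hb, hab⟩ := hcov a ha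
    exact mem_iUnion₂.2 ⟨b, hb, hab (mem_ball_self (hs a ha).1.1)⟩
  have hvb := vb_pos (d := d)
  haveI := hcnt.to_subtype
  calc τ * volume U ≤ τ * ∑' b : u, volume (ball (b : E d) (5 * s b)) :=
        mul_le_mul_right ((measure_mono hsub).trans (measure_biUnion_le _ hcnt _)) _
    _ = ∑' b : u, τ * volume (ball (b : E d) (5 * s b)) := by rw [ENNReal.tsum_mul_left]
    _ ≤ ∑' b : u, ENNReal.ofReal (vb d * 5 ^ (d:ℝ)) * ∫⁻ y in ball (b : E d) (s b), G y := by
        refine ENNReal.tsum_le_tsum fun b => ?_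
        have hb := hs b (huU b.2)
        have hb0 := hb.1.1
        rw [vol_ball _ (by positivity), Real.mul_rpow (by norm_num) hb0.le, ← mul_assoc, ENNReal.ofReal_mul (by positivity),
          mul_left_comm, ← av_eq hb0 hG, mul_comm τ]
        exact mul_le_mul_right (mul_le_mul_right hb.2.le _) _
    _ = ENNReal.ofReal (vb d * 5 ^ (d:ℝ)) * ∫⁻ y in ⋃ b ∈ u, ball b (s b), G y := by
        rw [ENNReal.tsum_mul_left, lintegral_biUnion hcnt (fun b _ => measurableSet_ball) hdis]
    _ ≤ _ := mul_le_mul_right (setLIntegral_le_lintegral _ _) _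

lemma Mx_strong {p : ℝ} (hp : 1 < p) : ∃ C : ℝ, 0 ≤ C ∧ ∀ (h : ℝ) (g : E d → ℝ), Measurable g →
    (∀ x, 0 ≤ g x) → (∃ N : ℝ, ∀ x, g x ≤ N) →
    ∫⁻ x, Mx h (fun x => ENNReal.ofReal (g x)) x ^ p ≤ ENNReal.ofReal C * ∫⁻ x, ENNReal.ofReal (g x) ^ p := by
  have hvb := vb_pos (d := d)
  set A := vb d * 5 ^ (d:ℝ) with hA
  set c := 2 * vb d with hc
  have hc0 : 0 < c := by positivity
  refine ⟨p * (2 * A) / (p - 1) * c ^ (p - 1), by have : 0 < p - 1 := by linarith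
                                                  positivity, ?_⟩
  intro h g hg hg0 ⟨N, hN⟩
  set G : E d → ℝ≥0∞ := fun x => ENNReal.ofReal (g x) with hG
  have hGm : Measurable G := by fun_prop
  have hp1 : 0 < p - 1 := by linarith
  have hfin : ∀ x, Mx h G x ≠ ⊤ := by
    intro x
    refine ne_top_of_le_ne_top (b := ENNReal.ofReal N * ENNReal.ofReal (vb d)) (by finiteness) (Mx_le fun s hs => ?_)
    rw [← av_const (s := s) _ x]
    exact av_mono (fun x => ENNReal.ofReal_le_ofReal (hN x)) x
  set f : E d → ℝ := fun x => (Mx h G x).toReal with hf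
  have hfm : Measurable f := (Mx_meas h hGm).ennreal_toReal
  have e1 : ∫⁻ x, Mx h G x ^ p = ∫⁻ x, ENNReal.ofReal (f x ^ p) := by
    refine lintegral_congr fun x => ?_
    rw [← ENNReal.ofReal_rpow_of_nonneg ENNReal.toReal_nonneg (by linarith), ENNReal.ofReal_toReal (hfin x)]
  set ν := (volume : Measure (E d)).withDensity G with hν
  have weak : ∀ t : ℝ, 0 < t → volume {x | t < f x} * ENNReal.ofReal (t ^ (p - 1)) ≤
      ENNReal.ofReal (2 * A) * (ν {x | t < c * g x} * ENNReal.ofReal (t ^ (p - 1 - 1))) := by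
    intro t ht
    set S := {x | t < c * g x} with hS
    have hSm : MeasurableSet S := measurableSet_lt measurable_const (by fun_prop)
    have hw := Mx_weak h (hGm.indicator hSm) (ENNReal.ofReal (t / 2))
    rw [lintegral_indicator hSm, ← withDensity_apply _ hSm] at hw
    have hsub : {x | t < f x} ⊆ {x | ENNReal.ofReal (t / 2) < Mx h (S.indicator G) x} := by
      intro x hx
      simp only [mem_setOf_eq] at hx ⊢
      by_contra hcon
      rw [not_lt] at hcon
      have : Mx h G x ≤ ENNReal.ofReal t := by
        refine Mx_le fun s hs => ?_
        calc av s G x ≤ av s (fun x => S.indicator G x + ENNReal.ofReal (t / c)) x := by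
              refine av_mono (fun y => ?_) x
              by_cases hy : y ∈ S
              · rw [indicator_of_mem hy]; exact le_self_add
              · rw [indicator_of_notMem hy, zero_add]
                refine ENNReal.ofReal_le_ofReal ?_
                rw [hS, mem_setOf_eq, not_lt] at hy
                rw [le_div_iff₀ hc0]; linarith
          _ = av s (S.indicator G) x + ENNReal.ofReal (t / c) * ENNReal.ofReal (vb d) := by
              rw [av_add (hGm.indicator hSm), av_const]
          _ ≤ ENNReal.ofReal (t / 2) + ENNReal.ofReal (t / 2) := by
              refine add_le_add ((av_le_Mx hs _ x).trans hcon) (le_of_eq ?_)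
              rw [← ENNReal.ofReal_mul (by positivity), hc]; congr 1; field_simp
          _ = ENNReal.ofReal t := by rw [← ENNReal.ofReal_add (by positivity) (by positivity), add_halves]
      have h2 := ENNReal.toReal_mono ENNReal.ofReal_ne_top this
      rw [ENNReal.toReal_ofReal ht.le] at h2
      exact absurd hx (not_lt.2 h2)
    have e : ENNReal.ofReal (t ^ (p - 1)) = ENNReal.ofReal 2 * (ENNReal.ofReal (t / 2) * ENNReal.ofReal (t ^ (p - 1 - 1))) := by
      rw [← ENNReal.ofReal_mul (by positivity), ← ENNReal.ofReal_mul (by positivity)]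
      congr 1
      have : t ^ (p - 1) = t ^ (p - 1 - 1) * t := by
        rw [← Real.rpow_add_one ht.ne']; congr 1; ring
      rw [this]; ring
    rw [e]
    calc volume {x | t < f x} * (ENNReal.ofReal 2 * (ENNReal.ofReal (t / 2) * ENNReal.ofReal (t ^ (p - 1 - 1))))
        = ENNReal.ofReal 2 * ((ENNReal.ofReal (t / 2) * volume {x | t < f x}) * ENNReal.ofReal (t ^ (p - 1 - 1))) := by ring
      _ ≤ ENNReal.ofReal 2 * ((ENNReal.ofReal A * ν S) * ENNReal.ofReal (t ^ (p - 1 - 1))) := by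
          refine mul_le_mul_right (mul_le_mul_left ?_ _) _
          exact (mul_le_mul_right (measure_mono hsub) _).trans hw
      _ = _ := by rw [ENNReal.ofReal_mul two_pos.le]; ring
  have l1 := lintegral_rpow_eq_lintegral_meas_lt_mul (volume : Measure (E d)) (f := f)
    (Eventually.of_forall fun x => ENNReal.toReal_nonneg) hfm.aemeasurable (p := p) (by linarith)
  have l2 := lintegral_rpow_eq_lintegral_meas_lt_mul ν (f := fun x => c * g x)
    (Eventually.of_forall fun x => mul_nonneg hc0.le (hg0 x)) (by fun_prop) (p := p - 1) hp1
  rw [e1, l1]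
  set I := ∫⁻ t in Ioi (0:ℝ), ν {a | t < c * g a} * ENNReal.ofReal (t ^ (p - 1 - 1)) with hI
  have l3 : ∫⁻ t in Ioi (0:ℝ), volume {a | t < f a} * ENNReal.ofReal (t ^ (p - 1)) ≤ ENNReal.ofReal (2 * A) * I := by
    rw [hI, ← lintegral_const_mul' _ _ ENNReal.ofReal_ne_top]
    exact setLIntegral_mono' measurableSet_Ioi fun t ht => weak t ht
  have l4 : ∫⁻ x, ENNReal.ofReal ((c * g x) ^ (p - 1)) ∂ν = ENNReal.ofReal (c ^ (p - 1)) * ∫⁻ x, G x ^ p := by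
    rw [hν, lintegral_withDensity_eq_lintegral_mul _ hGm (by fun_prop), ← lintegral_const_mul _ (by fun_prop)]
    refine lintegral_congr fun x => ?_
    simp only [Pi.mul_apply, hG]
    rw [ENNReal.ofReal_rpow_of_nonneg (hg0 x) (by linarith), ← ENNReal.ofReal_mul (hg0 x), ← ENNReal.ofReal_mul (by positivity)]
    congr 1
    rw [Real.mul_rpow hc0.le (hg0 x)]
    rcases (hg0 x).eq_or_lt with h0 | h0
    · rw [← h0, Real.zero_rpow (by linarith : p ≠ 0)]; ring
    · have : g x ^ p = g x ^ (p - 1) * g x := by rw [← Real.rpow_add_one h0.ne']; congr 1; ring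
      rw [this]; ring
  rw [l4] at l2
  have l5 : I = ENNReal.ofReal (1 / (p - 1)) * (ENNReal.ofReal (c ^ (p - 1)) * ∫⁻ x, G x ^ p) := by
    rw [l2, ← mul_assoc, ← ENNReal.ofReal_mul (by positivity), one_div_mul_cancel hp1.ne']; simp
  have hp0 : 0 < p := by linarith
  refine (mul_le_mul_right l3 _).trans_eq ?_
  have hA0 : 0 < A := by positivity
  rw [l5, ← mul_assoc, ← mul_assoc, ← mul_assoc, ← ENNReal.ofReal_mul (by positivity), ← ENNReal.ofReal_mul (by positivity),
    ← ENNReal.ofReal_mul (by positivity)]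
  congr 2
  ring

end HK

namespace HK
variable {d : ℕ}

lemma Mx_morrey {p q μ : ℝ} (hpq : p.HolderConjugate q) (hμ : 0 < μ) :
    ∃ C : ℝ, 0 ≤ C ∧ ∀ (h : ℝ) (g : E d → ℝ), Measurable g → (∀ x, 0 ≤ g x) → (∃ N : ℝ, ∀ x, g x ≤ N) →
      ∀ M : ℝ≥0∞, MB p (d - p * μ) (fun x => ENNReal.ofReal (g x)) M →
        MB p (d - p * μ) (Mx h (fun x => ENNReal.ofReal (g x))) (ENNReal.ofReal C * M) := by
  obtain ⟨C0, hC0, HS⟩ := Mx_strong (d := d) hpq.lt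
  have hp := hpq.lt
  have hp0 : 0 < p := by linarith
  have hv := vb_pos (d := d)
  set c : ℝ := vb d ^ (1 / q) with hc
  have hc0 : 0 < c := by positivity
  set T : ℝ := 2 ^ (p - 1) * (C0 * 2 ^ ((d:ℝ) - p * μ) + c ^ p * vb d) with hT
  have hT0 : 0 ≤ T := by positivity
  refine ⟨T ^ (1 / p), by positivity, ?_⟩
  intro h g hgm hg0 hgb M hM z r hr
  set G : E d → ℝ≥0∞ := fun x => ENNReal.ofReal (g x) with hG
  have hGm : Measurable G := by fun_prop
  set B := ball z (2 * r) with hB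
  have hBm : MeasurableSet B := measurableSet_ball
  set g1 : E d → ℝ := B.indicator g with hg1
  have hG1 : (fun x => ENNReal.ofReal (g1 x)) = B.indicator G := by
    ext x
    by_cases hx : x ∈ B
    · simp [hg1, hx, hG]
    · simp [hg1, hx]
  have s1 : ∀ x ∈ ball z r, Mx h G x ≤ Mx h (B.indicator G) x + M * ENNReal.ofReal (c * r ^ (-μ)) := by
    intro x hx
    refine Mx_le fun s hs => ?_
    rcases lt_or_ge s r with hsr | hsr
    · refine le_trans ?_ (le_self_add)
      refine le_trans (le_of_eq ?_) (av_le_Mx hs _ x)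
      unfold av
      refine setLIntegral_congr_fun measurableSet_ball fun ζ hζ => ?_
      have : x + s • ζ ∈ B := by
        rw [hB, mem_ball]
        have h1 : dist (x + s • ζ) x < r := by
          rw [dist_eq_norm, add_sub_cancel_left, norm_smul, Real.norm_of_nonneg hs.1.le]
          have : ‖ζ‖ < 1 := by simpa using hζ
          nlinarith [hs.1, norm_nonneg ζ]
        have := dist_triangle (x + s • ζ) x z
        rw [mem_ball] at hx
        linarith
      simp only [indicator_of_mem this]
    · refine le_trans ?_ (le_add_self)
      have h1 := MB.L1 hpq hM hGm.aemeasurable x hs.1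
      rw [← av_eq hs.1 hGm x] at h1
      have hsd : 0 < s ^ (d:ℝ) := Real.rpow_pos_of_pos hs.1 _
      have h2 : ENNReal.ofReal (s ^ (d:ℝ)) * av s G x ≤ ENNReal.ofReal (s ^ (d:ℝ)) * (M * ENNReal.ofReal (c * r ^ (-μ))) := by
        refine h1.trans ?_
        rw [mul_left_comm, ← ENNReal.ofReal_mul hsd.le]
        refine mul_le_mul_right (ENNReal.ofReal_le_ofReal ?_) _
        have : s ^ ((d:ℝ) - μ) = s ^ (d:ℝ) * s ^ (-μ) := by rw [← Real.rpow_add hs.1]; rfl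
        rw [this, mul_left_comm]
        have h3 : s ^ (-μ) ≤ r ^ (-μ) := Real.rpow_le_rpow_of_nonpos hr hsr (by linarith)
        gcongr
      exact (ENNReal.mul_le_mul_iff_right (by simpa using hsd) ENNReal.ofReal_ne_top).1 h2
  have s2 : ∫⁻ y in ball z r, Mx h G y ^ p ≤ ∫⁻ y in ball z r, (2:ℝ≥0∞) ^ (p - 1) *
      (Mx h (B.indicator G) y ^ p + (M * ENNReal.ofReal (c * r ^ (-μ))) ^ p) :=
    setLIntegral_mono' measurableSet_ball fun x hx =>
      (ENNReal.rpow_le_rpow (s1 x hx) hp0.le).trans (ENNReal.rpow_add_le_mul_rpow_add_rpow _ _ hp.le)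
  refine s2.trans ?_
  have hmm : Measurable (Mx h (B.indicator G)) := Mx_meas h (hGm.indicator hBm)
  rw [lintegral_const_mul _ (by fun_prop), lintegral_add_left (by fun_prop), lintegral_const]
  have s3 : ∫⁻ y in ball z r, Mx h (B.indicator G) y ^ p ≤ ENNReal.ofReal (C0 * 2 ^ ((d:ℝ) - p * μ) * r ^ ((d:ℝ) - p * μ)) * M ^ p := by
    refine (setLIntegral_le_lintegral _ _).trans ?_
    have := HS h g1 (hgm.indicator hBm) (fun x => indicator_nonneg (fun y _ => hg0 y) x)
      (by obtain ⟨N, hN⟩ := hgb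
          refine ⟨N, fun x => ?_⟩
          by_cases hx : x ∈ B
          · simpa [hg1, hx] using hN x
          · simpa [hg1, hx] using (hg0 x).trans (hN x))
    have e0 : (fun x => ENNReal.ofReal (g1 x)) = B.indicator G := hG1
    have e1 : ∀ x, ENNReal.ofReal (g1 x) ^ p = B.indicator (fun y => G y ^ p) x := by
      intro x
      have := congrFun e0 x
      rw [this]
      by_cases hx : x ∈ B
      · simp [hx]
      · simp [hx, hp0]
    rw [e0] at this
    refine this.trans ?_
    simp_rw [e1]
    rw [lintegral_indicator hBm]
    refine (mul_le_mul_right (hM z (2 * r) (by positivity)) _).trans_eq ?_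
    rw [mul_left_comm, ← ENNReal.ofReal_mul hC0, Real.mul_rpow two_pos.le hr.le, mul_comm, mul_assoc]
  refine (mul_le_mul_right (add_le_add_left s3 _) _).trans_eq ?_
  rw [Measure.restrict_apply_univ, vol_ball z hr, ENNReal.mul_rpow_of_nonneg _ _ hp0.le, ENNReal.mul_rpow_of_nonneg _ _ hp0.le,
    ENNReal.ofReal_rpow_of_nonneg (by positivity) hp0.le, ENNReal.ofReal_rpow_of_nonneg (by positivity) hp0.le,
    show (2:ℝ≥0∞) ^ (p - 1) = ENNReal.ofReal (2 ^ (p-1)) by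
      rw [← ENNReal.ofReal_rpow_of_pos two_pos]; simp]
  rw [← Real.rpow_mul hT0, one_div_mul_cancel hp0.ne', Real.rpow_one]
  set a := r ^ ((d:ℝ) - p * μ) with ha
  have ha0 : 0 < a := by positivity
  have e4 : (c * r ^ (-μ)) ^ p * (vb d * r ^ (d:ℝ)) = c ^ p * vb d * a := by
    rw [Real.mul_rpow hc0.le (by positivity), ← Real.rpow_mul hr.le, ha, sub_eq_add_neg, Real.rpow_add hr,
      show -μ * p = -(p * μ) by ring]; ring
  rw [mul_assoc (M ^ p), ← ENNReal.ofReal_mul (by positivity), e4, mul_comm (M ^ p), ← add_mul,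
    ← ENNReal.ofReal_add (by positivity) (by positivity), ← mul_assoc, ← ENNReal.ofReal_mul (by positivity),
    mul_right_comm (ENNReal.ofReal T), ← ENNReal.ofReal_mul hT0]
  congr 2
  rw [hT]; ring

end HK

namespace HK
variable {d : ℕ}

/-- ℓ¹ size of the Hessian -/
def H2 (w : E d → ℝ) (x : E d) : ℝ := ∑ i, ∑ j, |D i (D j w) x|

lemma H2_nonneg (w : E d → ℝ) (x : E d) : 0 ≤ H2 w x :=
  Finset.sum_nonneg fun _ _ => Finset.sum_nonneg fun _ _ => abs_nonneg _

lemma H2_cont {w : E d → ℝ} (hw : ContDiff ℝ 2 w) : Continuous (H2 w) := by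
  unfold H2
  refine continuous_finsetSum _ fun i _ => continuous_finsetSum _ fun j _ => ?_
  exact (D_cont (D_C1 hw j) i).abs

lemma fderiv_sum (w : E d → ℝ) (x ζ : E d) : fderiv ℝ w x ζ = ∑ i, ζ i * D i w x := by
  have : ζ = ∑ i, ζ i • ee i := by
    ext j
    simp [ee, Finset.sum_apply, Pi.single_apply]
  conv_lhs => rw [this]
  rw [map_sum]
  simp [D]

lemma abs_coord_le (ζ : E d) (i : Fin d) : |ζ i| ≤ ‖ζ‖ := by
  have := EuclideanSpace.norm_eq ζ
  have h2 := PiLp.norm_apply_le ζ i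
  simpa using h2

lemma line_deriv {w : E d → ℝ} (hw : ContDiff ℝ 1 w) (x ζ : E d) (h t : ℝ) :
    HasDerivAt (fun t : ℝ => w (x + (t * h) • ζ)) (h * ∑ i, ζ i * D i w (x + (t * h) • ζ)) t := by
  have h1 : HasDerivAt (fun t : ℝ => x + (t * h) • ζ) (h • ζ) t := by
    have := (((hasDerivAt_id t).mul_const h).smul_const ζ).const_add x
    simpa using this
  have h2 := (hw.differentiable (by norm_num) (x + (t * h) • ζ)).hasFDerivAt
  have := h2.comp_hasDerivAt t h1
  refine this.congr_deriv ?_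
  rw [map_smul, fderiv_sum, smul_eq_mul]

lemma taylor {w : E d → ℝ} (hw : ContDiff ℝ 2 w) (x ζ : E d) (hζ : ‖ζ‖ ≤ 1) (h : ℝ) :
    |w (x + h • ζ) - w x - h * fderiv ℝ w x ζ| ≤ h ^ 2 * ∫ t in Ioc (0:ℝ) 1, H2 w (x + (t * h) • ζ) := by
  have hw1 : ContDiff ℝ 1 w := hw.of_le (by norm_num)
  set φ' : ℝ → ℝ := fun t => h * ∑ i, ζ i * D i w (x + (t * h) • ζ) with hφ'
  set φ'' : ℝ → ℝ := fun t => h * ∑ i, ζ i * (h * ∑ j, ζ j * D j (D i w) (x + (t * h) • ζ)) with hφ''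
  have d1 : ∀ t, HasDerivAt (fun t : ℝ => w (x + (t * h) • ζ)) (φ' t) t := fun t => line_deriv hw1 x ζ h t
  have d2 : ∀ t, HasDerivAt φ' (φ'' t) t := by
    intro t
    refine HasDerivAt.const_mul h ?_
    refine HasDerivAt.fun_sum fun i _ => ?_
    exact HasDerivAt.const_mul (ζ i) (line_deriv (D_C1 hw i) x ζ h t)
  have d3 : ∀ t ∈ uIcc (0:ℝ) 1, HasDerivAt (fun t => w (x + (t * h) • ζ) + (1 - t) * φ' t) ((1 - t) * φ'' t) t := by
    intro t _
    have := (d1 t).add (((hasDerivAt_id t).const_sub 1).mul (d2 t))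
    refine this.congr_deriv ?_
    simp
  have cline : Continuous fun t : ℝ => x + (t * h) • ζ := by fun_prop
  have c2 : Continuous φ'' := by
    refine continuous_const.mul (continuous_finsetSum _ fun i _ => continuous_const.mul (continuous_const.mul
      (continuous_finsetSum _ fun j _ => continuous_const.mul ((D_cont (D_C1 hw i) j).comp cline))))
  have c3 : Continuous fun t => (1 - t) * φ'' t := by fun_prop
  have ftc := intervalIntegral.integral_eq_sub_of_hasDerivAt d3 (c3.intervalIntegrable 0 1)
  have e0 : φ' 0 = h * fderiv ℝ w x ζ := by simp [hφ', fderiv_sum]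
  have e1 : w (x + h • ζ) - w x - h * fderiv ℝ w x ζ = ∫ t in Ioc (0:ℝ) 1, (1 - t) * φ'' t := by
    rw [intervalIntegral.integral_of_le zero_le_one] at ftc
    rw [ftc, ← e0]; simp; ring
  rw [e1, ← integral_const_mul]
  have cH : Continuous fun t : ℝ => h ^ 2 * H2 w (x + (t * h) • ζ) := continuous_const.mul ((H2_cont hw).comp cline)
  show ‖∫ t in Ioc (0:ℝ) 1, (1 - t) * φ'' t‖ ≤ _
  refine norm_integral_le_of_norm_le (cH.integrableOn_Ioc) ?_
  refine (ae_restrict_iff' measurableSet_Ioc).2 (Eventually.of_forall fun t ht => ?_)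
  rw [Real.norm_eq_abs, abs_mul]
  have b1 : |1 - t| ≤ 1 := by rw [abs_le]; constructor <;> linarith [ht.1, ht.2]
  have b2 : |φ'' t| ≤ h ^ 2 * H2 w (x + (t * h) • ζ) := by
    have : φ'' t = h ^ 2 * ∑ i, ∑ j, ζ i * ζ j * D j (D i w) (x + (t * h) • ζ) := by
      simp only [hφ'', Finset.mul_sum]
      refine Finset.sum_congr rfl fun i _ => Finset.sum_congr rfl fun j _ => ?_
      ring
    rw [this, abs_mul, abs_of_nonneg (sq_nonneg h), H2, Finset.sum_comm]
    refine mul_le_mul_of_nonneg_left ?_ (sq_nonneg h)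
    refine (Finset.abs_sum_le_sum_abs _ _).trans (Finset.sum_le_sum fun i _ => ?_)
    refine (Finset.abs_sum_le_sum_abs _ _).trans (Finset.sum_le_sum fun j _ => ?_)
    rw [abs_mul, abs_mul]
    have k1 : |ζ j| ≤ 1 := (abs_coord_le ζ j).trans hζ
    have k2 : |ζ i| ≤ 1 := (abs_coord_le ζ i).trans hζ
    have : |ζ j| * |ζ i| ≤ 1 := mul_le_one₀ k1 (abs_nonneg _) k2
    nlinarith [abs_nonneg (D i (D j w) (x + (t * h) • ζ))]
  calc |1 - t| * |φ'' t| ≤ 1 * |φ'' t| := mul_le_mul_of_nonneg_right b1 (abs_nonneg _)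
    _ ≤ _ := by rw [one_mul]; exact b2

lemma grad_pt {w : E d → ℝ} (hw : ContDiff ℝ 2 w) {x : E d} {h S : ℝ} (hh : 0 < h)
    (hS : ∀ y ∈ ball x h, |w y| ≤ S) {G : E d → ℝ≥0∞} (hG : Measurable G)
    (hwG : ∀ y ∈ ball x h, ENNReal.ofReal (H2 w y) ≤ G y) :
    ENNReal.ofReal ‖fderiv ℝ w x‖ ≤ ENNReal.ofReal (8 * S / h) +
      ENNReal.ofReal (4 ^ ((d:ℝ) + 1) / vb d * h) * ∫⁻ t in Ioc (0:ℝ) 1, av (t * h) G x := by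
  have hv := vb_pos (d := d)
  have hS0 : 0 ≤ S := (abs_nonneg _).trans (hS x (mem_ball_self hh))
  set a := (InnerProductSpace.toDual ℝ (E d)).symm (fderiv ℝ w x) with ha
  have hna : ‖fderiv ℝ w x‖ = ‖a‖ := by rw [ha, LinearIsometryEquiv.norm_map]
  have hap : ∀ ζ, fderiv ℝ w x ζ = ⟪a, ζ⟫ := by
    intro ζ; rw [ha, InnerProductSpace.toDual_symm_apply]
  rcases (norm_nonneg a).eq_or_lt with h0 | h0
  · rw [hna, ← h0]; simp
  set c : E d := (1 / (2 * ‖a‖)) • a with hc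
  have hcn : ‖c‖ = 1 / 2 := by
    rw [hc, norm_smul, Real.norm_of_nonneg (by positivity)]; field_simp
  have hac : ⟪a, c⟫ = ‖a‖ / 2 := by
    rw [hc, real_inner_smul_right, real_inner_self_eq_norm_sq]; field_simp
  set B := ball c (1 / 4 : ℝ) with hB
  have hBsub : B ⊆ ball (0 : E d) 1 := by
    intro ζ hζ
    rw [hB, mem_ball, dist_eq_norm] at hζ
    rw [mem_ball_zero_iff]
    calc ‖ζ‖ = ‖(ζ - c) + c‖ := by simp
      _ ≤ ‖ζ - c‖ + ‖c‖ := norm_add_le _ _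
      _ < 1 := by rw [hcn]; linarith
  have hvB : volume B = ENNReal.ofReal (vb d * (1 / 4) ^ (d:ℝ)) := vol_ball c (by norm_num)
  have pt : ∀ ζ ∈ B, ENNReal.ofReal (h * ‖a‖ / 4) ≤ ENNReal.ofReal (2 * S) +
      ENNReal.ofReal (h ^ 2) * ∫⁻ t in Ioc (0:ℝ) 1, G (x + (t * h) • ζ) := by
    intro ζ hζ
    have hζ1 : ‖ζ‖ < 1 := by simpa using hBsub hζ
    have hin : ‖a‖ / 4 ≤ ⟪a, ζ⟫ := by
      have : ⟪a, ζ⟫ = ⟪a, c⟫ + ⟪a, ζ - c⟫ := by rw [← inner_add_right]; simp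
      rw [this, hac]
      have h1 := abs_real_inner_le_norm a (ζ - c)
      rw [hB, mem_ball, dist_eq_norm] at hζ
      have h2 := (abs_le.1 h1).1
      nlinarith
    have hmem : ∀ t ∈ Icc (0:ℝ) 1, x + (t * h) • ζ ∈ ball x h := by
      intro t ht
      rw [mem_ball, dist_eq_norm, add_sub_cancel_left, norm_smul, Real.norm_of_nonneg (mul_nonneg ht.1 hh.le)]
      have : t * h ≤ h := by nlinarith [ht.2]
      nlinarith [norm_nonneg ζ, mul_nonneg ht.1 hh.le]
    have ht := taylor hw x ζ hζ1.le h
    have k1 := hS (x + h • ζ) (by simpa using hmem 1 (by simp))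
    have k2 := hS x (mem_ball_self hh)
    rw [abs_le] at k1 k2 ht
    rw [hap] at ht
    have hI : h * ‖a‖ / 4 ≤ 2 * S + h ^ 2 * ∫ t in Ioc (0:ℝ) 1, H2 w (x + (t * h) • ζ) := by
      nlinarith [ht.1, k1.2, k2.1]
    have cline : Continuous fun t : ℝ => x + (t * h) • ζ := by fun_prop
    have cH : Continuous fun t : ℝ => H2 w (x + (t * h) • ζ) := (H2_cont hw).comp cline
    refine (ENNReal.ofReal_le_ofReal hI).trans (ENNReal.ofReal_add_le.trans ?_)
    refine add_le_add le_rfl ?_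
    rw [ENNReal.ofReal_mul (sq_nonneg h)]
    refine mul_le_mul_right ?_ _
    rw [ofReal_integral_eq_lintegral_ofReal cH.integrableOn_Ioc (Eventually.of_forall fun t => H2_nonneg _ _)]
    exact setLIntegral_mono' measurableSet_Ioc fun t ht => hwG _ (hmem t ⟨ht.1.le, ht.2⟩)
  have int : ENNReal.ofReal (h * ‖a‖ / 4) * volume B ≤ ENNReal.ofReal (2 * S) * volume B +
      ENNReal.ofReal (h ^ 2) * ∫⁻ t in Ioc (0:ℝ) 1, av (t * h) G x := by
    have hjm : Measurable (fun z : E d × ℝ => G (x + (z.2 * h) • z.1)) := by fun_prop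
    calc ENNReal.ofReal (h * ‖a‖ / 4) * volume B = ∫⁻ ζ in B, ENNReal.ofReal (h * ‖a‖ / 4) := by simp
      _ ≤ ∫⁻ ζ in B, (ENNReal.ofReal (2 * S) + ENNReal.ofReal (h ^ 2) * ∫⁻ t in Ioc (0:ℝ) 1, G (x + (t * h) • ζ)) :=
          setLIntegral_mono' measurableSet_ball pt
      _ = ENNReal.ofReal (2 * S) * volume B + ENNReal.ofReal (h ^ 2) * ∫⁻ ζ in B, ∫⁻ t in Ioc (0:ℝ) 1, G (x + (t * h) • ζ) := by
          rw [lintegral_add_left measurable_const, lintegral_const_mul' _ _ ENNReal.ofReal_ne_top]; simp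
      _ ≤ ENNReal.ofReal (2 * S) * volume B + ENNReal.ofReal (h ^ 2) * ∫⁻ ζ in ball (0 : E d) 1, ∫⁻ t in Ioc (0:ℝ) 1, G (x + (t * h) • ζ) := by
          refine add_le_add le_rfl (mul_le_mul_right (lintegral_mono_set hBsub) _)
      _ = _ := by
          rw [lintegral_lintegral_swap hjm.aemeasurable]; rfl
  rw [hvB] at int
  set I := ∫⁻ t in Ioc (0:ℝ) 1, av (t * h) G x with hI
  set m : ℝ := vb d * (1 / 4) ^ (d:ℝ) with hm
  have hm0 : 0 < m := by positivity
  have int2 := mul_le_mul_right int (ENNReal.ofReal (4 / (h * m)))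
  rw [mul_add, ← ENNReal.ofReal_mul (by positivity), ← ENNReal.ofReal_mul (by positivity), ← ENNReal.ofReal_mul (by positivity),
    ← mul_assoc (ENNReal.ofReal (4 / (h * m))), ← ENNReal.ofReal_mul (by positivity),
    ← ENNReal.ofReal_mul (by positivity)] at int2
  rw [hna]
  convert int2 using 2
  · field_simp
  · congr 1; field_simp; ring
  · congr 2
    rw [hm, Real.rpow_add (by norm_num), Real.rpow_one, one_div, Real.inv_rpow (by norm_num)]
    field_simp

end HK

namespace HK
variable {d : ℕ}

lemma hedberg {μ h K m : ℝ} (hμ : 1 < μ) (hh : 0 < h) (hK : 0 < K) (hm : 0 ≤ m) {A : ℝ → ℝ≥0∞}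
    (h1 : ∀ s ∈ Ioc 0 h, A s ≤ ENNReal.ofReal m) (h2 : ∀ s ∈ Ioc 0 h, A s ≤ ENNReal.ofReal (K * s ^ (-μ))) :
    ENNReal.ofReal h * ∫⁻ t in Ioc (0:ℝ) 1, A (t * h) ≤
      ENNReal.ofReal ((1 + 1 / (μ - 1)) * (m ^ (1 - 1 / μ) * K ^ (1 / μ))) := by
  have hmem : ∀ t ∈ Ioc (0:ℝ) 1, t * h ∈ Ioc 0 h := fun t ht =>
    ⟨mul_pos ht.1 hh, by nlinarith [ht.2]⟩
  rcases hm.eq_or_lt with h0 | h0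
  · have : ∫⁻ t in Ioc (0:ℝ) 1, A (t * h) ≤ ∫⁻ t in Ioc (0:ℝ) 1, 0 :=
      setLIntegral_mono' measurableSet_Ioc fun t ht => (h1 _ (hmem t ht)).trans (by rw [← h0]; simp)
    rw [lintegral_zero] at this
    rw [le_zero_iff.1 this, mul_zero]; exact zero_le
  have hμ0 : 0 < μ := by linarith
  set s0 : ℝ := (K / m) ^ (1 / μ) with hs0
  have hs0p : 0 < s0 := by positivity
  set t0 := s0 / h with ht0
  have ht0p : 0 < t0 := by positivity
  have hIntg : IntegrableOn (fun t : ℝ => K * h ^ (-μ) * t ^ (-μ)) (Ioi t0) :=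
    (integrableOn_Ioi_rpow_of_lt (by linarith) ht0p).const_mul _
  have step : ∫⁻ t in Ioc (0:ℝ) 1, A (t * h) ≤ ENNReal.ofReal (m * t0) + ENNReal.ofReal (K * h ^ (-μ) * (t0 ^ (1 - μ) / (μ - 1))) := by
    calc ∫⁻ t in Ioc (0:ℝ) 1, A (t * h) ≤ ∫⁻ t in Ioc (0:ℝ) 1, ((Ioc 0 t0).indicator (fun _ => ENNReal.ofReal m) t +
          (Ioi t0).indicator (fun t => ENNReal.ofReal (K * h ^ (-μ) * t ^ (-μ))) t) := by
          refine setLIntegral_mono' measurableSet_Ioc fun t ht => ?_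
          rcases le_or_gt t t0 with hc | hc
          · rw [indicator_of_mem (show t ∈ Ioc 0 t0 from ⟨ht.1, hc⟩)]
            exact (h1 _ (hmem t ht)).trans le_self_add
          · rw [indicator_of_mem (show t ∈ Ioi t0 from hc) (fun t => ENNReal.ofReal (K * h ^ (-μ) * t ^ (-μ)))]
            refine le_trans ?_ le_add_self
            refine (h2 _ (hmem t ht)).trans_eq ?_
            rw [Real.mul_rpow ht.1.le hh.le]; congr 1; ring
      _ ≤ ∫⁻ t, ((Ioc 0 t0).indicator (fun _ => ENNReal.ofReal m) t +
          (Ioi t0).indicator (fun t => ENNReal.ofReal (K * h ^ (-μ) * t ^ (-μ))) t) := setLIntegral_le_lintegral _ _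
      _ = ENNReal.ofReal m * ENNReal.ofReal t0 + ∫⁻ t in Ioi t0, ENNReal.ofReal (K * h ^ (-μ) * t ^ (-μ)) := by
          rw [lintegral_add_left (measurable_const.indicator measurableSet_Ioc), lintegral_indicator measurableSet_Ioc,
            lintegral_indicator measurableSet_Ioi]
          simp
      _ = _ := by
          rw [ENNReal.ofReal_mul hm]
          congr 1
          rw [← ofReal_integral_eq_lintegral_ofReal hIntg]
          · rw [integral_const_mul, integral_Ioi_rpow_of_lt (by linarith) ht0p]
            congr 2
            rw [show -μ + 1 = 1 - μ by ring, ← neg_div_neg_eq]; simp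
          · refine (ae_restrict_iff' measurableSet_Ioi).2 (Eventually.of_forall fun t ht => ?_)
            have : 0 < t := ht0p.trans ht
            show 0 ≤ _
            positivity
  refine (mul_le_mul_right step _).trans_eq ?_
  have hμ1 : 0 < μ - 1 := by linarith
  rw [← ENNReal.ofReal_add (by positivity) (by positivity), ← ENNReal.ofReal_mul hh.le]
  congr 1
  have e1 : s0 ^ μ = K / m := by
    rw [hs0, ← Real.rpow_mul (by positivity), one_div_mul_cancel hμ0.ne', Real.rpow_one]
  have e2 : m * s0 = m ^ (1 - 1 / μ) * K ^ (1 / μ) := by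
    rw [hs0, Real.div_rpow hK.le hm, Real.rpow_sub h0, Real.rpow_one]; field_simp
  have e3 : K * s0 ^ (1 - μ) = m * s0 := by
    rw [Real.rpow_sub hs0p, Real.rpow_one, e1]; field_simp
  have e4 : t0 ^ (1 - μ) = s0 ^ (1 - μ) * h ^ (μ - 1) := by
    rw [ht0, Real.div_rpow hs0p.le hh.le, show μ - 1 = -(1 - μ) by ring, Real.rpow_neg hh.le]; rfl
  have e5 : h ^ (-μ) * h ^ (μ - 1) * h = 1 := by
    rw [← Real.rpow_add hh, ← Real.rpow_add_one hh.ne']; ring_nf; simp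
  rw [← e2, e4]
  have : h * (m * t0) = m * s0 := by rw [ht0]; field_simp
  calc _ = h * (m * t0) + (K * s0 ^ (1 - μ)) / (μ - 1) * (h ^ (-μ) * h ^ (μ - 1) * h) := by ring
    _ = _ := by rw [this, e3, e5]; ring

lemma grad_Mx {w : E d → ℝ} (hw : ContDiff ℝ 2 w) {x : E d} {h S : ℝ} (hh : 0 < h)
    (hS : ∀ y ∈ ball x h, |w y| ≤ S) {G : E d → ℝ≥0∞} (hG : Measurable G)
    (hwG : ∀ y ∈ ball x h, ENNReal.ofReal (H2 w y) ≤ G y) :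
    ENNReal.ofReal ‖fderiv ℝ w x‖ ≤ ENNReal.ofReal (8 * S / h) +
      ENNReal.ofReal (4 ^ ((d:ℝ) + 1) / vb d * h) * Mx h G x := by
  refine (grad_pt hw hh hS hG hwG).trans (add_le_add le_rfl (mul_le_mul_right ?_ _))
  calc ∫⁻ t in Ioc (0:ℝ) 1, av (t * h) G x ≤ ∫⁻ t in Ioc (0:ℝ) 1, Mx h G x :=
        setLIntegral_mono' measurableSet_Ioc fun t ht => av_le_Mx ⟨mul_pos ht.1 hh, by nlinarith [ht.2]⟩ G x
    _ = _ := by simp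

lemma grad_hed {p q μ : ℝ} (hpq : p.HolderConjugate q) (hμ : 1 < μ) : ∃ C : ℝ, 0 ≤ C ∧ 
    ∀ (w : E d → ℝ), ContDiff ℝ 2 w → ∀ (x : E d) (h S : ℝ), 0 < h →
    (∀ y ∈ ball x h, |w y| ≤ S) → ∀ (G : E d → ℝ≥0∞), Measurable G → (∃ N : ℝ, ∀ x, G x ≤ ENNReal.ofReal N) →
    (∀ y ∈ ball x h, ENNReal.ofReal (H2 w y) ≤ G y) → ∀ K : ℝ, 0 < K → MB p (d - p * μ) G (ENNReal.ofReal K) →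
    ENNReal.ofReal ‖fderiv ℝ w x‖ ≤ ENNReal.ofReal (8 * S / h) +
      ENNReal.ofReal (C * K ^ (1 / μ)) * Mx h G x ^ (1 - 1 / μ) := by
  have hv := vb_pos (d := d)
  have hμ0 : 0 < μ := by linarith
  have hμ1 : 0 < μ - 1 := by linarith
  have hμ2 : 0 < 1 - 1 / μ := by
    rw [sub_pos, div_lt_one hμ0]; exact hμ
  set c : ℝ := vb d ^ (1 / q) with hc
  have hc0 : 0 < c := by positivity
  refine ⟨4 ^ ((d:ℝ) + 1) / vb d * (1 + 1 / (μ - 1)) * c ^ (1 / μ), by positivity, ?_⟩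
  intro w hw x h S hh hS G hG ⟨N, hN⟩ hwG K hK hMB
  refine (grad_pt hw hh hS hG hwG).trans (add_le_add le_rfl ?_)
  have hMtop : Mx h G x ≠ ⊤ := by
    refine ne_top_of_le_ne_top (b := ENNReal.ofReal N * ENNReal.ofReal (vb d)) (by finiteness) ?_
    refine Mx_le fun s hs => ?_
    rw [← av_const (s := s) _ x]
    exact av_mono hN x
  have hav : ∀ s ∈ Ioc 0 h, av s G x ≤ ENNReal.ofReal (K * c * s ^ (-μ)) := by
    intro s hs
    have h1 := MB.L1 hpq hMB hG.aemeasurable x hs.1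
    rw [← av_eq hs.1 hG x] at h1
    have hsd : 0 < s ^ (d:ℝ) := Real.rpow_pos_of_pos hs.1 _
    have h2 : ENNReal.ofReal (s ^ (d:ℝ)) * av s G x ≤ ENNReal.ofReal (s ^ (d:ℝ)) * ENNReal.ofReal (K * c * s ^ (-μ)) := by
      refine h1.trans_eq ?_
      rw [← ENNReal.ofReal_mul hsd.le, ← ENNReal.ofReal_mul hK.le]
      congr 1
      have : s ^ ((d:ℝ) - μ) = s ^ (d:ℝ) * s ^ (-μ) := by rw [← Real.rpow_add hs.1]; rfl
      rw [this]; ring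
    exact (ENNReal.mul_le_mul_iff_right (by simpa using hsd) ENNReal.ofReal_ne_top).1 h2
  have hd := hedberg (m := (Mx h G x).toReal) hμ hh (mul_pos hK hc0) ENNReal.toReal_nonneg (A := fun s => av s G x)
    (fun s hs => by rw [ENNReal.ofReal_toReal hMtop]; exact av_le_Mx hs G x) hav
  have e1 : Mx h G x ^ (1 - 1 / μ) = ENNReal.ofReal ((Mx h G x).toReal ^ (1 - 1 / μ)) := by
    rw [← ENNReal.ofReal_rpow_of_nonneg ENNReal.toReal_nonneg hμ2.le, ENNReal.ofReal_toReal hMtop]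
  rw [ENNReal.ofReal_mul (by positivity), mul_assoc, e1, ← ENNReal.ofReal_mul (by positivity)]
  refine (mul_le_mul_right hd _).trans_eq ?_
  rw [← ENNReal.ofReal_mul (by positivity)]
  congr 1
  rw [Real.mul_rpow hK.le hc0.le]; ring

end HK

namespace HK
variable {d : ℕ}

lemma MB.of_small {p l R : ℝ} (hp : 0 < p) (hl : 0 ≤ l) (hR : 0 < R) {G : E d → ℝ≥0∞} {M : ℝ≥0∞}
    (hG : ∀ x, x ∉ ball (0 : E d) R → G x = 0)
    (h : ∀ z : E d, ∀ r : ℝ, 0 < r → r ≤ R → ∫⁻ y in ball z r, G y ^ p ≤ M ^ p * ENNReal.ofReal (r ^ l)) :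
    MB p l G M := by
  intro z r hr
  rcases le_or_gt r R with h1 | h1
  · exact h z r hr h1
  calc ∫⁻ y in ball z r, G y ^ p ≤ ∫⁻ y, G y ^ p := setLIntegral_le_lintegral _ _
    _ = ∫⁻ y in ball 0 R, G y ^ p := by
        rw [setLIntegral_eq_of_support_subset]
        intro y hy
        by_contra hc
        exact hy (by simp [hG y hc, hp])
    _ ≤ M ^ p * ENNReal.ofReal (R ^ l) := h 0 R hR le_rfl
    _ ≤ _ := by
        refine mul_le_mul_right (ENNReal.ofReal_le_ofReal ?_) _
        exact Real.rpow_le_rpow hR.le h1.le hl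

lemma MB_one {p μ R : ℝ} (hp : 0 < p) (hμ : 0 < μ) (hl : 0 ≤ (d:ℝ) - p * μ) (hR : 0 < R) :
    MB p ((d:ℝ) - p * μ) ((ball (0 : E d) R).indicator fun _ => 1) (ENNReal.ofReal (vb d ^ (1 / p) * R ^ μ)) := by
  have hv := vb_pos (d := d)
  refine MB.of_small hp hl hR (fun x hx => indicator_of_notMem hx _) fun z r hr hrR => ?_
  calc ∫⁻ y in ball z r, ((ball (0 : E d) R).indicator (fun _ => (1:ℝ≥0∞)) y) ^ p ≤ ∫⁻ y in ball z r, 1 := by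
        refine lintegral_mono fun y => ?_
        refine ENNReal.rpow_le_one ?_ hp.le
        exact indicator_le (fun _ _ => le_rfl) y
    _ = ENNReal.ofReal (vb d * r ^ (d:ℝ)) := by simp [vol_ball z hr]
    _ ≤ _ := by
        rw [ENNReal.ofReal_rpow_of_nonneg (by positivity) hp.le, ← ENNReal.ofReal_mul (by positivity)]
        refine ENNReal.ofReal_le_ofReal ?_
        rw [Real.mul_rpow (by positivity) (by positivity), ← Real.rpow_mul hv.le, one_div_mul_cancel hp.ne', Real.rpow_one,
          ← Real.rpow_mul hR.le, mul_assoc]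
        refine mul_le_mul_of_nonneg_left ?_ hv.le
        calc r ^ (d:ℝ) = r ^ (μ * p) * r ^ ((d:ℝ) - p * μ) := by rw [← Real.rpow_add hr]; congr 1; ring
          _ ≤ _ := by
            refine mul_le_mul_of_nonneg_right ?_ (by positivity)
            exact Real.rpow_le_rpow hr.le hrR (by positivity)

lemma drift {p μ R R₀ bh : ℝ} (hp : 0 < p) (hμ : 1 < μ) (hl : 0 ≤ (d:ℝ) - p * μ) (hR : 0 < R) (hR₀ : R ≤ R₀) (hbh : 0 ≤ bh)
    {β m : E d → ℝ≥0∞} (hβ : Measurable β) (hm : Measurable m) {M : ℝ≥0∞}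
    (Hb : ∀ z : E d, ∀ s ∈ Ioc 0 R₀, ∫⁻ y in ball z s, β y ^ (p * μ) ≤ ENNReal.ofReal (vb d * bh ^ (p * μ) * s ^ ((d:ℝ) - p * μ)))
    (Hm : MB p ((d:ℝ) - p * μ) m M) :
    MB p ((d:ℝ) - p * μ) ((ball (0 : E d) R).indicator fun x => β x * m x ^ (1 - 1 / μ))
      (ENNReal.ofReal (vb d ^ (1 / (p * μ)) * bh) * M ^ (1 - 1 / μ)) := by
  have hv := vb_pos (d := d)
  have hμ0 : 0 < μ := by linarith
  have hμ2 : 0 < 1 - 1 / μ := by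
    rw [sub_pos, div_lt_one hμ0]; exact hμ
  refine MB.of_small hp hl hR (fun x hx => indicator_of_notMem hx _) fun z r hr hrR => ?_
  set μ' : ℝ := 1 / (1 - 1 / μ) with hμ'
  have hconj : μ.HolderConjugate μ' := by
    rw [Real.holderConjugate_iff]
    refine ⟨hμ, ?_⟩
    rw [hμ']; simp
  calc ∫⁻ y in ball z r, ((ball (0 : E d) R).indicator (fun x => β x * m x ^ (1 - 1 / μ)) y) ^ p
      ≤ ∫⁻ y in ball z r, ((fun y => β y ^ p) * fun y => m y ^ (p * (1 - 1 / μ))) y := by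
        refine lintegral_mono fun y => ?_
        refine (ENNReal.rpow_le_rpow (indicator_le_self _ _ y) hp.le).trans_eq ?_
        rw [ENNReal.mul_rpow_of_nonneg _ _ hp.le, ← ENNReal.rpow_mul, mul_comm p]; rfl
    _ ≤ (∫⁻ y in ball z r, (β y ^ p) ^ μ) ^ (1 / μ) * (∫⁻ y in ball z r, (m y ^ (p * (1 - 1 / μ))) ^ μ') ^ (1 / μ') :=
        ENNReal.lintegral_mul_le_Lp_mul_Lq _ hconj (by fun_prop) (by fun_prop)
    _ = (∫⁻ y in ball z r, β y ^ (p * μ)) ^ (1 / μ) * (∫⁻ y in ball z r, m y ^ p) ^ (1 - 1 / μ) := by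
        simp_rw [← ENNReal.rpow_mul]
        rw [hμ', one_div_one_div, mul_assoc p, mul_one_div_cancel hμ2.ne', mul_one]
    _ ≤ (ENNReal.ofReal (vb d * bh ^ (p * μ) * r ^ ((d:ℝ) - p * μ))) ^ (1 / μ) * (M ^ p * ENNReal.ofReal (r ^ ((d:ℝ) - p * μ))) ^ (1 - 1 / μ) := by
        refine mul_le_mul' (ENNReal.rpow_le_rpow (Hb z r ⟨hr, hrR.trans hR₀⟩) (by positivity)) (ENNReal.rpow_le_rpow (Hm z r hr) hμ2.le)
    _ = _ := by
        set a := r ^ ((d:ℝ) - p * μ) with ha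
        have ha0 : 0 < a := by positivity
        rw [ENNReal.mul_rpow_of_nonneg _ _ hμ2.le, ENNReal.mul_rpow_of_nonneg _ _ hp.le, ← ENNReal.rpow_mul, ← ENNReal.rpow_mul,
          mul_comm p (1 - 1 / μ), ENNReal.ofReal_rpow_of_nonneg (by positivity) (by positivity),
          ENNReal.ofReal_rpow_of_nonneg (by positivity) hμ2.le, ENNReal.ofReal_rpow_of_nonneg (by positivity) hp.le]
        rw [mul_left_comm, ← ENNReal.ofReal_mul (by positivity), mul_right_comm (ENNReal.ofReal ((vb d ^ (1 / (p * μ)) * bh) ^ p)),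
          ← ENNReal.ofReal_mul (by positivity), mul_comm]
        congr 2
        rw [Real.mul_rpow (by positivity) ha0.le, mul_assoc, ← Real.rpow_add ha0, Real.mul_rpow hv.le (by positivity),
          Real.mul_rpow (by positivity) hbh, ← Real.rpow_mul hv.le, ← Real.rpow_mul hbh]
        have e1 : p * μ * (1 / μ) = p := by field_simp
        have e2 : 1 / (p * μ) * p = 1 / μ := by field_simp
        rw [e1, e2, add_sub_cancel, Real.rpow_one]

end HK

namespace HK
variable {d : ℕ}

lemma D_mul {a b : E d → ℝ} {x : E d} (ha : DifferentiableAt ℝ a x) (hb : DifferentiableAt ℝ b x) (i : Fin d) :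
    D i (fun y => a y * b y) x = D i a x * b x + a x * D i b x := by
  unfold D
  rw [fderiv_fun_mul ha hb]
  simp; ring

lemma D_add {a b : E d → ℝ} {x : E d} (ha : DifferentiableAt ℝ a x) (hb : DifferentiableAt ℝ b x) (i : Fin d) :
    D i (fun y => a y + b y) x = D i a x + D i b x := by
  unfold D
  rw [fderiv_fun_add ha hb]
  simp

lemma D_comp {g : ℝ → ℝ} {s : E d → ℝ} {x : E d} (hg : DifferentiableAt ℝ g (s x)) (hs : DifferentiableAt ℝ s x) (i : Fin d) :
    D i (fun y => g (s y)) x = deriv g (s x) * D i s x := by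
  unfold D
  have := hg.hasDerivAt.comp_hasFDerivAt x hs.hasFDerivAt
  have e : fderiv ℝ (fun y => g (s y)) x = deriv g (s x) • fderiv ℝ s x := this.fderiv
  rw [e]; simp

lemma D_congr {a b : E d → ℝ} {x : E d} (h : a =ᶠ[nhds x] b) (i : Fin d) : D i a =ᶠ[nhds x] D i b := by
  filter_upwards [h.fderiv (𝕜 := ℝ)] with y hy
  unfold D; rw [hy]

lemma smoothT_bd : ∃ C : ℝ, 1 ≤ C ∧ (∀ t, |deriv Real.smoothTransition t| ≤ C) ∧ ∀ t, |deriv (deriv Real.smoothTransition) t| ≤ C := by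
  have hT : ContDiff ℝ 2 Real.smoothTransition := Real.smoothTransition.contDiff
  have h1 : ContDiff ℝ 1 (deriv Real.smoothTransition) := by
    have := (contDiff_succ_iff_deriv (n := 1) (f := Real.smoothTransition)).1 (by exact_mod_cast hT)
    exact this.2.2
  have h2 : Continuous (deriv (deriv Real.smoothTransition)) := h1.continuous_deriv le_rfl
  have s1 : HasCompactSupport (deriv Real.smoothTransition) := by
    refine HasCompactSupport.intro (isCompact_Icc (a := (0:ℝ)) (b := 1)) fun t ht => ?_
    rw [mem_Icc, not_and_or, not_le, not_le] at ht
    rcases ht with ht | ht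
    · have : Real.smoothTransition =ᶠ[nhds t] fun _ => 0 := by
        filter_upwards [Iio_mem_nhds ht] with y hy
        exact Real.smoothTransition.zero_of_nonpos (le_of_lt hy)
      rw [this.deriv_eq]; simp
    · have : Real.smoothTransition =ᶠ[nhds t] fun _ => 1 := by
        filter_upwards [Ioi_mem_nhds ht] with y hy
        exact Real.smoothTransition.one_of_one_le (le_of_lt hy)
      rw [this.deriv_eq]; simp
  have s2 := s1.deriv
  obtain ⟨C1, hC1⟩ := h1.continuous.bounded_above_of_compact_support s1
  obtain ⟨C2, hC2⟩ := h2.bounded_above_of_compact_support s2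
  refine ⟨max 1 (max C1 C2), le_max_left _ _, fun t => ?_, fun t => ?_⟩
  · exact (hC1 t).trans ((le_max_left _ _).trans (le_max_right _ _))
  · exact (hC2 t).trans ((le_max_right _ _).trans (le_max_right _ _))

lemma cutoff : ∃ C : ℝ, 0 < C ∧ ∀ r R : ℝ, 0 < r → r < R → ∃ η : E d → ℝ, ContDiff ℝ 2 η ∧
    (∀ x, 0 ≤ η x) ∧ (∀ x, η x ≤ 1) ∧ (∀ x ∈ ball (0 : E d) r, η x = 1) ∧ (∀ x, x ∉ ball (0 : E d) R → η x = 0) ∧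
    (∀ x ∈ closedBall (0 : E d) R, ∀ i, |D i η x| ≤ C / (R - r)) ∧
    (∀ x ∈ closedBall (0 : E d) R, ∀ i j, |D i (D j η) x| ≤ C / (R - r) ^ 2) := by
  obtain ⟨C, hC, hT1, hT2⟩ := smoothT_bd
  refine ⟨6 * C, by linarith, fun r R hr hrR => ?_⟩
  set T := Real.smoothTransition with hTdef
  have hT : ContDiff ℝ 2 T := Real.smoothTransition.contDiff
  have hT' : ContDiff ℝ 1 (deriv T) := by
    have := (contDiff_succ_iff_deriv (n := 1) (f := T)).1 (by exact_mod_cast hT)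
    exact this.2.2
  set κ := R ^ 2 - r ^ 2 with hκ
  have hδ : 0 < R - r := by linarith
  have hκ0 : 0 < κ := by nlinarith
  have hκR : (R - r) * R ≤ κ := by nlinarith
  have hκδ : (R - r) ^ 2 ≤ κ := by nlinarith
  set s : E d → ℝ := fun x => (R ^ 2 - ‖x‖ ^ 2) / κ with hs
  have hsC : ContDiff ℝ 2 s := by
    refine ContDiff.div_const (contDiff_const.sub (contDiff_norm_sq ℝ)) _
  have hsD : ∀ i x, D i s x = (-2 / κ) * x i := by
    intro i x
    have h1 := (hasStrictFDerivAt_norm_sq x).hasFDerivAt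
    have h2 := (h1.const_sub (R ^ 2)).mul_const κ⁻¹
    have : fderiv ℝ s x = _ := h2.fderiv
    unfold D
    rw [this]
    simp [ee, EuclideanSpace.inner_single_right]
    field_simp
  have hη : ContDiff ℝ 2 fun x => T (s x) := hT.comp hsC
  have hsd : Differentiable ℝ s := hsC.differentiable two_ne_zero
  have hTd : Differentiable ℝ T := hT.differentiable two_ne_zero
  have hTd' : Differentiable ℝ (deriv T) := hT'.differentiable one_ne_zero
  have hDη : ∀ i, D i (fun x => T (s x)) = fun x => deriv T (s x) * ((-2 / κ) * x i) := by
    intro i; ext x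
    rw [D_comp (hTd _) (hsd x), hsD]
  have hcoordD : ∀ i, Differentiable ℝ fun x : E d => (-2 / κ) * x i := by
    intro i; fun_prop
  have hcoord : ∀ i j (x : E d), |D i (fun x : E d => (-2 / κ) * x j) x| ≤ 2 / κ := by
    intro i j x
    have h0 : HasFDerivAt (fun x : E d => (-2 / κ) * x j) ((-2 / κ) • (EuclideanSpace.proj j : E d →L[ℝ] ℝ)) x :=
      ((EuclideanSpace.proj j : E d →L[ℝ] ℝ).hasFDerivAt).const_mul _
    unfold D
    rw [h0.fderiv]
    have e9 : ((-2 / κ) • (EuclideanSpace.proj j : E d →L[ℝ] ℝ)) (ee i) = (-2 / κ) * (ee i : E d) j := rfl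
    rw [e9, abs_mul]
    rw [abs_div, abs_neg, abs_two, abs_of_pos hκ0]
    refine mul_le_of_le_one_right (by positivity) ?_
    by_cases h : j = i
    · subst h; simp [ee]
    · simp [ee, h]
  have hR0 : 0 < R := by linarith
  have hx1 : ∀ x ∈ closedBall (0 : E d) R, ∀ i, |(-2 / κ) * x i| ≤ 2 / (R - r) := by
    intro x hx i
    have h1 : |x i| ≤ R := (abs_coord_le x i).trans (by simpa using hx)
    rw [abs_mul, abs_div, abs_neg, abs_two, abs_of_pos hκ0, div_mul_eq_mul_div, div_le_div_iff₀ hκ0 hδ]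
    nlinarith
  refine ⟨fun x => T (s x), hη, fun x => Real.smoothTransition.nonneg _, fun x => Real.smoothTransition.le_one _, ?_, ?_, ?_, ?_⟩
  · intro x hx
    refine Real.smoothTransition.one_of_one_le ?_
    rw [mem_ball_zero_iff] at hx
    rw [hs, le_div_iff₀ hκ0]
    nlinarith [norm_nonneg x]
  · intro x hx
    refine Real.smoothTransition.zero_of_nonpos ?_
    rw [mem_ball_zero_iff, not_lt] at hx
    refine div_nonpos_of_nonpos_of_nonneg ?_ hκ0.le
    nlinarith [norm_nonneg x]
  · intro x hx i
    rw [hDη, abs_mul]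
    calc _ ≤ C * (2 / (R - r)) := mul_le_mul (hT1 _) (hx1 x hx i) (abs_nonneg _) (by linarith)
      _ ≤ _ := by rw [mul_div_assoc']; refine div_le_div_of_nonneg_right ?_ hδ.le; linarith
  · intro x hx i j
    rw [hDη, D_mul (a := fun x => deriv T (s x)) ((hTd' _).comp x (hsd x)) (hcoordD j x), D_comp (hTd' _) (hsd x), hsD]
    have a1 := hx1 x hx i
    have a2 := hx1 x hx j
    have a3 := hcoord i j x
    have a4 := hT1 (s x)
    have a5 := hT2 (s x)
    have a6 : 2 / κ ≤ 2 / (R - r) ^ 2 := by gcongr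
    calc _ ≤ |deriv (deriv T) (s x) * (-2 / κ * x i) * (-2 / κ * x j)| + |deriv T (s x) * D i (fun x : E d => -2 / κ * x j) x| := abs_add_le _ _
      _ ≤ C * (2 / (R - r)) * (2 / (R - r)) + C * (2 / (R - r) ^ 2) := by
          rw [abs_mul, abs_mul, abs_mul (deriv T (s x))]
          refine add_le_add (mul_le_mul (mul_le_mul a5 a1 (abs_nonneg _) (by linarith)) a2 (abs_nonneg _) (by positivity)) ?_
          exact mul_le_mul a4 (a3.trans a6) (abs_nonneg _) (by linarith)
      _ = _ := by field_simp; ring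

end HK

namespace HK
variable {d : ℕ}

lemma Lap_mul {η w : E d → ℝ} (hη : ContDiff ℝ 2 η) (hw : ContDiff ℝ 2 w) (x : E d) :
    Lap (fun y => η y * w y) x = Lap η x * w x + 2 * ∑ l, D l η x * D l w x + η x * Lap w x := by
  have d1 : Differentiable ℝ η := hη.differentiable two_ne_zero
  have d2 : Differentiable ℝ w := hw.differentiable two_ne_zero
  have d3 : ∀ l, Differentiable ℝ (D l η) := fun l => (D_C1 hη l).differentiable one_ne_zero
  have d4 : ∀ l, Differentiable ℝ (D l w) := fun l => (D_C1 hw l).differentiable one_ne_zero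
  unfold Lap
  rw [Finset.sum_mul, Finset.mul_sum, Finset.mul_sum, ← Finset.sum_add_distrib, ← Finset.sum_add_distrib]
  refine Finset.sum_congr rfl fun l _ => ?_
  have e : D l (fun y => η y * w y) = fun y => D l η y * w y + η y * D l w y := by
    ext y; exact D_mul (d1 y) (d2 y) l
  rw [e, D_add (a := fun y => D l η y * w y) (b := fun y => η y * D l w y) ((d3 l x).mul (d2 x)) ((d1 x).mul (d4 l x)),
    D_mul (d3 l x) (d2 x), D_mul (d1 x) (d4 l x)]
  ring

lemma ee_norm (i : Fin d) : ‖(ee i : E d)‖ = 1 := by simp [ee]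

lemma D_le (w : E d → ℝ) (x : E d) (i : Fin d) : |D i w x| ≤ ‖fderiv ℝ w x‖ := by
  have := (fderiv ℝ w x).le_opNorm (ee i)
  rwa [ee_norm, mul_one] at this

lemma D2_zero {v : E d → ℝ} {x : E d} (h : v =ᶠ[nhds x] fun _ => 0) (i j : Fin d) : D i (D j v) x = 0 := by
  have h1 := D_congr (D_congr h j) i
  rw [h1.eq_of_nhds]
  have : D j (fun _ : E d => (0:ℝ)) = fun _ => 0 := by ext y; simp [D]
  rw [this]; simp [D]

lemma localize : ∃ C : ℝ, 0 < C ∧ ∀ (w : E d → ℝ), ContDiff ℝ 2 w → ∀ r δ S : ℝ, 0 < r → 0 < δ →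
    (∀ y ∈ ball (0 : E d) (r + δ / 4), |w y| ≤ S) → ∃ v : E d → ℝ, ContDiff ℝ 2 v ∧ HasCompactSupport v ∧
    (∀ x ∈ ball (0 : E d) r, ∀ i j, D i (D j v) x = D i (D j w) x) ∧
    ∀ x, ENNReal.ofReal |Lap v x| ≤ (ball (0 : E d) (r + δ / 4)).indicator (fun x =>
      ENNReal.ofReal |Lap w x| + ENNReal.ofReal (C / δ) * ENNReal.ofReal ‖fderiv ℝ w x‖ + ENNReal.ofReal (C * S / δ ^ 2)) x := by
  obtain ⟨C, hC, H⟩ := cutoff (d := d)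
  refine ⟨64 * (d + 1) * C, by positivity, fun w hw r δ S hr hδ hS => ?_⟩
  obtain ⟨η, hη, h0, h1, hr1, hR0, hD1, hD2⟩ := H r (r + δ / 8) hr (by linarith)
  have hcs : HasCompactSupport η := HasCompactSupport.intro (isCompact_closedBall (0 : E d) (r + δ / 8)) fun x hx =>
    hR0 x fun h => hx (ball_subset_closedBall h)
  refine ⟨fun y => η y * w y, hη.mul hw, hcs.mul_right, ?_, ?_⟩
  · intro x hx i j
    have : (fun y => η y * w y) =ᶠ[nhds x] w := by
      filter_upwards [isOpen_ball.mem_nhds hx] with y hy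
      rw [hr1 y hy, one_mul]
    exact (D_congr (D_congr this j) i).eq_of_nhds
  · intro x
    have hS0 : 0 ≤ S := (abs_nonneg _).trans (hS 0 (by simp; linarith))
    by_cases hx : x ∈ closedBall (0 : E d) (r + δ / 8)
    · have hxb : x ∈ ball (0 : E d) (r + δ / 4) := closedBall_subset_ball (by linarith) hx
      rw [indicator_of_mem hxb]
      rw [← ENNReal.ofReal_mul (by positivity), ← ENNReal.ofReal_add (by positivity) (by positivity),
        ← ENNReal.ofReal_add (by positivity) (by positivity)]
      refine ENNReal.ofReal_le_ofReal ?_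
      rw [Lap_mul hη hw]
      set g := ‖fderiv ℝ w x‖ with hg
      have hg0 : 0 ≤ g := norm_nonneg _
      have a1 : |Lap η x * w x| ≤ 64 * (d + 1) * C * S / δ ^ 2 := by
        rw [abs_mul]
        have : |Lap η x| ≤ d * (C / (δ / 8) ^ 2) := by
          unfold Lap
          refine (Finset.abs_sum_le_sum_abs _ _).trans ?_
          calc ∑ l, |D l (D l η) x| ≤ ∑ l : Fin d, C / (δ / 8) ^ 2 := Finset.sum_le_sum fun l _ => by
                have := hD2 x hx l l
                rwa [add_sub_cancel_left] at this
            _ = _ := by simp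
        calc |Lap η x| * |w x| ≤ d * (C / (δ / 8) ^ 2) * S := mul_le_mul this (hS x hxb) (abs_nonneg _) (by positivity)
          _ = 64 * d * C * S / δ ^ 2 := by field_simp; ring
          _ ≤ _ := by gcongr; linarith
      have a2 : |2 * ∑ l, D l η x * D l w x| ≤ 64 * (d + 1) * C / δ * g := by
        rw [abs_mul, abs_two]
        have : |∑ l, D l η x * D l w x| ≤ d * (C / (δ / 8) * g) := by
          refine (Finset.abs_sum_le_sum_abs _ _).trans ?_
          calc ∑ l, |D l η x * D l w x| ≤ ∑ l : Fin d, C / (δ / 8) * g := Finset.sum_le_sum fun l _ => by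
                have := hD1 x hx l
                rw [add_sub_cancel_left] at this
                rw [abs_mul]
                exact mul_le_mul this (D_le w x l) (abs_nonneg _) (by positivity)
            _ = _ := by simp
        calc 2 * |∑ l, D l η x * D l w x| ≤ 2 * (d * (C / (δ / 8) * g)) := by linarith
          _ = 16 * d * C / δ * g := by field_simp; ring
          _ ≤ _ := by gcongr <;> linarith
      have a3 : |η x * Lap w x| ≤ |Lap w x| := by
        rw [abs_mul, abs_of_nonneg (h0 x)]
        exact mul_le_of_le_one_left (abs_nonneg _) (h1 x)
      have := abs_add_le (Lap η x * w x + 2 * ∑ l, D l η x * D l w x) (η x * Lap w x)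
      have := abs_add_le (Lap η x * w x) (2 * ∑ l, D l η x * D l w x)
      linarith
    · have hz : (fun y => η y * w y) =ᶠ[nhds x] fun _ => 0 := by
        filter_upwards [isClosed_closedBall.isOpen_compl.mem_nhds hx] with y hy
        rw [hR0 y fun h => hy (ball_subset_closedBall h), zero_mul]
      have : Lap (fun y => η y * w y) x = 0 := by
        unfold Lap
        exact Finset.sum_eq_zero fun l _ => D2_zero hz l l
      rw [this]; simp

lemma MB.sum {ι : Type*} [DecidableEq ι] {p l : ℝ} (hp : 1 ≤ p) (s : Finset ι) {G : ι → E d → ℝ≥0∞} {M : ι → ℝ≥0∞} (h : ∀ i, MB p l (G i) (M i))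
    (hG : ∀ i, AEMeasurable (G i)) : MB p l (fun x => ∑ i ∈ s, G i x) (∑ i ∈ s, M i) := by
  induction s using Finset.induction_on with
  | empty =>
    intro z r hr
    have : (0:ℝ≥0∞) ^ p = 0 := ENNReal.zero_rpow_of_pos (by linarith)
    simp [this]
  | insert a s ha ih =>
    simp_rw [Finset.sum_insert ha]
    exact (h a).add hp ih (hG a) (Finset.aemeasurable_fun_sum _ fun i _ => hG i)

end HK

namespace HK
variable {d : ℕ}

set_option maxHeartbeats 1600000 in
lemma step {p q μ : ℝ} (hd : 0 < d) (hpq : p.HolderConjugate q) (hp2 : p ≠ 2) (hμ : 1 < μ) (hl : 0 ≤ (d:ℝ) - p * μ) :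
    ∃ C : ℝ, 0 < C ∧ ∀ w : E d → ℝ, ContDiff ℝ 2 w → (∃ N : ℝ, ∀ x, H2 w x ≤ N) →
    ∀ r δ S ρ R₀ bh θ K Φ : ℝ, 0 < r → 0 < δ → r + δ ≤ ρ → ρ ≤ R₀ → 0 < bh → bh ≤ 1 → 0 < θ → θ ≤ 1 / 4 → 0 < K → 0 ≤ Φ →
    (∀ y ∈ ball (0 : E d) (r + δ / 2), |w y| ≤ S) → ∀ β F : E d → ℝ≥0∞, Measurable β → Measurable F →
    (∀ z : E d, ∀ s ∈ Ioc 0 R₀, ∫⁻ y in ball z s, β y ^ (p * μ) ≤ ENNReal.ofReal (vb d * bh ^ (p * μ) * s ^ ((d:ℝ) - p * μ))) →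
    MB p ((d:ℝ) - p * μ) F (ENNReal.ofReal Φ) →
    (∀ᵐ x, x ∈ ball (0 : E d) (r + δ / 2) → ENNReal.ofReal |Lap w x| ≤ F x + β x * ENNReal.ofReal ‖fderiv ℝ w x‖) →
    MB p ((d:ℝ) - p * μ) (fun x => ENNReal.ofReal ((ball (0 : E d) (r + δ / 2)).indicator (H2 w) x)) (ENNReal.ofReal K) →
    MB p ((d:ℝ) - p * μ) (fun x => ENNReal.ofReal ((ball (0 : E d) r).indicator (H2 w) x))
      (ENNReal.ofReal (C * (Φ + (bh + θ) * K + S * ρ ^ μ / (θ * δ ^ 2)))) := by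
  have hμ0 : 0 < μ := by linarith
  have hμ2 : 0 < 1 - 1 / μ := by
    rw [sub_pos, div_lt_one hμ0]; exact hμ
  have hp1 := hpq.lt
  have hp0 : 0 < p := by linarith
  have hv := vb_pos (d := d)
  obtain ⟨C1, hC1, HCZ⟩ := CZ hd hpq hp2 hμ0
  obtain ⟨CM, hCM, HM⟩ := Mx_morrey (d := d) hpq hμ0
  obtain ⟨CH, hCH, HH⟩ := grad_hed (d := d) hpq hμ
  obtain ⟨CL, hCL, HL⟩ := localize (d := d)
  set c4 : ℝ := 4 ^ ((d:ℝ) + 1) / vb d with hc4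
  set cb : ℝ := vb d ^ (1 / (p * μ)) with hcb
  set c1 : ℝ := vb d ^ (1 / p) with hc1
  have hc4p : 0 < c4 := by positivity
  have hcbp : 0 < cb := by positivity
  have hc1p : 0 < c1 := by positivity
  set C2 : ℝ := 1 + 32 * cb * c1 ^ (1 - 1 / μ) + CH * cb * CM ^ (1 - 1 / μ) + 9 * CL * c1 + CL * c4 * CM with hC2
  have hC2p : 0 < C2 := by positivity
  refine ⟨d * d * C1 * C2 + 1, by positivity, ?_⟩
  intro w hw ⟨N, hN⟩ r δ S ρ R₀ bh θ K Φ hr hδ hrδ hρR hbh hbh1 hθ hθ1 hK hΦ hS β F hβ hF Hb HF Heq HK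
  have hρ : 0 < ρ := by linarith
  have hS0 : 0 ≤ S := (abs_nonneg _).trans (hS 0 (by simp; linarith))
  set R := r + δ / 4 with hR
  have hR0 : 0 < R := by positivity
  have hRρ : R ≤ ρ := by rw [hR]; linarith
  obtain ⟨v, hv2, hvs, hvw, hvL⟩ := HL w hw r δ S hr hδ fun y hy => hS y (ball_subset_ball (by linarith) hy)
  set g : E d → ℝ := (ball (0 : E d) (r + δ / 2)).indicator (H2 w) with hg
  set G : E d → ℝ≥0∞ := fun x => ENNReal.ofReal (g x) with hG
  have hgm : Measurable g := (H2_cont hw).measurable.indicator measurableSet_ball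
  have hGm : Measurable G := by fun_prop
  have hg0 : ∀ x, 0 ≤ g x := fun x => indicator_nonneg (fun y _ => H2_nonneg w y) x
  have hgN : ∀ x, g x ≤ N := fun x => by
    by_cases hx : x ∈ ball (0 : E d) (r + δ / 2)
    · rw [hg, indicator_of_mem hx]; exact hN x
    · rw [hg, indicator_of_notMem hx]; exact (H2_nonneg w x).trans (hN x)
  set h1 := δ / 4 with hh1
  set h := θ * δ with hh
  have h1p : 0 < h1 := by positivity
  have hp : 0 < h := by positivity
  have hle : h ≤ h1 := by rw [hh, hh1]; nlinarith
  have hsub : ∀ x ∈ ball (0 : E d) R, ball x h1 ⊆ ball (0 : E d) (r + δ / 2) := by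
    intro x hx
    refine ball_subset_ball' ?_
    rw [mem_ball] at hx
    rw [hh1]; linarith
  have hgw : ∀ x ∈ ball (0 : E d) R, ∀ y ∈ ball x h1, ENNReal.ofReal (H2 w y) ≤ G y := by
    intro x hx y hy
    simp only [hG, hg]
    rw [indicator_of_mem (hsub x hx hy)]
  have gr1 : ∀ x ∈ ball (0 : E d) R, ENNReal.ofReal ‖fderiv ℝ w x‖ ≤ ENNReal.ofReal (8 * S / h1) +
      ENNReal.ofReal (CH * K ^ (1 / μ)) * Mx h1 G x ^ (1 - 1 / μ) := fun x hx =>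
    HH w hw x h1 S h1p (fun y hy => hS y (hsub x hx hy)) G hGm ⟨N, fun x => ENNReal.ofReal_le_ofReal (hgN x)⟩ (hgw x hx) K hK HK
  have gr2 : ∀ x ∈ ball (0 : E d) R, ENNReal.ofReal ‖fderiv ℝ w x‖ ≤ ENNReal.ofReal (8 * S / h) +
      ENNReal.ofReal (c4 * h) * Mx h G x := fun x hx =>
    grad_Mx hw hp (fun y hy => hS y (hsub x hx (ball_subset_ball hle hy))) hGm (fun y hy => hgw x hx y (ball_subset_ball hle hy))
  set I : E d → ℝ≥0∞ := (ball (0 : E d) R).indicator fun _ => 1 with hI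
  have hIm : Measurable I := measurable_const.indicator measurableSet_ball
  have hMm : ∀ h, Measurable (Mx h G) := fun h => Mx_meas h hGm
  have HI : MB p ((d:ℝ) - p * μ) I (ENNReal.ofReal (c1 * R ^ μ)) := MB_one hp0 hμ0 hl hR0
  have HMx : ∀ h, MB p ((d:ℝ) - p * μ) (Mx h G) (ENNReal.ofReal CM * ENNReal.ofReal K) := fun h => HM h g hgm hg0 ⟨N, hgN⟩ _ HK
  set t2 : E d → ℝ≥0∞ := (ball (0 : E d) R).indicator fun x => β x * I x ^ (1 - 1 / μ) with ht2
  set t3 : E d → ℝ≥0∞ := (ball (0 : E d) R).indicator fun x => β x * Mx h1 G x ^ (1 - 1 / μ) with ht3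
  have mt2 : Measurable t2 := Measurable.indicator (by fun_prop) measurableSet_ball
  have mt3 : Measurable t3 := by
    have := hMm h1
    exact Measurable.indicator (by fun_prop) measurableSet_ball
  have H2' := (drift hp0 hμ hl hR0 (hRρ.trans hρR) hbh.le hβ hIm Hb HI).const_mul hp0.le mt2.aemeasurable (ENNReal.ofReal (8 * S / h1))
  have H3' := (drift hp0 hμ hl hR0 (hRρ.trans hρR) hbh.le hβ (hMm h1) Hb (HMx h1)).const_mul hp0.le mt3.aemeasurable (ENNReal.ofReal (CH * K ^ (1 / μ)))
  have H4' := HI.const_mul hp0.le hIm.aemeasurable (ENNReal.ofReal (CL / δ * (8 * S / h) + CL * S / δ ^ 2))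
  have H5' := (HMx h).const_mul hp0.le (hMm h).aemeasurable (ENNReal.ofReal (CL / δ * (c4 * h)))
  have m2 : Measurable fun x => ENNReal.ofReal (8 * S / h1) * t2 x := mt2.const_mul _
  have m3 : Measurable fun x => ENNReal.ofReal (CH * K ^ (1 / μ)) * t3 x := mt3.const_mul _
  have m4 : Measurable fun x => ENNReal.ofReal (CL / δ * (8 * S / h) + CL * S / δ ^ 2) * I x := hIm.const_mul _
  have m5 : Measurable fun x => ENNReal.ofReal (CL / δ * (c4 * h)) * Mx h G x := (hMm h).const_mul _
  have T2 := HF.add hp1.le H2' hF.aemeasurable m2.aemeasurable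
  have T3 := T2.add hp1.le H3' (hF.add m2).aemeasurable m3.aemeasurable
  have T4 := T3.add hp1.le H4' ((hF.add m2).add m3).aemeasurable m4.aemeasurable
  have HT := T4.add hp1.le H5' (((hF.add m2).add m3).add m4).aemeasurable m5.aemeasurable
  set Q : ℝ := Φ + (bh + θ) * K + S * ρ ^ μ / (θ * δ ^ 2) with hQ
  have hQ0 : 0 ≤ Q := by positivity
  -- bound of the constants
  have HL' : MB p ((d:ℝ) - p * μ) (fun x => ENNReal.ofReal |Lap v x|) (ENNReal.ofReal (C2 * Q)) := by
    refine HT.mono hp0.le ?_ ?_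
    · filter_upwards [Heq] with x hx
      refine (hvL x).trans ?_
      by_cases hxR : x ∈ ball (0 : E d) R
      · rw [indicator_of_mem hxR]
        have hI1 : I x = 1 := by rw [hI, indicator_of_mem hxR]
        have e2 : t2 x = β x := by rw [ht2, indicator_of_mem hxR, hI1]; simp
        have e3 : t3 x = β x * Mx h1 G x ^ (1 - 1 / μ) := by rw [ht3, indicator_of_mem hxR]
        rw [ht2] at e2
        rw [ht3] at e3
        rw [e2, e3, hI1]
        have q1 := hx (ball_subset_ball (by linarith) hxR)
        have q2 := q1.trans (add_le_add le_rfl (mul_le_mul_right (gr1 x hxR) (β x)))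
        have q3 := mul_le_mul_right (gr2 x hxR) (ENNReal.ofReal (CL / δ))
        refine (add_le_add (add_le_add q2 q3) le_rfl).trans_eq ?_
        rw [ENNReal.ofReal_add (p := CL / δ * (8 * S / h)) (by positivity) (by positivity), ENNReal.ofReal_mul (p := CL / δ) (by positivity),
          ENNReal.ofReal_mul (p := CL / δ) (by positivity)]
        ring
      · rw [indicator_of_notMem hxR]; exact zero_le
    · have b2 : 8 * S / h1 * (cb * bh * (c1 * R ^ μ) ^ (1 - 1 / μ)) ≤ 32 * cb * c1 ^ (1 - 1 / μ) * (S * ρ ^ μ / (θ * δ ^ 2)) := by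
        rw [Real.mul_rpow hc1p.le (by positivity), ← Real.rpow_mul hR0.le]
        have e : μ * (1 - 1 / μ) = μ - 1 := by field_simp
        rw [e]
        have k1 : R ^ (μ - 1) ≤ ρ ^ μ / δ := by
          calc R ^ (μ - 1) ≤ ρ ^ (μ - 1) := Real.rpow_le_rpow hR0.le hRρ (by linarith)
            _ = ρ ^ μ / ρ := by rw [Real.rpow_sub hρ, Real.rpow_one]
            _ ≤ _ := by gcongr; linarith
        calc 8 * S / h1 * (cb * bh * (c1 ^ (1 - 1 / μ) * R ^ (μ - 1)))
            ≤ 8 * S / h1 * (cb * 1 * (c1 ^ (1 - 1 / μ) * (ρ ^ μ / δ))) := by gcongr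
          _ = 32 * cb * c1 ^ (1 - 1 / μ) * (S * ρ ^ μ / (1 * δ ^ 2)) := by rw [hh1]; field_simp; ring
          _ ≤ _ := by gcongr; linarith
      have b3 : CH * K ^ (1 / μ) * (cb * bh * (CM * K) ^ (1 - 1 / μ)) = CH * cb * CM ^ (1 - 1 / μ) * (bh * K) := by
        rw [Real.mul_rpow hCM hK.le]
        have : K ^ (1 / μ) * K ^ (1 - 1 / μ) = K := by
          rw [← Real.rpow_add hK]; simp
        calc _ = CH * cb * CM ^ (1 - 1 / μ) * bh * (K ^ (1 / μ) * K ^ (1 - 1 / μ)) := by ring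
          _ = _ := by rw [this]; ring
      have b4 : (CL / δ * (8 * S / h) + CL * S / δ ^ 2) * (c1 * R ^ μ) ≤ 9 * CL * c1 * (S * ρ ^ μ / (θ * δ ^ 2)) := by
        have k1 : R ^ μ ≤ ρ ^ μ := Real.rpow_le_rpow hR0.le hRρ hμ0.le
        have k2 : CL / δ * (8 * S / h) + CL * S / δ ^ 2 ≤ 9 * CL * S / (θ * δ ^ 2) := by
          have : CL * S / (1 * δ ^ 2) ≤ CL * S / (θ * δ ^ 2) := by gcongr; linarith
          rw [one_mul] at this
          have e : CL / δ * (8 * S / h) = 8 * (CL * S / (θ * δ ^ 2)) := by rw [hh]; field_simp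
          rw [e, show 9 * CL * S / (θ * δ ^ 2) = 9 * (CL * S / (θ * δ ^ 2)) by ring]
          linarith
        calc _ ≤ 9 * CL * S / (θ * δ ^ 2) * (c1 * ρ ^ μ) := by gcongr
          _ = _ := by ring
      have b5 : CL / δ * (c4 * h) * (CM * K) = CL * c4 * CM * (θ * K) := by rw [hh]; field_simp
      rw [ENNReal.ofReal_rpow_of_nonneg (by positivity) hμ2.le, ← ENNReal.ofReal_mul hCM, ENNReal.ofReal_rpow_of_nonneg (by positivity) hμ2.le]
      try simp only [← hcb]
      simp only [← ENNReal.ofReal_mul (show 0 ≤ cb * bh by positivity), ← ENNReal.ofReal_mul (show 0 ≤ 8 * S / h1 by positivity),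
        ← ENNReal.ofReal_mul (show 0 ≤ CH * K ^ (1 / μ) by positivity),
        ← ENNReal.ofReal_mul (show 0 ≤ CL / δ * (8 * S / h) + CL * S / δ ^ 2 by positivity),
        ← ENNReal.ofReal_mul (show 0 ≤ CL / δ * (c4 * h) by positivity)]
      rw [← ENNReal.ofReal_add (by positivity) (by positivity), ← ENNReal.ofReal_add (by positivity) (by positivity),
        ← ENNReal.ofReal_add (by positivity) (by positivity), ← ENNReal.ofReal_add (by positivity) (by positivity)]
      refine ENNReal.ofReal_le_ofReal ?_
      rw [b3, b5]
      set X := S * ρ ^ μ / (θ * δ ^ 2) with hX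
      have hX0 : 0 ≤ X := by positivity
      have A2 : 0 ≤ 32 * cb * c1 ^ (1 - 1 / μ) := by positivity
      have A3 : 0 ≤ CH * cb * CM ^ (1 - 1 / μ) := by positivity
      have A4 : 0 ≤ 9 * CL * c1 := by positivity
      have A5 : 0 ≤ CL * c4 * CM := by positivity
      have B1 : 0 ≤ bh * K := by positivity
      have B2 : 0 ≤ θ * K := by positivity
      have z1 : Φ ≤ Q := by rw [hQ]; linarith
      have z2 : X ≤ Q := by rw [hQ]; linarith
      have z3 : bh * K ≤ Q := by rw [hQ]; linarith
      have z4 : θ * K ≤ Q := by rw [hQ]; linarith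
      have eC : C2 * Q = Q + 32 * cb * c1 ^ (1 - 1 / μ) * Q + CH * cb * CM ^ (1 - 1 / μ) * Q + 9 * CL * c1 * Q + CL * c4 * CM * Q := by
        rw [hC2]; ring
      rw [eC]
      refine add_le_add (add_le_add (add_le_add (add_le_add z1 ?_) ?_) ?_) ?_
      · exact b2.trans (mul_le_mul_of_nonneg_left z2 A2)
      · exact mul_le_mul_of_nonneg_left z3 A3
      · exact b4.trans (mul_le_mul_of_nonneg_left z2 A4)
      · exact mul_le_mul_of_nonneg_left z4 A5
  have Hij := HCZ v hv2 hvs (C2 * Q) (by positivity) HL'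
  have mij : ∀ i j, Measurable fun x => ENNReal.ofReal |D i (D j v) x| := fun i j =>
    ((D_cont (D_C1 hv2 j) i).abs.measurable).ennreal_ofReal
  have Hs := MB.sum hp1.le Finset.univ (fun i => MB.sum hp1.le Finset.univ (fun j => Hij i j) (fun j => (mij i j).aemeasurable))
    (fun i => Finset.aemeasurable_fun_sum _ fun j _ => (mij i j).aemeasurable)
  refine Hs.mono hp0.le (Eventually.of_forall fun x => ?_) ?_
  · by_cases hx : x ∈ ball (0 : E d) r
    · rw [indicator_of_mem hx]
      unfold H2
      rw [ENNReal.ofReal_sum_of_nonneg (fun i _ => Finset.sum_nonneg fun j _ => abs_nonneg _)]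
      refine Finset.sum_le_sum fun i _ => ?_
      rw [ENNReal.ofReal_sum_of_nonneg (fun i _ => abs_nonneg _)]
      refine Finset.sum_le_sum fun j _ => ?_
      rw [hvw x hx]
    · rw [indicator_of_notMem hx]; simp
  · simp only [Finset.sum_const, Finset.card_univ, Fintype.card_fin, nsmul_eq_mul]
    rw [← mul_assoc, show (d:ℝ≥0∞) = ENNReal.ofReal d by simp, ← ENNReal.ofReal_mul (by positivity), ← ENNReal.ofReal_mul (by positivity)]
    refine ENNReal.ofReal_le_ofReal ?_
    nlinarith

end HK

namespace HK
variable {d : ℕ}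

lemma MB.limit {p l : ℝ} {G : E d → ℝ≥0∞} {a : ℕ → ℝ} {A : ℝ} (ha : Tendsto a atTop (nhds A))
    (h : ∀ n, MB p l G (ENNReal.ofReal (a n))) : MB p l G (ENNReal.ofReal A) := by
  intro z r hr
  have h1 : Tendsto (fun n => ENNReal.ofReal (a n) ^ p * ENNReal.ofReal (r ^ l)) atTop
      (nhds (ENNReal.ofReal A ^ p * ENNReal.ofReal (r ^ l))) := by
    refine ENNReal.Tendsto.mul_const ?_ (Or.inr ENNReal.ofReal_ne_top)
    exact ((ENNReal.continuous_rpow_const).tendsto _).comp (ENNReal.tendsto_ofReal ha)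
  exact ge_of_tendsto' h1 fun n => h n z r hr

lemma iter {p q μ : ℝ} (hd : 0 < d) (hpq : p.HolderConjugate q) (hp2 : p ≠ 2) (hμ : 1 < μ) (hl : 0 ≤ (d:ℝ) - p * μ) :
    ∃ bh N : ℝ, 0 < bh ∧ 0 < N ∧ ∀ w : E d → ℝ, ContDiff ℝ 2 w → (∃ N : ℝ, ∀ x, H2 w x ≤ N) →
    ∀ S ρ R₀ Φ : ℝ, 0 < ρ → ρ ≤ R₀ → 0 ≤ Φ → 
    (∀ y ∈ ball (0 : E d) (2 * ρ / 3), |w y| ≤ S) → ∀ β F : E d → ℝ≥0∞, Measurable β → Measurable F →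
    (∀ z : E d, ∀ s ∈ Ioc 0 R₀, ∫⁻ y in ball z s, β y ^ (p * μ) ≤ ENNReal.ofReal (vb d * bh ^ (p * μ) * s ^ ((d:ℝ) - p * μ))) →
    MB p ((d:ℝ) - p * μ) F (ENNReal.ofReal Φ) →
    (∀ᵐ x, x ∈ ball (0 : E d) (2 * ρ / 3) → ENNReal.ofReal |Lap w x| ≤ F x + β x * ENNReal.ofReal ‖fderiv ℝ w x‖) →
    MB p ((d:ℝ) - p * μ) (fun x => ENNReal.ofReal ((ball (0 : E d) (ρ / 3)).indicator (H2 w) x))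
      (ENNReal.ofReal (N * Φ + N * ρ ^ (μ - 2) * S)) := by
  obtain ⟨C, hC, Hstep⟩ := step hd hpq hp2 hμ hl
  have hp1 := hpq.lt
  have hp0 : 0 < p := by linarith
  have hμ0 : 0 < μ := by linarith
  have hv := vb_pos (d := d)
  set bh : ℝ := min (1 / 4) (1 / (16 * C)) with hbh
  have hb0 : 0 < bh := by positivity
  have hb1 : bh ≤ 1 / 4 := min_le_left _ _
  have hb2 : C * bh ≤ 1 / 16 := by
    have : bh ≤ 1 / (16 * C) := min_le_right _ _
    calc C * bh ≤ C * (1 / (16 * C)) := by gcongr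
      _ = _ := by field_simp
  refine ⟨bh, 18 * C + 18 * C / bh, hb0, by positivity, ?_⟩
  intro w hw ⟨N, hN⟩ S ρ R₀ Φ hρ hρR hΦ hS β F hβ hF Hb HF Heq
  have hS0 : 0 ≤ S := (abs_nonneg _).trans (hS 0 (mem_ball_self (by positivity)))
  set ρ' : ℝ := 2 * ρ / 3 with hρ'
  set P : ℝ → Prop := fun A => ∀ r, ρ / 3 ≤ r → r < ρ' →
    MB p ((d:ℝ) - p * μ) (fun x => ENNReal.ofReal ((ball (0 : E d) r).indicator (H2 w) x)) (ENNReal.ofReal (A / (ρ' - r) ^ 2)) with hP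
  set X : ℝ := C * (ρ ^ 2 * Φ + S * ρ ^ μ / bh) with hX
  have hX0 : 0 ≤ X := by positivity
  have base : ∃ A0 : ℝ, 0 < A0 ∧ P A0 := by
    set N1 := |N| + 1 with hN1
    refine ⟨N1 * (vb d ^ (1 / p) * ρ' ^ μ) * ρ ^ 2, by positivity, fun r h1 h2 => ?_⟩
    have hm : Measurable ((ball (0 : E d) ρ').indicator fun _ => (1 : ℝ≥0∞)) := measurable_const.indicator measurableSet_ball
    refine ((MB_one hp0 hμ0 hl (R := ρ') (by positivity)).const_mul hp0.le hm.aemeasurable (ENNReal.ofReal N1)).mono hp0.le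
      (Eventually.of_forall fun x => ?_) ?_
    · by_cases hx : x ∈ ball (0 : E d) r
      · rw [indicator_of_mem hx, indicator_of_mem (ball_subset_ball h2.le hx), mul_one]
        refine ENNReal.ofReal_le_ofReal ((hN x).trans ?_)
        have := le_abs_self N
        linarith
      · rw [indicator_of_notMem hx]; simp
    · rw [← ENNReal.ofReal_mul (by positivity)]
      refine ENNReal.ofReal_le_ofReal ?_
      have h3 : 0 < ρ' - r := by linarith
      rw [le_div_iff₀ (by positivity)]
      have h4 : (ρ' - r) ^ 2 ≤ ρ ^ 2 := by
        apply pow_le_pow_left₀ h3.le; linarith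
      gcongr
  have ind : ∀ A, 0 < A → P A → P (X + A / 2) := by
    intro A hA hPA r h1 h2
    set δ := ρ' - r with hδ
    have hδ0 : 0 < δ := by linarith
    have hin : ball (0 : E d) (r + δ / 2) ⊆ ball 0 ρ' := ball_subset_ball (by linarith)
    have hh := hPA (r + δ / 2) (by linarith) (by linarith)
    rw [show ρ' - (r + δ / 2) = δ / 2 by rw [hδ]; ring] at hh
    have res := Hstep w hw ⟨N, hN⟩ r δ S ρ R₀ bh bh (A / (δ / 2) ^ 2) Φ (by linarith) hδ0 (by linarith) hρR hb0 (by linarith)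
      hb0 hb1 (by positivity) hΦ (fun y hy => hS y (hin hy)) β F hβ hF Hb HF (Heq.mono fun x hx hx2 => hx (hin hx2)) hh
    refine res.mono hp0.le (Eventually.of_forall fun x => le_rfl) (ENNReal.ofReal_le_ofReal ?_)
    rw [le_div_iff₀ (by positivity)]
    have e : C * (Φ + (bh + bh) * (A / (δ / 2) ^ 2) + S * ρ ^ μ / (bh * δ ^ 2)) * δ ^ 2
        = C * (δ ^ 2 * Φ + S * ρ ^ μ / bh) + 8 * (C * bh) * A := by
      field_simp; ring
    rw [e, hX]
    have h4 : δ ^ 2 ≤ ρ ^ 2 := by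
      apply pow_le_pow_left₀ hδ0.le; linarith
    have h5 : 8 * (C * bh) * A ≤ 8 * (1 / 16) * A := by gcongr
    have h6 : C * (δ ^ 2 * Φ + S * ρ ^ μ / bh) ≤ C * (ρ ^ 2 * Φ + S * ρ ^ μ / bh) := by gcongr
    linarith
  obtain ⟨A0, hA0, hPA0⟩ := base
  have all : ∀ n : ℕ, P (2 * X + A0 / 2 ^ n) := by
    intro n
    induction n with
    | zero =>
      intro r h1 h2
      refine (hPA0 r h1 h2).mono hp0.le (Eventually.of_forall fun x => le_rfl) (ENNReal.ofReal_le_ofReal ?_)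
      gcongr
      simp; exact hX0
    | succ n ih =>
      have := ind _ (by positivity) ih
      convert this using 1
      rw [pow_succ]; field_simp; ring
  have lim := MB.limit (A := 2 * X / (ρ' - ρ / 3) ^ 2) (a := fun n : ℕ => (2 * X + A0 / 2 ^ n) / (ρ' - ρ / 3) ^ 2) (by
    refine Tendsto.div_const ?_ _
    have : Tendsto (fun n : ℕ => A0 / 2 ^ n) atTop (nhds 0) := by
      have := (tendsto_pow_atTop_nhds_zero_of_lt_one (r := (1/2:ℝ)) (by norm_num) (by norm_num)).const_mul A0
      simpa [div_eq_mul_inv] using this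
    simpa using this.const_add (2 * X)) fun n => all n (ρ / 3) le_rfl (by linarith)
  refine lim.mono hp0.le (Eventually.of_forall fun x => le_rfl) (ENNReal.ofReal_le_ofReal ?_)
  have e1 : ρ ^ (μ - 2) = ρ ^ μ / ρ ^ 2 := by
    rw [Real.rpow_sub hρ]; norm_num
  have e2 : 2 * X / (ρ' - ρ / 3) ^ 2 = 18 * C * Φ + 18 * C / bh * (ρ ^ μ / ρ ^ 2) * S := by
    rw [hX, show ρ' - ρ / 3 = ρ / 3 by rw [hρ']; ring]; field_simp; ring
  rw [e1, e2]
  have : 0 ≤ 18 * C / bh * Φ := by positivity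
  have : 0 ≤ 18 * C * (ρ ^ μ / ρ ^ 2) * S := by positivity
  nlinarith

end HK

namespace HK
variable {d : ℕ}

lemma nLp_iff {p μ r : ℝ} (hp : 0 < p) (hr : 0 < r) (x : E d) (g : E d → ℝ) (M : ℝ≥0∞) :
    ENNReal.ofReal (r ^ μ) * nLp p (ball x r) g ≤ M ↔
      ∫⁻ y in ball x r, ENNReal.ofReal (|g y| ^ p) ≤ ENNReal.ofReal (vb d * r ^ ((d:ℝ) - p * μ)) * M ^ p := by
  have hv := vb_pos (d := d)
  rw [← ENNReal.rpow_le_rpow_iff hp, nLp, ENNReal.mul_rpow_of_nonneg _ _ hp.le, ← ENNReal.rpow_mul, one_div_mul_cancel hp.ne',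
    ENNReal.rpow_one, ENNReal.ofReal_rpow_of_nonneg (by positivity) hp.le, ← Real.rpow_mul hr.le, vol_ball x hr, ← mul_assoc]
  have e : ENNReal.ofReal (r ^ (μ * p)) * (ENNReal.ofReal (vb d * r ^ (d:ℝ)))⁻¹
      = (ENNReal.ofReal (vb d * r ^ ((d:ℝ) - p * μ)))⁻¹ := by
    rw [← ENNReal.ofReal_inv_of_pos (by positivity), ← ENNReal.ofReal_inv_of_pos (by positivity), ← ENNReal.ofReal_mul (by positivity)]
    congr 1
    rw [Real.rpow_sub hr, mul_comm p μ]
    field_simp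
  rw [e, ENNReal.inv_mul_le_iff _ ENNReal.ofReal_ne_top]
  have : 0 < vb d * r ^ ((d:ℝ) - p * μ) := by positivity
  simpa using this

lemma MB_of_morrey {p μ ρ : ℝ} (hp : 0 < p) (f : E d → ℝ) (m : ℝ) (hm : 0 ≤ m)
    (hf : morrey p μ (ball (0 : E d) ρ) f ≤ ENNReal.ofReal m) :
    MB p ((d:ℝ) - p * μ) ((ball (0 : E d) ρ).indicator fun x => ENNReal.ofReal |f x|)
      (ENNReal.ofReal ((vb d * 2 ^ ((d:ℝ) - p * μ)) ^ (1 / p) * m)) := by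
  have hv := vb_pos (d := d)
  intro z r hr
  set l := (d:ℝ) - p * μ with hl
  have eF : ∀ y, ((ball (0 : E d) ρ).indicator (fun x => ENNReal.ofReal |f x|) y) ^ p
      = ENNReal.ofReal (|(ball (0 : E d) ρ).indicator f y| ^ p) := by
    intro y
    by_cases hy : y ∈ ball (0 : E d) ρ
    · rw [indicator_of_mem hy, indicator_of_mem hy, ENNReal.ofReal_rpow_of_nonneg (abs_nonneg _) hp.le]
    · rw [indicator_of_notMem hy, indicator_of_notMem hy]
      simp [hp, hp.ne']
  by_cases hne : (ball z r ∩ ball (0 : E d) ρ).Nonempty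
  · obtain ⟨x, hxz, hx⟩ := hne
    simp_rw [eF]
    have hsub : ball z r ⊆ ball x (2 * r) := by
      intro y hy
      rw [mem_ball] at *
      have := dist_triangle y z x
      rw [dist_comm z x] at this
      linarith
    have h1 : ENNReal.ofReal ((2 * r) ^ μ) * nLp p (ball x (2 * r)) ((ball (0 : E d) ρ).indicator f) ≤ ENNReal.ofReal m := by
      refine le_trans ?_ hf
      unfold morrey
      exact le_iSup_of_le (2 * r) (le_iSup_of_le (by positivity) (le_iSup_of_le x (le_iSup_of_le hx le_rfl)))
    rw [nLp_iff hp (by positivity)] at h1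
    refine (lintegral_mono_set hsub).trans (h1.trans (le_of_eq ?_))
    rw [ENNReal.ofReal_rpow_of_nonneg hm hp.le, ENNReal.ofReal_rpow_of_nonneg (by positivity) hp.le,
      ← ENNReal.ofReal_mul (by positivity), ← ENNReal.ofReal_mul (by positivity)]
    congr 1
    rw [Real.mul_rpow (by norm_num) hr.le, Real.mul_rpow (by positivity) hm, ← Real.rpow_mul (by positivity), one_div_mul_cancel hp.ne',
      Real.rpow_one]
    ring
  · have : ∫⁻ y in ball z r, ((ball (0 : E d) ρ).indicator (fun x => ENNReal.ofReal |f x|) y) ^ p = 0 := by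
      rw [setLIntegral_congr_fun (g := fun _ => 0) measurableSet_ball]
      · simp
      · intro y hy
        have hy2 : y ∉ ball (0 : E d) ρ := fun h => hne ⟨y, hy, h⟩
        simp only [indicator_of_notMem hy2]
        simp [hp]
    rw [this]; exact zero_le

lemma morrey_of_MB {p μ ρ : ℝ} (hp : 0 < p) (g : E d → ℝ) (G : E d → ℝ≥0∞) (hG : ∀ x, ENNReal.ofReal |(ball (0 : E d) ρ).indicator g x| ≤ G x)
    (K : ℝ) (hK : 0 ≤ K) (h : MB p ((d:ℝ) - p * μ) G (ENNReal.ofReal K)) :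
    morrey p μ (ball (0 : E d) ρ) g ≤ ENNReal.ofReal (vb d ^ (-(1 / p)) * K) := by
  have hv := vb_pos (d := d)
  unfold morrey
  refine iSup_le fun r => iSup_le fun hr => iSup_le fun x => iSup_le fun hx => ?_
  rw [nLp_iff hp hr]
  calc _ ≤ ∫⁻ y in ball x r, G y ^ p := by
        refine lintegral_mono fun y => ?_
        rw [← ENNReal.ofReal_rpow_of_nonneg (abs_nonneg _) hp.le]
        exact ENNReal.rpow_le_rpow (hG y) hp.le
    _ ≤ _ := h x r hr
    _ = _ := by
      rw [ENNReal.ofReal_rpow_of_nonneg (by positivity) hp.le, ENNReal.ofReal_rpow_of_nonneg (by positivity) hp.le,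
        ← ENNReal.ofReal_mul (by positivity), ← ENNReal.ofReal_mul (by positivity)]
      congr 1
      rw [Real.mul_rpow (by positivity) hK, ← Real.rpow_mul hv.le, neg_mul, one_div_mul_cancel hp.ne', Real.rpow_neg_one]
      field_simp

lemma frob_le (m : Matrix (Fin d) (Fin d) ℝ) : frob m ≤ ∑ i, ∑ j, |m i j| := by
  unfold frob
  set T := ∑ i, ∑ j, |m i j| with hT
  have hT0 : 0 ≤ T := Finset.sum_nonneg fun i _ => Finset.sum_nonneg fun j _ => abs_nonneg _
  refine Real.sqrt_le_iff.2 ⟨hT0, ?_⟩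
  have h1 : ∀ i j, |m i j| ≤ T := fun i j =>
    (Finset.single_le_sum (f := fun j => |m i j|) (fun _ _ => abs_nonneg _) (Finset.mem_univ j)).trans
      (Finset.single_le_sum (f := fun i => ∑ j, |m i j|) (fun _ _ => Finset.sum_nonneg fun _ _ => abs_nonneg _) (Finset.mem_univ i))
  calc ∑ i, ∑ j, m i j ^ 2 ≤ ∑ i, ∑ j, |m i j| * T := by
        refine Finset.sum_le_sum fun i _ => Finset.sum_le_sum fun j _ => ?_
        rw [← sq_abs, sq]
        exact mul_le_mul_of_nonneg_left (h1 i j) (abs_nonneg _)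
    _ = T ^ 2 := by simp_rw [← Finset.sum_mul]; rw [← hT, sq]

lemma trace_hess (u : E d → ℝ) (x : E d) : (hess u x).trace = Lap u x := rfl

lemma frob_hess (u : E d → ℝ) (x : E d) : frob (hess u x) ≤ H2 u x := frob_le _

lemma inner_grad (u : E d → ℝ) (x ζ : E d) : ⟪ζ, grad u x⟫ = fderiv ℝ u x ζ := by
  rw [fderiv_sum, PiLp.inner_apply]
  refine Finset.sum_congr rfl fun i _ => ?_
  simp [grad, D, ee, mul_comm]

lemma exists_w {u : E d → ℝ} {ρ : ℝ} (hρ : 0 < ρ) (hu : ContDiffOn ℝ 2 u (closedBall 0 ρ)) :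
    ∃ w : E d → ℝ, ContDiff ℝ 2 w ∧ (∃ N : ℝ, ∀ x, H2 w x ≤ N) ∧ ∀ x ∈ ball (0 : E d) (2 * ρ / 3), w =ᶠ[nhds x] u := by
  obtain ⟨C, hC, H⟩ := cutoff (d := d)
  obtain ⟨χ, hχ, h0, h1, hin, hout, -, -⟩ := H (2 * ρ / 3) (5 * ρ / 6) (by positivity) (by linarith)
  have hw : ContDiff ℝ 2 fun x => χ x * u x := by
    rw [contDiff_iff_contDiffAt]
    intro x
    by_cases hx : x ∈ ball (0 : E d) ρ
    · exact hχ.contDiffAt.mul (hu.contDiffAt (Filter.mem_of_superset (isOpen_ball.mem_nhds hx) ball_subset_closedBall))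
    · have : (fun x => χ x * u x) =ᶠ[nhds x] fun _ => 0 := by
        have hx2 : x ∈ (closedBall (0 : E d) (5 * ρ / 6))ᶜ := by
          rw [mem_compl_iff, mem_closedBall]
          rw [mem_ball] at hx
          intro h; apply hx; linarith
        filter_upwards [isClosed_closedBall.isOpen_compl.mem_nhds hx2] with y hy
        rw [hout y fun h => hy (ball_subset_closedBall h), zero_mul]
      exact contDiffAt_const.congr_of_eventuallyEq this
  have hs : HasCompactSupport fun x => χ x * u x := by
    refine HasCompactSupport.intro (isCompact_closedBall (0 : E d) ρ) fun x hx => ?_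
    rw [hout x fun h => hx (ball_subset_closedBall (ball_subset_ball (by linarith) h)), zero_mul]
  refine ⟨_, hw, ?_, ?_⟩
  · have : ∀ i j, ∃ N, ∀ x, ‖D i (D j fun x => χ x * u x) x‖ ≤ N := fun i j =>
      (D_cont (D_C1 hw j) i).bounded_above_of_compact_support (D_supp (D_supp hs j) i)
    choose N hN using this
    exact ⟨∑ i, ∑ j, N i j, fun x => Finset.sum_le_sum fun i _ => Finset.sum_le_sum fun j _ => hN i j x⟩
  · intro x hx
    filter_upwards [isOpen_ball.mem_nhds hx] with y hy
    rw [hin y hy, one_mul]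

lemma D2_congr {w u : E d → ℝ} {x : E d} (h : w =ᶠ[nhds x] u) (i j : Fin d) : D i (D j w) x = D i (D j u) x :=
  (D_congr (D_congr h j) i).eq_of_nhds

end HK

/-- Theorem 2.2 of the paper specialized to the linear equation `Δu + b·Du + f = 0`
with drift `b` in a Morrey class containing `L_d`. -/
theorem stmt_2 (d : ℕ) (hd : 2 ≤ d) :
    ∃ d₀ : ℝ, d₀ ∈ Set.Ioo ((d : ℝ) / 2) (d : ℝ) ∧
      ∀ p : ℝ, d₀ < p → p < d →
        ∀ μ : ℝ, 1 < μ → μ < (d : ℝ) / p →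
          ∃ bh ν : ℝ, 0 < bh ∧ 1 < ν ∧
            ∀ R₀ : ℝ, R₀ ∈ Set.Ioc (0 : ℝ) 1 →
              ∃ N : ℝ, 0 < N ∧
                ∀ (b : E d → E d) (u : E d → ℝ) (f : E d → ℝ) (ρ : ℝ),
                  Measurable b →
                  (∀ r ∈ Set.Ioc (0 : ℝ) R₀, ∀ z : E d,
                    ENNReal.ofReal r * nLp (p * μ) (ball z r) (fun x => ‖b x‖) ≤
                      ENNReal.ofReal bh) →
                  0 < ρ → ρ ≤ min R₀ (1 / ν) →
                  ContDiffOn ℝ 2 u (closedBall 0 ρ) →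
                  Measurable f →
                  (∀ᵐ x ∂volume, x ∈ ball (0 : E d) ρ →
                    (hess u x).trace + ⟪b x, grad u x⟫ + f x = 0) →
                  morrey p μ (ball (0 : E d) ρ) f < ⊤ →
                  morrey p μ (ball (0 : E d) (ρ / 3)) (fun x => frob (hess u x)) ≤
                    ENNReal.ofReal (N * ρ ^ (-2 : ℝ)) * morrey p μ (ball (0 : E d) ρ) u +
                      ENNReal.ofReal (N * ρ ^ (μ - 2)) *
                        (⨆ x ∈ ball (0 : E d) ρ, ENNReal.ofReal |u x|) +
                      ENNReal.ofReal N * morrey p μ (ball (0 : E d) ρ) f := by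
  refine ⟨(d:ℝ) - 1 / 2, ?_, ?_⟩
  · have : (2:ℝ) ≤ d := by exact_mod_cast hd
    constructor <;> linarith
  intro p hp hpd μ hμ hμd
  have hd2 : (2:ℝ) ≤ d := by exact_mod_cast hd
  have hp1 : 1 < p := by linarith
  have hp0 : 0 < p := by linarith
  have hμ0 : 0 < μ := by linarith
  have hp2 : p ≠ 2 := by
    rintro rfl
    have h1 : 2 < d := by exact_mod_cast hpd
    have h2 : (3:ℝ) ≤ d := by exact_mod_cast h1
    linarith
  have hl : 0 ≤ (d:ℝ) - p * μ := by
    rw [lt_div_iff₀ hp0] at hμd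
    linarith
  have hpq : p.HolderConjugate (p / (p - 1)) := Real.HolderConjugate.conjExponent hp1
  have hv := HK.vb_pos (d := d)
  obtain ⟨bh, N, hbh, hN, H⟩ := HK.iter (d := d) (by omega) hpq hp2 hμ hl
  refine ⟨bh, 2, hbh, by norm_num, fun R₀ hR₀ => ?_⟩
  set c1 : ℝ := (HK.vb d * 2 ^ ((d:ℝ) - p * μ)) ^ (1 / p) with hc1
  set c2 : ℝ := HK.vb d ^ (-(1 / p)) with hc2
  have hc1p : 0 < c1 := by positivity
  have hc2p : 0 < c2 := by positivity
  refine ⟨c2 * N * (1 + c1), by positivity, ?_⟩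
  intro b u f ρ hb Hb hρ hρR hu hf Heq hfin
  obtain ⟨w, hw, hwN, hwu⟩ := HK.exists_w hρ hu
  set m : ℝ := (morrey p μ (ball (0 : E d) ρ) f).toReal with hm
  have hm0 : 0 ≤ m := ENNReal.toReal_nonneg
  have hmm : ENNReal.ofReal m = morrey p μ (ball (0 : E d) ρ) f := ENNReal.ofReal_toReal hfin.ne
  have HF := HK.MB_of_morrey hp0 f m hm0 hmm.ge
  set sup : ℝ≥0∞ := ⨆ x ∈ ball (0 : E d) ρ, ENNReal.ofReal |u x| with hsup
  have hsupfin : sup ≠ ⊤ := by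
    obtain ⟨C, hC⟩ := (isCompact_closedBall (0 : E d) ρ).exists_bound_of_continuousOn hu.continuousOn
    refine ne_top_of_le_ne_top (ENNReal.ofReal_ne_top (r := C)) ?_
    exact iSup_le fun x => iSup_le fun hx => ENNReal.ofReal_le_ofReal (hC x (ball_subset_closedBall hx))
  set S : ℝ := sup.toReal with hS
  have hS0 : 0 ≤ S := ENNReal.toReal_nonneg
  have hSS : ENNReal.ofReal S = sup := ENNReal.ofReal_toReal hsupfin
  have huS : ∀ y ∈ ball (0 : E d) ρ, |u y| ≤ S := by
    intro y hy
    have h1 : ENNReal.ofReal |u y| ≤ sup := le_iSup₂_of_le (f := fun x (_ : x ∈ ball (0 : E d) ρ) => ENNReal.ofReal |u x|) y hy le_rfl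
    rw [← hSS] at h1
    exact (ENNReal.ofReal_le_ofReal_iff hS0).1 h1
  have hin : ball (0 : E d) (2 * ρ / 3) ⊆ ball 0 ρ := ball_subset_ball (by linarith)
  have hin2 : ball (0 : E d) (ρ / 3) ⊆ ball 0 (2 * ρ / 3) := ball_subset_ball (by linarith)
  have res := H w hw hwN S ρ R₀ (c1 * m) hρ (hρR.trans (min_le_left _ _)) (by positivity)
    (fun y hy => by rw [(hwu y hy).eq_of_nhds]; exact huS y (hin hy))
    (fun x => ENNReal.ofReal ‖b x‖) ((ball (0 : E d) ρ).indicator fun x => ENNReal.ofReal |f x|)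
    hb.norm.ennreal_ofReal (hf.abs.ennreal_ofReal.indicator measurableSet_ball) ?_ HF ?_
  · have fin := HK.morrey_of_MB (ρ := ρ / 3) hp0 (fun x => frob (hess u x)) _ (fun x => ?_) _ (by positivity) res
    · refine fin.trans ?_
      rw [← hc2, ← hmm, ← hSS]
      have e : c2 * (N * (c1 * m) + N * ρ ^ (μ - 2) * S) ≤
          c2 * N * (1 + c1) * ρ ^ (μ - 2) * S + c2 * N * (1 + c1) * m := by
        have h1 : 0 ≤ c2 * N * c1 * ρ ^ (μ - 2) * S := by positivity
        have h2 : 0 ≤ c2 * N * m := by positivity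
        linarith
      refine (ENNReal.ofReal_le_ofReal e).trans ?_
      rw [ENNReal.ofReal_add (by positivity) (by positivity), ← ENNReal.ofReal_mul (by positivity), ← ENNReal.ofReal_mul (by positivity), add_assoc]
      exact le_add_self
    · by_cases hx : x ∈ ball (0 : E d) (ρ / 3)
      · rw [indicator_of_mem hx, indicator_of_mem hx]
        refine ENNReal.ofReal_le_ofReal ?_
        rw [abs_of_nonneg (show 0 ≤ frob (hess u x) from Real.sqrt_nonneg _)]
        refine (HK.frob_hess u x).trans (le_of_eq ?_)
        unfold HK.H2
        simp_rw [HK.D2_congr (hwu x (hin2 hx))]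
      · rw [indicator_of_notMem hx]; simp
  · intro z s hs
    have h1 := Hb s hs z
    rw [show ENNReal.ofReal s = ENNReal.ofReal (s ^ (1:ℝ)) by rw [Real.rpow_one], HK.nLp_iff (by positivity) hs.1, mul_one] at h1
    calc _ = ∫⁻ y in ball z s, ENNReal.ofReal (|‖b y‖| ^ (p * μ)) := by
          refine lintegral_congr fun y => ?_
          rw [abs_norm, ENNReal.ofReal_rpow_of_nonneg (norm_nonneg _) (by positivity)]
      _ ≤ _ := h1
      _ = _ := by
          have := hs.1
          rw [ENNReal.ofReal_rpow_of_nonneg hbh.le (by positivity), ← ENNReal.ofReal_mul (by positivity)]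
          congr 1; ring
  · filter_upwards [Heq] with x hx hxb
    have h1 := hx (hin hxb)
    rw [HK.trace_hess, HK.inner_grad] at h1
    have h2 : HK.Lap w x = HK.Lap u x := by
      unfold HK.Lap
      simp_rw [HK.D2_congr (hwu x hxb)]
    have h3 : fderiv ℝ w x = fderiv ℝ u x := (hwu x hxb).fderiv_eq
    rw [h2, h3, indicator_of_mem (hin hxb), ← ENNReal.ofReal_mul (norm_nonneg _), ← ENNReal.ofReal_add (abs_nonneg _) (by positivity)]
    refine ENNReal.ofReal_le_ofReal ?_
    have h4 : HK.Lap u x = -(f x + fderiv ℝ u x (b x)) := by linarith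
    rw [h4, abs_neg]
    refine (abs_add_le _ _).trans (add_le_add le_rfl ?_)
    have := (fderiv ℝ u x).le_opNorm (b x)
    rw [Real.norm_eq_abs] at this
    linarith
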